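/- arXiv:2110.01602 — 3 statements merged into one kernel-verified Lean document; each statement's English description precedes it below -/
import Mathlib

section
/- Let n, d ≥ 1, let X = (x_1, …, x_n)^T ∈ ℝ^{n×d} and y ∈ [−1,1]^n. Define μ̂ = n^{−1} X^T y and Σ̂ = n^{−1} X^T (I_n − n^{−1} y y^T) X. If Σ̂ is positive definite, then (μ̂, Σ̂) maximizes the complete-data likelihood: for every μ ∈ ℝ^d and every positive definite Σ ∈ ℝ^{d×d}, L(μ, Σ; X, y) ≤ L(μ̂, Σ̂; X, y). -/
open Real Matrix

noncomputable section

/-- Density of the `d`-dimensional Gaussian distribution `N(μ, S)` at `x`. -/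
def gaussDensity {d : ℕ} (μ : Fin d → ℝ) (S : Matrix (Fin d) (Fin d) ℝ) (x : Fin d → ℝ) : ℝ :=
  (2 * π) ^ (-(d : ℝ) / 2) * S.det ^ (-(1 : ℝ) / 2) *
    Real.exp (-(1 / 2) * ((x - μ) ⬝ᵥ (S⁻¹ *ᵥ (x - μ))))

/-- The complete-data likelihood `L(μ, Σ; X, y)` of the two-component symmetric Gaussian
mixture model, where the rows of `X` are the data points `x_i` and `y ∈ [-1,1]^n`. -/
def likelihood {n d : ℕ} (X : Fin n → Fin d → ℝ) (y : Fin n → ℝ)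
    (μ : Fin d → ℝ) (S : Matrix (Fin d) (Fin d) ℝ) : ℝ :=
  ∏ i, ((1 / 2 * gaussDensity μ S (X i)) ^ ((1 + y i) / 2) *
        (1 / 2 * gaussDensity (-μ) S (X i)) ^ ((1 - y i) / 2))

/-- For a positive definite matrix, `log det M ≤ tr M - d`. -/
theorem Matrix.PosDef.log_det_le_trace_sub {d : ℕ} {M : Matrix (Fin d) (Fin d) ℝ}
    (hM : M.PosDef) : Real.log M.det ≤ M.trace - d := by
  rw [hM.1.det_eq_prod_eigenvalues, hM.1.trace_eq_sum_eigenvalues]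
  simp only [RCLike.ofReal_real_eq_id, id_eq]
  rw [Real.log_prod fun i _ => (hM.eigenvalues_pos i).ne']
  calc ∑ i, Real.log (hM.1.eigenvalues i) ≤ ∑ i, (hM.1.eigenvalues i - 1) :=
        Finset.sum_le_sum fun i _ => Real.log_le_sub_one_of_pos (hM.eigenvalues_pos i)
    _ = _ := by simp

open scoped MatrixOrder in
/-- The Gaussian relative entropy inequality for two positive definite matrices. -/
theorem Matrix.PosDef.log_det_add_le {d : ℕ} {S T : Matrix (Fin d) (Fin d) ℝ}
    (hS : S.PosDef) (hT : T.PosDef) :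
    Real.log T.det + d ≤ Real.log S.det + (S⁻¹ * T).trace := by
  obtain ⟨B, hB, hSB⟩ := CStarAlgebra.isStrictlyPositive_iff_eq_star_mul_self.mp
    hS.inv.isStrictlyPositive
  rw [Matrix.star_eq_conjTranspose] at hSB
  have hM : (B * T * Bᴴ).PosDef := by
    have := hT.conjTranspose_mul_mul_same (B := Bᴴ)
      (Matrix.mulVec_injective_of_isUnit hB.star)
    simpa using this
  have htr : (B * T * Bᴴ).trace = (S⁻¹ * T).trace := by
    rw [Matrix.trace_mul_comm, ← Matrix.mul_assoc, ← hSB]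
  have hdet : (B * T * Bᴴ).det = S.det⁻¹ * T.det := by
    have := congrArg Matrix.det hSB
    rw [Matrix.det_nonsing_inv, Ring.inverse_eq_inv', Matrix.det_mul] at this
    rw [Matrix.det_mul, Matrix.det_mul, this]
    ring
  have h := hM.log_det_le_trace_sub
  rw [htr, hdet, Real.log_mul (inv_ne_zero hS.det_pos.ne') hT.det_pos.ne', Real.log_inv] at h
  linarith

theorem Matrix.IsSymm.dotProduct_mulVec_comm {d : ℕ} {A : Matrix (Fin d) (Fin d) ℝ}
    (hA : A.IsSymm) (u v : Fin d → ℝ) : u ⬝ᵥ (A *ᵥ v) = v ⬝ᵥ (A *ᵥ u) := by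
  rw [Matrix.dotProduct_mulVec, ← Matrix.mulVec_transpose, hA.eq, dotProduct_comm]

theorem gaussDensity_pos {d : ℕ} (μ : Fin d → ℝ) {S : Matrix (Fin d) (Fin d) ℝ}
    (hS : S.PosDef) (x : Fin d → ℝ) : 0 < gaussDensity μ S x := by
  have := hS.det_pos
  unfold gaussDensity
  positivity

theorem log_half_mul_gaussDensity {d : ℕ} (μ : Fin d → ℝ) {S : Matrix (Fin d) (Fin d) ℝ}
    (hS : S.PosDef) (x : Fin d → ℝ) :
    Real.log (1 / 2 * gaussDensity μ S x) =
      Real.log (1 / 2) - d / 2 * Real.log (2 * π) - 1 / 2 * Real.log S.det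
        - 1 / 2 * ((x - μ) ⬝ᵥ (S⁻¹ *ᵥ (x - μ))) := by
  have hdet := hS.det_pos
  have hpi : 0 < 2 * π := by positivity
  rw [Real.log_mul (by norm_num) (gaussDensity_pos μ hS x).ne', gaussDensity,
    Real.log_mul (by positivity) (by positivity), Real.log_mul (by positivity) (by positivity),
    Real.log_rpow hpi, Real.log_rpow hdet, Real.log_exp]
  ring

theorem likelihood_pos {n d : ℕ} (X : Fin n → Fin d → ℝ) (y : Fin n → ℝ)
    (μ : Fin d → ℝ) {S : Matrix (Fin d) (Fin d) ℝ} (hS : S.PosDef) :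
    0 < likelihood X y μ S :=
  Finset.prod_pos fun i _ => by
    have h₁ := gaussDensity_pos μ hS (X i)
    have h₂ := gaussDensity_pos (-μ) hS (X i)
    positivity

theorem log_likelihood {n d : ℕ} (X : Fin n → Fin d → ℝ) (y : Fin n → ℝ)
    (μ : Fin d → ℝ) {S : Matrix (Fin d) (Fin d) ℝ} (hS : S.PosDef) :
    Real.log (likelihood X y μ S) =
      n * (Real.log (1 / 2) - d / 2 * Real.log (2 * π) - 1 / 2 * Real.log S.det)
        - 1 / 2 * ∑ i, (X i ⬝ᵥ (S⁻¹ *ᵥ X i) - 2 * (y i * (X i ⬝ᵥ (S⁻¹ *ᵥ μ)))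
          + μ ⬝ᵥ (S⁻¹ *ᵥ μ)) := by
  have hsymm : S⁻¹.IsSymm := by simpa using hS.inv.1
  have hterm (i : Fin n) :
      0 < (1 / 2 * gaussDensity μ S (X i)) ^ ((1 + y i) / 2) ∧
        0 < (1 / 2 * gaussDensity (-μ) S (X i)) ^ ((1 - y i) / 2) := by
    have h₁ := gaussDensity_pos μ hS (X i)
    have h₂ := gaussDensity_pos (-μ) hS (X i)
    constructor <;> positivity
  rw [likelihood, Real.log_prod fun i _ => (mul_pos (hterm i).1 (hterm i).2).ne',
    Finset.mul_sum]
  have hconst (c : ℝ) : (n : ℝ) * c = ∑ _i : Fin n, c := by simp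
  rw [hconst, ← Finset.sum_sub_distrib]
  refine Finset.sum_congr rfl fun i _ => ?_
  rw [Real.log_mul (hterm i).1.ne' (hterm i).2.ne',
    Real.log_rpow (mul_pos (by norm_num) (gaussDensity_pos μ hS (X i))),
    Real.log_rpow (mul_pos (by norm_num) (gaussDensity_pos (-μ) hS (X i))),
    log_half_mul_gaussDensity μ hS, log_half_mul_gaussDensity (-μ) hS]
  simp only [sub_neg_eq_add, Matrix.mulVec_sub, Matrix.mulVec_add, dotProduct_sub,
    dotProduct_add, sub_dotProduct, add_dotProduct, hsymm.dotProduct_mulVec_comm μ (X i)]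
  ring

theorem Matrix.trace_mul_transpose_mul_self {n d : ℕ} (A : Matrix (Fin d) (Fin d) ℝ)
    (X : Fin n → Fin d → ℝ) :
    (A * ((Matrix.of X)ᵀ * Matrix.of X)).trace = ∑ i, X i ⬝ᵥ (A *ᵥ X i) := by
  rw [← Matrix.mul_assoc, Matrix.trace_mul_comm]
  rfl

theorem Matrix.trace_mul_vecMulVec {d : ℕ} (A : Matrix (Fin d) (Fin d) ℝ) (u v : Fin d → ℝ) :
    (A * Matrix.vecMulVec u v).trace = v ⬝ᵥ (A *ᵥ u) := by
  rw [Matrix.mul_vecMulVec, Matrix.trace_vecMulVec, dotProduct_comm]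

/-- Decomposition of the quadratic part of the log-likelihood around the sample estimates. -/
theorem sum_quadratic_eq {n d : ℕ} (hn : 1 ≤ n) (X : Fin n → Fin d → ℝ) (y : Fin n → ℝ)
    {A : Matrix (Fin d) (Fin d) ℝ} (hA : A.IsSymm) (μ μhat : Fin d → ℝ)
    (Sig : Matrix (Fin d) (Fin d) ℝ)
    (hμhat : μhat = (n : ℝ)⁻¹ • ((Matrix.of X)ᵀ *ᵥ y))
    (hSig : Sig = (n : ℝ)⁻¹ •
      ((Matrix.of X)ᵀ * ((1 : Matrix (Fin n) (Fin n) ℝ) - (n : ℝ)⁻¹ • Matrix.vecMulVec y y) *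
        Matrix.of X)) :
    ∑ i, (X i ⬝ᵥ (A *ᵥ X i) - 2 * (y i * (X i ⬝ᵥ (A *ᵥ μ))) + μ ⬝ᵥ (A *ᵥ μ)) =
      n * ((A * Sig).trace + (μ - μhat) ⬝ᵥ (A *ᵥ (μ - μhat))) := by
  have hn0 : (n : ℝ) ≠ 0 := by positivity
  have hv : (Matrix.of X)ᵀ *ᵥ y = (n : ℝ) • μhat := by
    rw [hμhat, smul_smul, mul_inv_cancel₀ hn0, one_smul]
  have hcross : ∑ i, y i * (X i ⬝ᵥ (A *ᵥ μ)) = n * (μhat ⬝ᵥ (A *ᵥ μ)) := by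
    rw [← smul_eq_mul, ← smul_dotProduct, ← hv, Matrix.mulVec_transpose,
      ← Matrix.dotProduct_mulVec]
    rfl
  have hSig' : Sig = (n : ℝ)⁻¹ • ((Matrix.of X)ᵀ * Matrix.of X) -
      Matrix.vecMulVec μhat μhat := by
    rw [hSig, Matrix.mul_sub, Matrix.sub_mul, Matrix.mul_one, Matrix.mul_smul, Matrix.smul_mul,
      Matrix.mul_vecMulVec, Matrix.vecMulVec_mul, ← Matrix.mulVec_transpose, hv,
      Matrix.smul_vecMulVec, Matrix.vecMulVec_smul, smul_sub]
    simp [smul_smul, hn0]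
  have htr : n * (A * Sig).trace = ∑ i, X i ⬝ᵥ (A *ᵥ X i) - n * (μhat ⬝ᵥ (A *ᵥ μhat)) := by
    rw [hSig', Matrix.mul_sub, Matrix.trace_sub, Matrix.mul_smul, Matrix.trace_smul,
      Matrix.trace_mul_transpose_mul_self, Matrix.trace_mul_vecMulVec, smul_eq_mul]
    field_simp
  rw [Finset.sum_add_distrib, Finset.sum_sub_distrib, ← Finset.mul_sum, hcross, mul_add, htr]
  simp only [Matrix.mulVec_sub, dotProduct_sub, sub_dotProduct,
    hA.dotProduct_mulVec_comm μ μhat, Finset.sum_const, Finset.card_univ, Fintype.card_fin,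
    nsmul_eq_mul]
  ring

/-- the pair `(μ̂, Σ̂) = (n⁻¹ Xᵀ y, n⁻¹ Xᵀ (I - n⁻¹ y yᵀ) X)` maximizes the
complete-data likelihood over all `μ ∈ ℝ^d` and positive definite `Σ`. -/
theorem mle_maximizes_complete_likelihood {n d : ℕ} (hn : 1 ≤ n) (hd : 1 ≤ d)
    (X : Fin n → Fin d → ℝ) (y : Fin n → ℝ) (hy : ∀ i, -1 ≤ y i ∧ y i ≤ 1)
    (μhat : Fin d → ℝ) (Sig : Matrix (Fin d) (Fin d) ℝ)
    (hμhat : μhat = (n : ℝ)⁻¹ • ((Matrix.of X)ᵀ *ᵥ y))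
    (hSig : Sig = (n : ℝ)⁻¹ •
      ((Matrix.of X)ᵀ * ((1 : Matrix (Fin n) (Fin n) ℝ) - (n : ℝ)⁻¹ • Matrix.vecMulVec y y) *
        Matrix.of X))
    (hpd : Sig.PosDef) :
    ∀ (μ : Fin d → ℝ) (S : Matrix (Fin d) (Fin d) ℝ), S.PosDef →
      likelihood X y μ S ≤ likelihood X y μhat Sig := by
  intro μ S hS
  have hsymm {T : Matrix (Fin d) (Fin d) ℝ} (hT : T.PosDef) : T⁻¹.IsSymm := by
    simpa using hT.inv.1
  rw [← Real.log_le_log_iff (likelihood_pos X y μ hS) (likelihood_pos X y μhat hpd),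
    log_likelihood X y μ hS, log_likelihood X y μhat hpd,
    sum_quadratic_eq hn X y (hsymm hS) μ μhat Sig hμhat hSig,
    sum_quadratic_eq hn X y (hsymm hpd) μhat μhat Sig hμhat hSig,
    Matrix.nonsing_inv_mul Sig hpd.det_pos.ne'.isUnit]
  have hdet := hS.log_det_add_le hpd
  have hq : 0 ≤ (μ - μhat) ⬝ᵥ (S⁻¹ *ᵥ (μ - μhat)) := by
    simpa using hS.inv.posSemidef.dotProduct_mulVec_nonneg (μ - μhat)
  have h := mul_le_mul_of_nonneg_left (add_le_add hdet hq) (Nat.cast_nonneg (α := ℝ) n)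
  simp only [Matrix.trace_one, Fintype.card_fin, sub_self, zero_dotProduct, add_zero] at h ⊢
  linarith
end
end

section
/- Let (d_n) be positive integers with (d_n log n)/n → 0 and let (SNR_n) be positive reals. For each n and each deterministic y* ∈ {±1}^n, consider the canonical model with d = d_n and SNR = SNR_n, let H = X(X^T X)^{−1} X^T (defined almost surely), and let ŷ be any measurable maximizer of y ↦ y^T H y over {±1}^n. Then: (1) if SNR_n → ∞ and SNR_n ≤ C log n for some constant C > 0, there is a sequence γ_n → 0, not depending on the choice of y*, such that sup_{y* ∈ {±1}^n} E[R(ŷ, y*)] ≤ exp(−SNR_n/(2 + γ_n)) for all n; (2) if SNR_n > (2 + ε) log n for some constant ε > 0, there is a sequence γ'_n → 0, not depending on y*, such that inf_{y* ∈ {±1}^n} P(R(ŷ, y*) = 0) ≥ 1 − γ'_n for all n. -/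
open MeasureTheory Real Matrix Filter
open scoped ENNReal

noncomputable section

/-- The one-dimensional Gaussian density with mean `m` and variance `v`. -/
def g1 (m v x : ℝ) : ℝ := (2 * π * v) ^ (-(1 : ℝ) / 2) * Real.exp (-(x - m) ^ 2 / (2 * v))

/-- Law of `X = (√(1-σ²) y⋆ + σ z, W)` in the canonical model with deterministic
`y⋆ ∈ {±1}ⁿ` and `σ = 1/√(1 + SNR)`: all entries of `X` are independent, the first column
having entries `N(√(1-σ²) y⋆_i, σ²)` and the remaining columns i.i.d. standard Gaussian. -/
def canonLaw (n d : ℕ) (ystar : Fin n → ℝ) (snr : ℝ) : Measure (Fin n → Fin d → ℝ) :=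
  volume.withDensity fun X => ENNReal.ofReal (∏ i : Fin n, ∏ j : Fin d,
    g1 (if (j : ℕ) = 0 then Real.sqrt (1 - (1 / Real.sqrt (1 + snr)) ^ 2) * ystar i else 0)
       (if (j : ℕ) = 0 then (1 / Real.sqrt (1 + snr)) ^ 2 else 1) (X i j))

/-- The matrix `H = X (XᵀX)⁻¹ Xᵀ`. -/
def Hmat {n d : ℕ} (X : Fin n → Fin d → ℝ) : Matrix (Fin n) (Fin n) ℝ :=
  Matrix.of X * ((Matrix.of X)ᵀ * Matrix.of X)⁻¹ * (Matrix.of X)ᵀ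

/-- `v` is a vector of signs ±1. -/
def isSign {m : ℕ} (v : Fin m → ℝ) : Prop := ∀ i, v i = 1 ∨ v i = -1

/-- `y` is a maximizer of the Max-Cut objective `y ↦ yᵀ H y` over `{±1}ⁿ`. -/
def isMaxCutOpt {n d : ℕ} (X : Fin n → Fin d → ℝ) (y : Fin n → ℝ) : Prop :=
  isSign y ∧ ∀ y' : Fin n → ℝ, isSign y' → y' ⬝ᵥ (Hmat X *ᵥ y') ≤ y ⬝ᵥ (Hmat X *ᵥ y)

/-- Misclassification proportion `R(a, b) = n⁻¹ min_{s = ±1} #{i : s aᵢ ≠ bᵢ}`. -/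
def misclass (n : ℕ) (a b : Fin n → ℝ) : ℝ :=
  (n : ℝ)⁻¹ * min (Nat.card {i : Fin n // a i ≠ b i} : ℝ)
                  (Nat.card {i : Fin n // -(a i) ≠ b i} : ℝ)

open ProbabilityTheory

theorem lintegral_fin_prod_eq_prod {n : ℕ} {E : Type*} [MeasurableSpace E]
    {μ : Fin n → Measure E} [∀ i, SigmaFinite (μ i)] {f : Fin n → E → ℝ≥0∞}
    (hf : ∀ i, Measurable (f i)) :
    ∫⁻ x : Fin n → E, ∏ i, f i (x i) ∂(Measure.pi μ) = ∏ i, ∫⁻ x, f i x ∂(μ i) := by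
  induction n with
  | zero => simp
  | succ n ih =>
    have h := measurePreserving_piFinSuccAbove μ 0
    rw [← h.symm.lintegral_comp_emb (MeasurableEquiv.measurableEmbedding _),
      Fin.prod_univ_succ, ← ih (μ := fun i : Fin n => μ i.succ) (f := fun i : Fin n => f i.succ)
        (fun i : Fin n => hf i.succ)]
    simp_rw [MeasurableEquiv.piFinSuccAbove_symm_apply, Fin.insertNthEquiv,
      Fin.prod_univ_succ, Fin.insertNth_zero, Equiv.coe_fn_mk, Fin.cons_succ, Fin.cons_zero]
    exact lintegral_prod_mul (hf 0).aemeasurable (Measurable.aemeasurable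
      (Finset.measurable_prod _ fun (i : Fin n) _ => (hf i.succ).comp (measurable_pi_apply i)))

/-- A product of measures with densities has the product density. -/
theorem pi_withDensity_eq {n : ℕ} {E : Type*} [MeasurableSpace E]
    {μ : Measure E} [SigmaFinite μ] {f : Fin n → E → ℝ≥0∞}
    (hf : ∀ i, Measurable (f i)) [∀ i, SigmaFinite (μ.withDensity (f i))] :
    Measure.pi (fun i => μ.withDensity (f i)) =
      (Measure.pi fun _ : Fin n => μ).withDensity fun x => ∏ i, f i (x i) := by
  refine Measure.pi_eq fun s hs => ?_
  rw [withDensity_apply _ (.univ_pi hs), Measure.restrict_pi_pi,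
    lintegral_fin_prod_eq_prod hf]
  exact Finset.prod_congr rfl fun i _ => (withDensity_apply _ (hs i)).symm

/-- Exponential Markov inequality for a sum of independent functions. -/
theorem pi_measure_sum_ge_le {n : ℕ} {E : Type*} [MeasurableSpace E]
    {μ : Measure E} [IsProbabilityMeasure μ] {f : Fin n → E → ℝ}
    (hf : ∀ i, Measurable (f i)) {c : ℝ}
    (hc : ∀ i, ∫⁻ x, ENNReal.ofReal (Real.exp (f i x)) ∂μ ≤ ENNReal.ofReal (Real.exp c))
    (a : ℝ) :
    (Measure.pi fun _ : Fin n => μ) {x | a ≤ ∑ i, f i (x i)} ≤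
      ENNReal.ofReal (Real.exp (n * c - a)) := by
  have hm : Measurable fun x : Fin n → E => ENNReal.ofReal (Real.exp (∑ i, f i (x i))) := by
    fun_prop
  have h1 := mul_meas_ge_le_lintegral (μ := Measure.pi fun _ : Fin n => μ) hm
    (ENNReal.ofReal (Real.exp a))
  have h2 : ∫⁻ x : Fin n → E, ENNReal.ofReal (Real.exp (∑ i, f i (x i)))
      ∂(Measure.pi fun _ => μ) ≤ ENNReal.ofReal (Real.exp (n * c)) := by
    simp_rw [Real.exp_sum, ENNReal.ofReal_prod_of_nonneg (fun _ _ => (Real.exp_pos _).le)]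
    rw [lintegral_fin_prod_eq_prod (f := fun i x => ENNReal.ofReal (Real.exp (f i x)))
      (fun i => by have := hf i; fun_prop)]
    calc _ ≤ ∏ i : Fin n, ENNReal.ofReal (Real.exp c) := Finset.prod_le_prod' fun i _ => hc i
      _ = _ := by
        rw [Finset.prod_const, Finset.card_univ, Fintype.card_fin,
          ← ENNReal.ofReal_pow (Real.exp_pos _).le, ← Real.exp_nat_mul]
  have h3 : {x : Fin n → E | a ≤ ∑ i, f i (x i)} =
      {x | ENNReal.ofReal (Real.exp a) ≤ ENNReal.ofReal (Real.exp (∑ i, f i (x i)))} := by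
    ext x
    simp [ENNReal.ofReal_le_ofReal_iff (Real.exp_pos _).le]
  rw [h3, Real.exp_sub, ENNReal.ofReal_div_of_pos (Real.exp_pos _)]
  rw [ENNReal.le_div_iff_mul_le (by simp [Real.exp_pos]) (by simp), mul_comm]
  exact h1.trans h2

/-- The standard Gaussian measure on `ι → ℝ`. -/
abbrev stdPi (ι : Type*) [Fintype ι] : Measure (ι → ℝ) := Measure.pi fun _ => gaussianReal 0 1

theorem map_linear_stdPi {ι : Type*} [Fintype ι] (c : ι → ℝ) :
    (stdPi ι).map (fun x => ∑ j, c j * x j) = gaussianReal 0 (∑ j, c j ^ 2).toNNReal := by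
  have hm : Measurable fun x : ι → ℝ => ∑ j, c j * x j := by fun_prop
  have : IsProbabilityMeasure ((stdPi ι).map (fun x => ∑ j, c j * x j)) :=
    Measure.isProbabilityMeasure_map hm.aemeasurable
  refine Measure.ext_of_charFun ?_
  ext t
  rw [charFun_gaussianReal, charFun_apply_real, integral_map hm.aemeasurable (by fun_prop)]
  have h : ∀ x : ι → ℝ, Complex.exp (t * ((∑ j, c j * x j : ℝ) : ℂ) * Complex.I) =
      ∏ j, Complex.exp (((t * c j : ℝ) : ℂ) * (x j : ℂ) * Complex.I) := by
    intro x
    rw [← Complex.exp_sum]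
    congr 1
    push_cast
    rw [Finset.mul_sum, Finset.sum_mul]
    exact Finset.sum_congr rfl fun j _ => by ring
  simp_rw [h]
  rw [integral_fintype_prod_eq_prod (fun j (y : ℝ) =>
    Complex.exp (((t * c j : ℝ) : ℂ) * (y : ℂ) * Complex.I))]
  simp_rw [← charFun_apply_real, charFun_gaussianReal]
  rw [← Complex.exp_sum, Real.coe_toNNReal _ (Finset.sum_nonneg fun j _ => sq_nonneg _)]
  congr 1
  push_cast
  simp only [mul_zero, zero_mul, zero_sub, Finset.sum_neg_distrib]
  rw [Finset.sum_mul, Finset.sum_div]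
  congr 1
  exact Finset.sum_congr rfl fun j _ => by ring

theorem lintegral_linear_stdPi {ι : Type*} [Fintype ι] (c : ι → ℝ) {g : ℝ → ℝ≥0∞}
    (hg : Measurable g) :
    ∫⁻ x, g (∑ j, c j * x j) ∂(stdPi ι) = ∫⁻ x, g x ∂(gaussianReal 0 (∑ j, c j ^ 2).toNNReal) := by
  rw [← map_linear_stdPi, lintegral_map hg (by fun_prop)]

theorem lintegral_exp_gaussianReal (v : NNReal) (t : ℝ) :
    ∫⁻ x, ENNReal.ofReal (Real.exp (t * x)) ∂(gaussianReal 0 v) =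
      ENNReal.ofReal (Real.exp (v * t ^ 2 / 2)) := by
  rw [← ofReal_integral_eq_lintegral_ofReal (integrable_exp_mul_gaussianReal t)
    (ae_of_all _ fun x => (Real.exp_pos _).le)]
  have := congrFun (mgf_fun_id_gaussianReal (μ := 0) (v := v)) t
  rw [mgf] at this
  rw [this]; simp

theorem lintegral_exp_linear_stdPi_le {ι : Type*} [Fintype ι] (c : ι → ℝ)
    (hc : ∑ j, c j ^ 2 ≤ 1) (t : ℝ) :
    ∫⁻ x, ENNReal.ofReal (Real.exp (t * ∑ j, c j * x j)) ∂(stdPi ι) ≤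
      ENNReal.ofReal (Real.exp (t ^ 2 / 2)) := by
  rw [lintegral_linear_stdPi c (g := fun y => ENNReal.ofReal (Real.exp (t * y))) (by fun_prop),
    lintegral_exp_gaussianReal, Real.coe_toNNReal _ (Finset.sum_nonneg fun j _ => sq_nonneg _)]
  gcongr
  nlinarith [sq_nonneg t]

theorem lintegral_gaussianReal_eq {v : NNReal} (hv : v ≠ 0) {g : ℝ → ℝ≥0∞} (hg : Measurable g) :
    ∫⁻ x, g x ∂(gaussianReal 0 v) = ∫⁻ x, gaussianPDF 0 v x * g x := by
  rw [gaussianReal_of_var_ne_zero _ hv,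
    lintegral_withDensity_eq_lintegral_mul _ (measurable_gaussianPDF 0 v) hg]
  rfl

theorem lintegral_exp_sq_gaussianReal :
    ∫⁻ x, ENNReal.ofReal (Real.exp (x ^ 2 / 4)) ∂(gaussianReal 0 1) = ENNReal.ofReal √2 := by
  rw [lintegral_gaussianReal_eq one_ne_zero (by fun_prop)]
  have h : ∀ x : ℝ, gaussianPDF 0 1 x * ENNReal.ofReal (Real.exp (x ^ 2 / 4)) =
      ENNReal.ofReal √2 * gaussianPDF 0 2 x := by
    intro x
    rw [gaussianPDF, gaussianPDF, ← ENNReal.ofReal_mul (gaussianPDFReal_nonneg _ _ _),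
      ← ENNReal.ofReal_mul (Real.sqrt_nonneg _)]
    congr 1
    simp only [gaussianPDFReal, NNReal.coe_one, sub_zero, NNReal.coe_ofNat, mul_one]
    rw [mul_assoc, ← Real.exp_add, show 2 * π * 2 = 2 * (2 * π) by ring,
      Real.sqrt_mul (by norm_num) (2 * π), mul_inv, ← mul_assoc, ← mul_assoc,
      mul_inv_cancel₀ (by positivity), one_mul]
    congr 2
    ring
  simp_rw [h]
  rw [lintegral_const_mul _ (measurable_gaussianPDF 0 2),
    lintegral_gaussianPDF_eq_one _ two_ne_zero, mul_one]

theorem lintegral_exp_sq_gaussianReal_le {v : ℝ} (hv : v ≤ 2) :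
    ∫⁻ x, ENNReal.ofReal (Real.exp (x ^ 2 / 8)) ∂(gaussianReal 0 v.toNNReal) ≤ 2 := by
  have h1 : gaussianReal 0 v.toNNReal = (gaussianReal 0 1).map (fun x => √v * x) := by
    rw [gaussianReal_map_const_mul]
    congr 1
    · simp
    · ext
      simp [Real.coe_toNNReal']
      rcases le_total 0 v with h | h
      · rw [Real.sq_sqrt h, max_eq_left h]
      · rw [Real.sqrt_eq_zero_of_nonpos h, max_eq_right h]; simp
  rw [h1, lintegral_map (by fun_prop) (by fun_prop)]
  calc _ ≤ ∫⁻ x, ENNReal.ofReal (Real.exp (x ^ 2 / 4)) ∂(gaussianReal 0 1) := by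
        refine lintegral_mono fun x => ?_
        gcongr ENNReal.ofReal (Real.exp ?_)
        rw [mul_pow]
        have : √v ^ 2 ≤ 2 := by
          rcases le_total 0 v with h | h
          · rwa [Real.sq_sqrt h]
          · rw [Real.sqrt_eq_zero_of_nonpos h]; norm_num
        nlinarith [sq_nonneg x]
    _ ≤ 2 := by
        rw [lintegral_exp_sq_gaussianReal]
        rw [← ENNReal.ofReal_ofNat 2]
        gcongr
        rw [Real.sqrt_le_left (by norm_num)]; norm_num

theorem gaussianReal_interval_le {v : ℝ} (hv : 1 / 2 ≤ v) (t : ℝ) {k : ℝ} :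
    gaussianReal 0 v.toNNReal {x | |x - t| ≤ k} ≤ ENNReal.ofReal (2 * k) := by
  have hv0 : v.toNNReal ≠ 0 := by
    simp; linarith
  have hs : {x : ℝ | |x - t| ≤ k} = Set.Icc (t - k) (t + k) := by
    ext x
    rw [Set.mem_ofPred_eq, abs_le, Set.mem_Icc]
    constructor <;> rintro ⟨_, _⟩ <;> constructor <;> linarith
  rw [gaussianReal_apply _ hv0, hs]
  calc _ ≤ ∫⁻ x in Set.Icc (t - k) (t + k), 1 := by
        refine lintegral_mono fun x => ?_
        rw [gaussianPDF, ← ENNReal.ofReal_one]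
        refine ENNReal.ofReal_le_ofReal ?_
        rw [gaussianPDFReal, Real.coe_toNNReal _ (by linarith)]
        have h1 : (√(2 * π * v))⁻¹ ≤ 1 := by
          refine inv_le_one_of_one_le₀ ?_
          rw [Real.one_le_sqrt]
          nlinarith [Real.pi_gt_three]
        have h2 : Real.exp (-(x - 0) ^ 2 / (2 * v)) ≤ 1 := by
          rw [Real.exp_le_one_iff]
          have : 0 ≤ (x - 0) ^ 2 / (2 * v) := by positivity
          rw [neg_div]; linarith
        exact mul_le_one₀ h1 (Real.exp_pos _).le h2
    _ = _ := by rw [setLIntegral_one, Real.volume_Icc]; ring_nf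

/-- Indices of the noise columns of the canonical model. -/
abbrev NoiseIdx (d : ℕ) : Type := {j : Fin d // ¬ (j : ℕ) = 0}

/-- The law of the pair `(W, z)` of standard Gaussian noises. -/
abbrev noiseLaw (n : ℕ) (ι : Type*) [Fintype ι] : Measure ((Fin n → ι → ℝ) × (Fin n → ℝ)) :=
  (Measure.pi fun _ : Fin n => stdPi ι).prod (stdPi (Fin n))

/-- The data matrix with signal coefficient `a`, noise level `σ` and noises `(W, z)`. -/
def dataMatrix {n d : ℕ} (y : Fin n → ℝ) (a σ : ℝ)
    (p : (Fin n → NoiseIdx d → ℝ) × (Fin n → ℝ)) : Fin n → Fin d → ℝ :=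
  fun i j => if h : (j : ℕ) = 0 then a * y i + σ * p.2 i else p.1 i ⟨j, h⟩

theorem measurable_dataMatrix {n d : ℕ} (y : Fin n → ℝ) (a σ : ℝ) :
    Measurable (dataMatrix (d := d) y a σ) := by
  refine measurable_pi_lambda _ fun i => measurable_pi_lambda _ fun j => ?_
  unfold dataMatrix
  split_ifs <;> fun_prop

theorem g1_eq_gaussianPDFReal (m x : ℝ) (v : NNReal) : g1 m v x = gaussianPDFReal m v x := by
  rw [g1, gaussianPDFReal, Real.sqrt_eq_rpow, ← Real.rpow_neg (by positivity), neg_div]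

theorem withDensity_g1_eq_pi (n d : ℕ) (m : Fin n → Fin d → ℝ) (v : Fin d → NNReal)
    (hv : ∀ j, v j ≠ 0) :
    (volume.withDensity fun X : Fin n → Fin d → ℝ =>
      ENNReal.ofReal (∏ i, ∏ j, g1 (m i j) (v j) (X i j))) =
    Measure.pi fun i => Measure.pi fun j => gaussianReal (m i j) (v j) := by
  have h1 : ∀ i, (Measure.pi fun j => gaussianReal (m i j) (v j)) =
      (volume : Measure (Fin d → ℝ)).withDensity fun x => ∏ j, gaussianPDF (m i j) (v j) (x j) := by
    intro i
    have h : ∀ j, gaussianReal (m i j) (v j) = volume.withDensity (gaussianPDF (m i j) (v j)) :=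
      fun j => gaussianReal_of_var_ne_zero _ (hv j)
    have : ∀ j, SigmaFinite ((volume : Measure ℝ).withDensity (gaussianPDF (m i j) (v j))) :=
      fun j => by rw [← h j]; infer_instance
    simp_rw [h]
    rw [pi_withDensity_eq fun j => measurable_gaussianPDF _ _]
    rfl
  have : ∀ i, SigmaFinite ((volume : Measure (Fin d → ℝ)).withDensity
      fun x => ∏ j, gaussianPDF (m i j) (v j) (x j)) :=
    fun i => by rw [← h1 i]; infer_instance
  simp_rw [h1]
  rw [pi_withDensity_eq (f := fun i (x : Fin d → ℝ) => ∏ j, gaussianPDF (m i j) (v j) (x j))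
    fun i => Finset.measurable_prod _ fun j _ =>
      (measurable_gaussianPDF _ _).comp (measurable_pi_apply j)]
  congr 1
  ext X
  have hnn : ∀ i j, 0 ≤ g1 (m i j) (v j) (X i j) := fun i j => by
    rw [g1_eq_gaussianPDFReal]; exact gaussianPDFReal_nonneg _ _ _
  rw [ENNReal.ofReal_prod_of_nonneg fun i _ => Finset.prod_nonneg fun j _ => hnn i j]
  refine Finset.prod_congr rfl fun i _ => ?_
  rw [ENNReal.ofReal_prod_of_nonneg fun j _ => hnn i j]
  refine Finset.prod_congr rfl fun j _ => ?_
  rw [g1_eq_gaussianPDFReal, gaussianPDF]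

theorem pi_gaussianReal_eq_map (d : ℕ) (hd : 1 ≤ d) (m σ : ℝ) :
    (Measure.pi fun j : Fin d => gaussianReal (if (j : ℕ) = 0 then m else 0)
      (if (j : ℕ) = 0 then (σ ^ 2).toNNReal else 1)) =
    ((stdPi (NoiseIdx d)).prod (gaussianReal 0 1)).map
      (fun p (j : Fin d) => if h : (j : ℕ) = 0 then m + σ * p.2 else p.1 ⟨j, h⟩) := by
  have hm : Measurable (fun (p : (NoiseIdx d → ℝ) × ℝ) (j : Fin d) =>
      if h : (j : ℕ) = 0 then m + σ * p.2 else p.1 ⟨j, h⟩) := by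
    refine measurable_pi_lambda _ fun j => ?_
    split_ifs <;> fun_prop
  refine Measure.pi_eq fun s hs => ?_
  rw [Measure.map_apply hm (.univ_pi hs)]
  have hpre : (fun (p : (NoiseIdx d → ℝ) × ℝ) (j : Fin d) =>
      if h : (j : ℕ) = 0 then m + σ * p.2 else p.1 ⟨j, h⟩) ⁻¹' (Set.univ.pi s) =
      (Set.univ.pi fun j : NoiseIdx d => s j) ×ˢ ((fun x => m + σ * x) ⁻¹' (s ⟨0, hd⟩)) := by
    ext p
    simp only [Set.mem_preimage, Set.mem_pi, Set.mem_univ, forall_true_left, Set.mem_prod]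
    constructor
    · intro h
      exact ⟨fun j => by simpa [j.2] using h j, by simpa using h ⟨0, hd⟩⟩
    · rintro ⟨h1, h2⟩ j
      by_cases hj : (j : ℕ) = 0
      · have : j = ⟨0, hd⟩ := Fin.ext hj
        subst this; simpa using h2
      · simpa [hj] using h1 ⟨j, hj⟩
  have hmap : (gaussianReal 0 1).map (fun x => m + σ * x) = gaussianReal m (σ ^ 2).toNNReal := by
    have : (fun x : ℝ => m + σ * x) = (fun x => m + x) ∘ (fun x => σ * x) := rfl
    rw [this, ← Measure.map_map (by fun_prop) (by fun_prop), gaussianReal_map_const_mul,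
      gaussianReal_map_const_add]
    congr 1
    · simp
    · ext; simp [Real.coe_toNNReal _ (sq_nonneg σ)]
  rw [hpre, Measure.prod_prod, Measure.pi_pi, ← Measure.map_apply (by fun_prop) (hs _), hmap,
    ← Fintype.prod_subtype_mul_prod_subtype (fun j : Fin d => (j : ℕ) = 0), mul_comm]
  have : Unique {j : Fin d // (j : ℕ) = 0} :=
    ⟨⟨⟨⟨0, hd⟩, rfl⟩⟩, fun j => Subtype.ext (Fin.ext j.2)⟩
  congr 1
  · rw [Fintype.prod_unique]
    have h0 : (default : {j : Fin d // (j : ℕ) = 0}) = ⟨⟨0, hd⟩, rfl⟩ := Subsingleton.elim _ _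
    rw [h0]; simp
  · refine Finset.prod_congr rfl fun j _ => ?_
    simp [j.2]

theorem canonLaw_eq_map (n d : ℕ) (hd : 1 ≤ d) (y : Fin n → ℝ) {snr : ℝ} (hs : 0 < snr) :
    canonLaw n d y snr = (noiseLaw n (NoiseIdx d)).map
      (dataMatrix y (√(1 - (1 / √(1 + snr)) ^ 2)) (1 / √(1 + snr))) := by
  set σ := 1 / √(1 + snr) with hσ
  set a := √(1 - σ ^ 2)
  have hσ0 : 0 < σ := by positivity
  have h1 := withDensity_g1_eq_pi n d (fun i j => if (j : ℕ) = 0 then a * y i else 0)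
    (fun j => if (j : ℕ) = 0 then (σ ^ 2).toNNReal else 1) (fun j => by
      split_ifs
      · rw [Ne, Real.toNNReal_eq_zero]; have : 0 < σ ^ 2 := by positivity
        linarith
      · exact one_ne_zero)
  have h2 : ∀ j : Fin d, ((if (j : ℕ) = 0 then (σ ^ 2).toNNReal else 1 : NNReal) : ℝ) =
      if (j : ℕ) = 0 then σ ^ 2 else 1 := fun j => by
    split_ifs
    · exact Real.coe_toNNReal _ (sq_nonneg σ)
    · rfl
  simp_rw [h2] at h1
  rw [canonLaw, h1]
  simp_rw [fun i => pi_gaussianReal_eq_map d hd (a * y i) σ]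
  have hmeas : ∀ i, Measurable (fun (p : (NoiseIdx d → ℝ) × ℝ) (j : Fin d) =>
      if h : (j : ℕ) = 0 then a * y i + σ * p.2 else p.1 ⟨j, h⟩) := fun i => by
    refine measurable_pi_lambda _ fun j => ?_
    split_ifs <;> fun_prop
  have hprob : ∀ i, IsProbabilityMeasure (((stdPi (NoiseIdx d)).prod (gaussianReal 0 1)).map
      (fun (p : (NoiseIdx d → ℝ) × ℝ) (j : Fin d) =>
      if h : (j : ℕ) = 0 then a * y i + σ * p.2 else p.1 ⟨j, h⟩)) :=
    fun i => Measure.isProbabilityMeasure_map (hmeas i).aemeasurable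
  rw [← Measure.pi_map_pi fun i => (hmeas i).aemeasurable]
  have h3 := (measurePreserving_arrowProdEquivProdArrow (NoiseIdx d → ℝ) ℝ (Fin n)
    (fun _ => stdPi (NoiseIdx d)) (fun _ => gaussianReal 0 1)).map_eq
  rw [noiseLaw, stdPi, ← h3, Measure.map_map (measurable_dataMatrix y a σ)
    (MeasurableEquiv.measurable _)]
  rfl

/-- The matrix `M (MᵀM)⁻¹ Mᵀ`, the orthogonal projection onto the column space of `M`. -/
def colProj {n : ℕ} {κ : Type*} [Fintype κ] [DecidableEq κ] (M : Matrix (Fin n) κ ℝ) :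
    Matrix (Fin n) (Fin n) ℝ := M * (Mᵀ * M)⁻¹ * Mᵀ

section Projection

variable {n : ℕ} {κ : Type*} [Fintype κ] [DecidableEq κ] (M : Matrix (Fin n) κ ℝ)

theorem colProj_transpose : (colProj M)ᵀ = colProj M := by
  simp [colProj, Matrix.transpose_mul, Matrix.transpose_nonsing_inv, Matrix.mul_assoc]

theorem colProj_mulVec (v : Fin n → ℝ) :
    colProj M *ᵥ v = M *ᵥ ((Mᵀ * M)⁻¹ *ᵥ (Mᵀ *ᵥ v)) := by
  simp [colProj, Matrix.mulVec_mulVec, Matrix.mul_assoc]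

variable {M}

theorem isUnit_det_transpose_mul (hM : ∀ b, M *ᵥ b = 0 → b = 0) : IsUnit (Mᵀ * M).det := by
  rw [← Matrix.isUnit_iff_isUnit_det, ← Matrix.mulVec_injective_iff_isUnit]
  refine (injective_iff_map_eq_zero (Matrix.mulVecLin (Mᵀ * M))).2 fun b hb => hM b ?_
  rw [Matrix.mulVecLin_apply] at hb
  rw [← dotProduct_self_eq_zero, Matrix.dotProduct_mulVec, Matrix.vecMul_mulVec,
    ← Matrix.dotProduct_mulVec, hb, dotProduct_zero]

theorem colProj_mul (hM : ∀ b, M *ᵥ b = 0 → b = 0) : colProj M * M = M := by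
  rw [colProj, Matrix.mul_assoc, Matrix.mul_assoc,
    Matrix.nonsing_inv_mul _ (isUnit_det_transpose_mul hM), Matrix.mul_one]

theorem colProj_mulVec_mulVec (hM : ∀ b, M *ᵥ b = 0 → b = 0) (b : κ → ℝ) :
    colProj M *ᵥ (M *ᵥ b) = M *ᵥ b := by
  rw [Matrix.mulVec_mulVec, colProj_mul hM]

theorem dotProduct_colProj_comm (u v : Fin n → ℝ) :
    u ⬝ᵥ (colProj M *ᵥ v) = (colProj M *ᵥ u) ⬝ᵥ v := by
  rw [Matrix.dotProduct_mulVec, ← Matrix.mulVec_transpose, colProj_transpose]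

theorem dotProduct_colProj_self (hM : ∀ b, M *ᵥ b = 0 → b = 0) (v : Fin n → ℝ) :
    v ⬝ᵥ (colProj M *ᵥ v) = (colProj M *ᵥ v) ⬝ᵥ (colProj M *ᵥ v) := by
  rw [← dotProduct_colProj_comm]
  congr 1
  rw [colProj_mulVec M v, colProj_mulVec_mulVec hM]

theorem residual_dotProduct (hM : ∀ b, M *ᵥ b = 0 → b = 0) (v : Fin n → ℝ) (b : κ → ℝ) :
    (v - colProj M *ᵥ v) ⬝ᵥ (M *ᵥ b) = 0 := by
  rw [sub_dotProduct, ← dotProduct_colProj_comm, colProj_mulVec_mulVec hM, sub_self]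

theorem residual_le (hM : ∀ b, M *ᵥ b = 0 → b = 0) (v : Fin n → ℝ) (b : κ → ℝ) :
    v ⬝ᵥ v - v ⬝ᵥ (colProj M *ᵥ v) ≤ (v - M *ᵥ b) ⬝ᵥ (v - M *ᵥ b) := by
  have h1 := residual_dotProduct hM v b
  have h3 := dotProduct_colProj_self hM v
  have h4 : 0 ≤ (colProj M *ᵥ v - M *ᵥ b) ⬝ᵥ (colProj M *ᵥ v - M *ᵥ b) :=
    Finset.sum_nonneg fun i _ => mul_self_nonneg _
  rw [sub_dotProduct] at h1
  simp only [sub_dotProduct, dotProduct_sub] at h4 ⊢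
  have h6 := dotProduct_comm v (M *ᵥ b)
  have h7 := dotProduct_comm (colProj M *ᵥ v) (M *ᵥ b)
  linarith

theorem residual_eq (hM : ∀ b, M *ᵥ b = 0 → b = 0) (v : Fin n → ℝ) :
    (v - colProj M *ᵥ v) ⬝ᵥ (v - colProj M *ᵥ v) = v ⬝ᵥ v - v ⬝ᵥ (colProj M *ᵥ v) := by
  have h3 := dotProduct_colProj_self hM v
  have h6 := dotProduct_comm v (colProj M *ᵥ v)
  simp only [sub_dotProduct, dotProduct_sub]
  linarith

end Projection

theorem isSign.sq_eq {n : ℕ} {y : Fin n → ℝ} (hy : isSign y) (i : Fin n) : y i * y i = 1 := by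
  rcases hy i with h | h <;> simp [h]

theorem isSign.dotProduct_self {n : ℕ} {y : Fin n → ℝ} (hy : isSign y) : y ⬝ᵥ y = n := by
  simp [dotProduct, hy.sq_eq]

theorem isSign.abs_eq {n : ℕ} {y : Fin n → ℝ} (hy : isSign y) (i : Fin n) : |y i| = 1 := by
  rcases hy i with h | h <;> simp [h]

theorem isSign.neg {n : ℕ} {y : Fin n → ℝ} (hy : isSign y) : isSign (-y) := fun i => by
  rcases hy i with h | h <;> simp [h]

/-- A maximizer of the Max-Cut objective minimizes the least squares criterion jointly in the
labels and the coefficients. -/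
theorem isMaxCutOpt.exists_leastSquares {n d : ℕ} {X : Fin n → Fin d → ℝ} {y : Fin n → ℝ}
    (h : isMaxCutOpt X y) (hX : ∀ b, Matrix.of X *ᵥ b = 0 → b = 0) :
    ∃ b, ∀ y', isSign y' → ∀ b', (y - Matrix.of X *ᵥ b) ⬝ᵥ (y - Matrix.of X *ᵥ b) ≤
      (y' - Matrix.of X *ᵥ b') ⬝ᵥ (y' - Matrix.of X *ᵥ b') := by
  refine ⟨((Matrix.of X)ᵀ * Matrix.of X)⁻¹ *ᵥ ((Matrix.of X)ᵀ *ᵥ y),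
    fun y' hy' b' => le_trans ?_ (residual_le hX y' b')⟩
  rw [← colProj_mulVec, residual_eq hX y, h.1.dotProduct_self, hy'.dotProduct_self]
  exact sub_le_sub_left (h.2 y' hy') _

/-- The uniform regularity properties of the noise matrix `W` used in the analysis. -/
structure GoodNoise {n : ℕ} {ι : Type*} [Fintype ι] (W : Matrix (Fin n) ι ℝ) (y : Fin n → ℝ)
    (η δ T : ℝ) : Prop where
  smallBall : ∀ θ : ι → ℝ, θ ⬝ᵥ θ = 1 → ∀ t : ℝ,
    (Finset.card {i | |y i * (W *ᵥ θ) i - t| ≤ 1 / 64} : ℝ) ≤ n / 4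
  spread : ∀ θ : ι → ℝ, θ ⬝ᵥ θ = 1 → ∀ S : Finset (Fin n), (S.card : ℝ) ≤ η * n →
    ∑ i ∈ S, (W *ᵥ θ) i ^ 2 ≤ δ * n
  bounded : ∀ θ : ι → ℝ, θ ⬝ᵥ θ = 1 → ∑ i, (W *ᵥ θ) i ^ 2 ≤ T * n

namespace GoodNoise

variable {n : ℕ} {ι : Type*} [Fintype ι] {W : Matrix (Fin n) ι ℝ} {y : Fin n → ℝ} {η δ T : ℝ}

theorem exists_normalize (θ : ι → ℝ) (hθ : θ ≠ 0) :
    ∃ r : ℝ, 0 < r ∧ θ ⬝ᵥ θ = r ^ 2 ∧ ∃ φ : ι → ℝ, φ ⬝ᵥ φ = 1 ∧ θ = r • φ := by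
  have h0 : 0 < θ ⬝ᵥ θ := lt_of_le_of_ne (Finset.sum_nonneg fun i _ => mul_self_nonneg _)
    fun h => hθ (dotProduct_self_eq_zero.1 h.symm)
  have hr := Real.sqrt_pos.2 h0
  have hsq := Real.sq_sqrt h0.le
  refine ⟨√(θ ⬝ᵥ θ), hr, hsq.symm, (√(θ ⬝ᵥ θ))⁻¹ • θ, ?_, ?_⟩
  · rw [smul_dotProduct, dotProduct_smul, smul_eq_mul, smul_eq_mul]
    nth_rewrite 3 [← hsq]
    field_simp
  · rw [smul_smul, mul_inv_cancel₀ hr.ne', one_smul]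

theorem spread' (h : GoodNoise W y η δ T) (θ : ι → ℝ) {S : Finset (Fin n)}
    (hS : (S.card : ℝ) ≤ η * n) : ∑ i ∈ S, (W *ᵥ θ) i ^ 2 ≤ δ * (n * (θ ⬝ᵥ θ)) := by
  rcases eq_or_ne θ 0 with rfl | hθ
  · simp
  obtain ⟨r, hr, h2, φ, hφ, rfl⟩ := exists_normalize θ hθ
  have := h.spread φ hφ S hS
  simp only [Matrix.mulVec_smul, Pi.smul_apply, smul_eq_mul, mul_pow, ← Finset.mul_sum, h2]
  nlinarith [sq_nonneg r]

theorem bounded' (h : GoodNoise W y η δ T) (θ : ι → ℝ) :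
    ∑ i, (W *ᵥ θ) i ^ 2 ≤ T * (n * (θ ⬝ᵥ θ)) := by
  rcases eq_or_ne θ 0 with rfl | hθ
  · simp
  obtain ⟨r, hr, h2, φ, hφ, rfl⟩ := exists_normalize θ hθ
  have := h.bounded φ hφ
  simp only [Matrix.mulVec_smul, Pi.smul_apply, smul_eq_mul, mul_pow, ← Finset.mul_sum, h2]
  nlinarith [sq_nonneg r]

theorem two_point (h : GoodNoise W y η δ T) (θ : ι → ℝ) {t : Fin n → ℝ} {t₁ t₂ : ℝ}
    (ht : ∀ i, t i = t₁ ∨ t i = t₂) :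
    n * (θ ⬝ᵥ θ) ≤ 8192 * ∑ i, (y i * (W *ᵥ θ) i - t i) ^ 2 := by
  rcases eq_or_ne θ 0 with rfl | hθ
  · simp only [dotProduct_zero, mul_zero]
    positivity
  obtain ⟨r, hr, h2, φ, hφ, rfl⟩ := exists_normalize θ hθ
  have h3 := h.smallBall φ hφ (t₁ / r)
  have h4 := h.smallBall φ hφ (t₂ / r)
  set A : Finset (Fin n) := {i | |y i * (W *ᵥ φ) i - t₁ / r| ≤ 1 / 64}
  set B : Finset (Fin n) := {i | |y i * (W *ᵥ φ) i - t₂ / r| ≤ 1 / 64}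
  have h5 : (n : ℝ) / 2 ≤ ((A ∪ B)ᶜ.card : ℝ) := by
    have h6 : ((A ∪ B).card : ℝ) ≤ A.card + B.card := by exact_mod_cast Finset.card_union_le A B
    have h7 : ((A ∪ B)ᶜ.card : ℝ) + (A ∪ B).card = n := by
      have := Finset.card_compl_add_card (A ∪ B)
      rw [Fintype.card_fin] at this
      exact_mod_cast this
    linarith
  have h6 : ∑ i ∈ (A ∪ B)ᶜ, (r / 64) ^ 2 ≤ ∑ i, (y i * (W *ᵥ (r • φ)) i - t i) ^ 2 := by
    refine (Finset.sum_le_sum fun i hi => ?_).trans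
      (Finset.sum_le_univ_sum_of_nonneg fun i => sq_nonneg _)
    simp only [Finset.mem_compl, Finset.mem_union, not_or, A, B, Finset.mem_filter,
      Finset.mem_univ, true_and, not_le] at hi
    have key : 1 / 64 < |y i * (W *ᵥ φ) i - t i / r| := by
      rcases ht i with h | h <;> rw [h]
      exacts [hi.1, hi.2]
    have e : y i * (W *ᵥ (r • φ)) i - t i = r * (y i * (W *ᵥ φ) i - t i / r) := by
      rw [Matrix.mulVec_smul, Pi.smul_apply, smul_eq_mul]
      field_simp
    rw [e, ← sq_abs (r * _), abs_mul, abs_of_pos hr]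
    refine pow_le_pow_left₀ (by positivity) ?_ 2
    nlinarith
  rw [Finset.sum_const, nsmul_eq_mul] at h6
  rw [h2]
  nlinarith [sq_nonneg r]

theorem mulVec_sq_ge (h : GoodNoise W y η δ T) (hy : isSign y) (θ : ι → ℝ) :
    n * (θ ⬝ᵥ θ) ≤ 8192 * ∑ i, (W *ᵥ θ) i ^ 2 := by
  refine (h.two_point θ (t := 0) (t₁ := 0) (t₂ := 0) fun i => Or.inl rfl).trans (le_of_eq ?_)
  congr 1
  refine Finset.sum_congr rfl fun i _ => ?_
  have := hy.sq_eq i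
  simp only [Pi.zero_apply, sub_zero, mul_pow]
  rw [sq (y i), this, one_mul]

theorem eq_zero_of_mulVec (h : GoodNoise W y η δ T) (hy : isSign y) (hn : 0 < n) (θ : ι → ℝ)
    (hθ : W *ᵥ θ = 0) : θ = 0 := by
  have h1 := h.mulVec_sq_ge hy θ
  rw [hθ] at h1
  simp only [Pi.zero_apply, ne_eq, OfNat.ofNat_ne_zero, not_false_eq_true, zero_pow,
    Finset.sum_const_zero, mul_zero] at h1
  have h2 : 0 ≤ θ ⬝ᵥ θ := Finset.sum_nonneg fun i _ => mul_self_nonneg _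
  have h3 : (0 : ℝ) < n := by exact_mod_cast hn
  exact dotProduct_self_eq_zero.1 (by nlinarith)

theorem colProj_sq_le [DecidableEq ι] (h : GoodNoise W y η δ T) (hy : isSign y) (hn : 0 < n)
    (hδ : 0 ≤ δ) {S : Finset (Fin n)} (hS : (S.card : ℝ) ≤ η * n) {v : Fin n → ℝ}
    (hv : ∀ i, |v i| ≤ 1) (hvS : ∀ i ∉ S, v i = 0) :
    (colProj W *ᵥ v) ⬝ᵥ (colProj W *ᵥ v) ≤ 8192 * δ * S.card := by
  have hinj := h.eq_zero_of_mulVec hy hn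
  have h1 := dotProduct_colProj_self hinj v
  rw [colProj_mulVec] at h1 ⊢
  set α := (Wᵀ * W)⁻¹ *ᵥ (Wᵀ *ᵥ v)
  set x := (W *ᵥ α) ⬝ᵥ (W *ᵥ α) with hx
  have hxs : ∑ i, (W *ᵥ α) i ^ 2 = x := by simp [hx, dotProduct, sq]
  have h2 := h.mulVec_sq_ge hy α
  have h3 := h.spread' α hS
  rw [hxs] at h2
  have h4 : v ⬝ᵥ (W *ᵥ α) = ∑ i ∈ S, v i * (W *ᵥ α) i := by
    rw [dotProduct]
    exact (Finset.sum_subset (Finset.subset_univ S) fun i _ hi => by rw [hvS i hi, zero_mul]).symm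
  have h5 := Finset.sum_mul_sq_le_sq_mul_sq S v (W *ᵥ α)
  rw [← h4, h1] at h5
  have h6 : ∑ i ∈ S, v i ^ 2 ≤ S.card := by
    refine (Finset.sum_le_sum fun i _ => (sq_le_one_iff_abs_le_one _).2 (hv i)).trans ?_
    simp
  have hx0 : 0 ≤ x := Finset.sum_nonneg fun i _ => mul_self_nonneg _
  have h7 : x ^ 2 ≤ S.card * (δ * (8192 * x)) := by
    refine h5.trans (mul_le_mul h6 (h3.trans ?_) (Finset.sum_nonneg fun i _ => sq_nonneg _)
      (Nat.cast_nonneg _))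
    exact mul_le_mul_of_nonneg_left h2 hδ
  by_contra! hlt
  have h8 : 0 < x := lt_of_le_of_lt (by positivity) hlt
  nlinarith

theorem colProj_diag_le [DecidableEq ι] (h : GoodNoise W y η δ T) (hy : isSign y) (hn : 0 < n)
    (hδ : 0 ≤ δ) (hη : 1 ≤ η * n) (i : Fin n) : colProj W i i ≤ 8192 * δ := by
  have h1 := h.colProj_sq_le hy hn hδ (S := {i}) (by simpa using hη) (v := Pi.single i 1)
    (fun j => by by_cases hj : j = i <;> simp [hj])
    (fun j hj => by simp at hj; simp [hj])
  rw [← dotProduct_colProj_self (h.eq_zero_of_mulVec hy hn)] at h1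
  simpa using h1

/-- On the good event the extended design `(W, y + s z)` has full column rank. -/
theorem mulVec_ne (h : GoodNoise W y η δ T) (hn : 0 < n) (hT : 0 ≤ T) {z : Fin n → ℝ}
    (hy : isSign y) (hz : z ⬝ᵥ z ≤ 4 * n) {s : ℝ} (hs : (65536 * T + 8) * s ^ 2 < 1) (θ : ι → ℝ) :
    W *ᵥ θ ≠ y + s • z := by
  intro heq
  have h1 := h.two_point θ (t := fun _ => 1) (t₁ := 1) (t₂ := 1) fun i => Or.inl rfl
  have hzz : ∑ i, z i ^ 2 = z ⬝ᵥ z := by simp [dotProduct, sq]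
  have hyy : ∑ i, y i ^ 2 = n := by rw [← hy.dotProduct_self]; simp [dotProduct, sq]
  have h2 : ∑ i, (y i * (W *ᵥ θ) i - 1) ^ 2 = s ^ 2 * (z ⬝ᵥ z) := by
    rw [← hzz, Finset.mul_sum]
    refine Finset.sum_congr rfl fun i _ => ?_
    have h3 := hy.sq_eq i
    rw [heq]
    simp only [Pi.add_apply, Pi.smul_apply, smul_eq_mul]
    linear_combination (s ^ 2 * z i ^ 2 + 2 * s * y i * z i + y i * y i - 1) * h3
  have h4 := h.bounded' θ
  have h5 : (n : ℝ) ≤ 2 * ∑ i, (W *ᵥ θ) i ^ 2 + 2 * (s ^ 2 * (z ⬝ᵥ z)) := by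
    rw [← hyy, ← hzz, Finset.mul_sum, Finset.mul_sum, Finset.mul_sum, ← Finset.sum_add_distrib]
    refine Finset.sum_le_sum fun i _ => ?_
    rw [heq]
    simp only [Pi.add_apply, Pi.smul_apply, smul_eq_mul]
    nlinarith [sq_nonneg (y i + 2 * (s * z i))]
  have hn' : (0 : ℝ) < n := by exact_mod_cast hn
  rw [h2] at h1
  have h6 : s ^ 2 * (z ⬝ᵥ z) ≤ s ^ 2 * (4 * n) := mul_le_mul_of_nonneg_left hz (sq_nonneg s)
  have h7 : T * (n * (θ ⬝ᵥ θ)) ≤ T * (8192 * (s ^ 2 * (4 * n))) :=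
    mul_le_mul_of_nonneg_left (by linarith) hT
  nlinarith

end GoodNoise

/-- The set of misclassified indices. -/
def errSet {n : ℕ} (u y : Fin n → ℝ) : Finset (Fin n) := {i | u i ≠ y i}

theorem dotProduct_self_eq_sum_sq {ι : Type*} [Fintype ι] (v : ι → ℝ) :
    v ⬝ᵥ v = ∑ i, v i ^ 2 := by simp [dotProduct, sq]

theorem coefficient_bounds {n k b B : ℝ} (hn : 0 < n) (hk0 : 0 ≤ k) (hk : k ≤ n / 2)
    (hB0 : 0 ≤ B) (hB : 1000 * B ≤ 1)
    (h : (1 - b) ^ 2 * (n - k) + (1 + b) ^ 2 * k ≤ B * (1 + b ^ 2) * n) :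
    b ^ 2 ≤ 4 ∧ (1 - b) ^ 2 ≤ 10 * B ∧ k ≤ 5 * B * n := by
  have h11 : (1 - b) ^ 2 ≤ 2 * B * (1 + b ^ 2) := by
    have h12 : (1 - b) ^ 2 * (n / 2) ≤ (1 - b) ^ 2 * (n - k) :=
      mul_le_mul_of_nonneg_left (by linarith) (sq_nonneg _)
    have h13 : 0 ≤ (1 + b) ^ 2 * k := by positivity
    have h14 : (1 - b) ^ 2 * n ≤ (2 * B * (1 + b ^ 2)) * n := by linarith
    exact le_of_mul_le_mul_right h14 hn
  have h12 : B ≤ 1 / 1000 := by linarith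
  have h13 : B * (1 + b ^ 2) ≤ 1 / 1000 * (1 + b ^ 2) :=
    mul_le_mul_of_nonneg_right h12 (by positivity)
  have hb2 : b ≤ 2 := by by_contra! hb; nlinarith
  have hb1 : 1 / 2 ≤ b := by by_contra! hb; nlinarith
  have hb4 : b ^ 2 ≤ 4 := by nlinarith
  refine ⟨hb4, by nlinarith, ?_⟩
  have h14 : 0 ≤ (1 - b) ^ 2 * (n - k) := mul_nonneg (sq_nonneg _) (by linarith)
  have h15 : 1 * k ≤ (1 + b) ^ 2 * k := mul_le_mul_of_nonneg_right (by nlinarith) hk0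
  have h16 : B * (1 + b ^ 2) * n ≤ B * 5 * n := by gcongr; linarith
  linarith

namespace GoodNoise

variable {n : ℕ} {ι : Type*} [Fintype ι] {W : Matrix (Fin n) ι ℝ} {y : Fin n → ℝ} {η δ T : ℝ}

theorem rough_estimate (h : GoodNoise W y η δ T) (hy : isSign y) (hn : 0 < n) (hT : 0 ≤ T)
    {z : Fin n → ℝ} (hz : z ⬝ᵥ z ≤ 4 * n) {s : ℝ} {u : Fin n → ℝ} (hu : isSign u)
    (hk : ((errSet u y).card : ℝ) ≤ n / 2) {A : ℝ} (hA : A = 16 * (1 + 8192 * T))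
    (hs : 1000 * (A * s ^ 2) ≤ 1) {θ : ι → ℝ} {b : ℝ}
    (hopt : (u - W *ᵥ θ - b • (y + s • z)) ⬝ᵥ (u - W *ᵥ θ - b • (y + s • z)) ≤
      (y - (y + s • z)) ⬝ᵥ (y - (y + s • z))) :
    b ^ 2 ≤ 4 ∧ (1 - b) ^ 2 ≤ 10 * (A * s ^ 2) ∧
      ((errSet u y).card : ℝ) ≤ 5 * (A * s ^ 2) * n := by
  have hn' : (0 : ℝ) < n := by exact_mod_cast hn
  simp only [dotProduct_self_eq_sum_sq] at hopt hz
  set Z := ∑ i, z i ^ 2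
  set F := ∑ i, (u i - (W *ᵥ θ) i - b * (y i + s * z i)) ^ 2 with hF
  set k : ℝ := ((errSet u y).card : ℝ) with hkdef
  have h1 : F ≤ s ^ 2 * Z := by
    refine hopt.trans (le_of_eq ?_)
    rw [Finset.mul_sum]
    refine Finset.sum_congr rfl fun i _ => ?_
    simp only [Pi.sub_apply, Pi.add_apply, Pi.smul_apply, smul_eq_mul]
    ring
  set G := ∑ i, (u i - (W *ᵥ θ) i - b * y i) ^ 2 with hG
  have h2 : G ≤ 2 * F + 2 * (b ^ 2 * s ^ 2 * Z) := by
    rw [hG, hF, Finset.mul_sum, Finset.mul_sum, Finset.mul_sum, ← Finset.sum_add_distrib]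
    refine Finset.sum_le_sum fun i _ => ?_
    nlinarith [sq_nonneg (u i - (W *ᵥ θ) i - b * (y i + s * z i) - b * s * z i)]
  have h3 : G ≤ 8 * (s ^ 2 * (1 + b ^ 2)) * n := by
    have h4 : s ^ 2 * Z ≤ s ^ 2 * (4 * n) := mul_le_mul_of_nonneg_left hz (sq_nonneg s)
    have h5 : b ^ 2 * (s ^ 2 * Z) ≤ b ^ 2 * (s ^ 2 * (4 * n)) :=
      mul_le_mul_of_nonneg_left h4 (sq_nonneg b)
    nlinarith
  have h4 := h.two_point θ (t := fun i => u i * y i - b) (t₁ := 1 - b) (t₂ := -1 - b) fun i => by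
    rcases hu i with h | h <;> rcases hy i with h' | h' <;> simp [h, h']
  have h5 : ∑ i, (y i * (W *ᵥ θ) i - (u i * y i - b)) ^ 2 = G := by
    refine Finset.sum_congr rfl fun i _ => ?_
    rcases hy i with h' | h' <;> rw [h'] <;> ring
  rw [h5] at h4
  have h6 := h.bounded' θ
  have h7 : T * (n * (θ ⬝ᵥ θ)) ≤ T * (8192 * G) := mul_le_mul_of_nonneg_left h4 hT
  have h8 : ∑ i, (u i - b * y i) ^ 2 ≤ 2 * G + 2 * ∑ i, (W *ᵥ θ) i ^ 2 := by
    rw [hG, Finset.mul_sum, Finset.mul_sum, ← Finset.sum_add_distrib]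
    refine Finset.sum_le_sum fun i _ => ?_
    nlinarith [sq_nonneg (u i - b * y i - 2 * (W *ᵥ θ) i)]
  have h9 : ∑ i, (u i - b * y i) ^ 2 = (1 - b) ^ 2 * (n - k) + (1 + b) ^ 2 * k := by
    have e : ∀ i, (u i - b * y i) ^ 2 = (1 - b) ^ 2 + if u i ≠ y i then 4 * b else 0 := by
      intro i
      rcases hu i with h | h <;> rcases hy i with h' | h' <;> rw [h, h'] <;> norm_num <;> ring
    simp_rw [e]
    rw [Finset.sum_add_distrib, ← Finset.sum_filter, Finset.sum_const, Finset.sum_const,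
      Finset.card_univ, Fintype.card_fin, nsmul_eq_mul, nsmul_eq_mul, hkdef, errSet]
    ring
  have h10 : (1 - b) ^ 2 * (n - k) + (1 + b) ^ 2 * k ≤ A * s ^ 2 * (1 + b ^ 2) * n := by
    rw [← h9, hA]
    have h11 : T * G ≤ T * (8 * (s ^ 2 * (1 + b ^ 2)) * n) := mul_le_mul_of_nonneg_left h3 hT
    nlinarith
  have hA0 : 0 ≤ A * s ^ 2 := by
    rw [hA]; positivity
  exact coefficient_bounds hn' (Nat.cast_nonneg _) hk hA0 hs h10

theorem main_inequality [DecidableEq ι] (h : GoodNoise W y η δ T) (hy : isSign y) (hn : 0 < n)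
    (hδ : 0 ≤ δ) {z : Fin n → ℝ} {s : ℝ} (hs : 0 ≤ s) {u : Fin n → ℝ} (hu : isSign u)
    (hk : ((errSet u y).card : ℝ) ≤ η * n) {θ : ι → ℝ} {b C ε : ℝ}
    (hopt : ∀ θ', (u - W *ᵥ θ - b • (y + s • z)) ⬝ᵥ (u - W *ᵥ θ - b • (y + s • z)) ≤
      (y - W *ᵥ θ' - b • (y + s • z)) ⬝ᵥ (y - W *ᵥ θ' - b • (y + s • z)))
    (hb : |1 - b| ≤ C * s) (hC : C * s ≤ ε) (hδε : 8192 * δ ≤ ε) :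
    (1 - 2 * ε) * (errSet u y).card ≤ ∑ i ∈ errSet u y,
      (C * s * |(colProj W *ᵥ y) i| + (1 + ε) * s * |(z - colProj W *ᵥ z) i|) := by
  have hinj := h.eq_zero_of_mulVec hy hn
  set S := errSet u y with hS
  set k : ℝ := (S.card : ℝ)
  set v : Fin n → ℝ := fun i => if u i ≠ y i then y i else 0 with hv
  have hvS : ∀ i ∉ S, v i = 0 := fun i hi => by
    simp only [hS, errSet, Finset.mem_filter, Finset.mem_univ, true_and] at hi
    simp [hv, hi]
  have hvS' : ∀ i ∈ S, v i = y i := fun i hi => by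
    simp only [hS, errSet, Finset.mem_filter, Finset.mem_univ, true_and] at hi
    simp [hv, hi]
  have hv1 : ∀ i, |v i| ≤ 1 := fun i => by
    by_cases hi : i ∈ S
    · rw [hvS' i hi, hy.abs_eq]
    · simp [hvS i hi]
  have huv : u = y - (2 : ℝ) • v := by
    ext i
    simp only [Pi.sub_apply, Pi.smul_apply, smul_eq_mul, hv]
    rcases hu i with h | h <;> rcases hy i with h' | h' <;> rw [h, h'] <;> norm_num
  have hdot : ∀ w : Fin n → ℝ, w ⬝ᵥ v = ∑ i ∈ S, w i * y i := fun w => by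
    rw [dotProduct, ← Finset.sum_subset (Finset.subset_univ S) fun i _ hi => by
      rw [hvS i hi, mul_zero]]
    exact Finset.sum_congr rfl fun i hi => by rw [hvS' i hi]
  have hyv : y ⬝ᵥ v = k := by rw [hdot]; simp [hy.sq_eq, k]
  have hvv : v ⬝ᵥ v = k := by
    rw [hdot]
    rw [Finset.sum_congr rfl fun i hi => by rw [hvS' i hi, hy.sq_eq]]
    simp [k]
  have hPv := h.colProj_sq_le hy hn hδ hk hv1 hvS
  rw [← dotProduct_colProj_self hinj] at hPv
  set P := colProj W
  have hQv := residual_eq hinj v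
  set q := v - P *ᵥ v with hq
  set r := u - W *ᵥ θ - b • (y + s • z) with hr
  have h1 := hopt (θ + (2 : ℝ) • ((Wᵀ * W)⁻¹ *ᵥ (Wᵀ *ᵥ v)))
  have h2 : y - W *ᵥ (θ + (2 : ℝ) • ((Wᵀ * W)⁻¹ *ᵥ (Wᵀ *ᵥ v))) - b • (y + s • z) =
      r + (2 : ℝ) • q := by
    rw [Matrix.mulVec_add, Matrix.mulVec_smul, ← colProj_mulVec, hr, hq, huv]
    module
  rw [h2] at h1
  have h3 : r ⬝ᵥ q = (1 - b) * (k - (P *ᵥ y) ⬝ᵥ v) - b * s * ((z - P *ᵥ z) ⬝ᵥ v) - 2 * (q ⬝ᵥ q) := by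
    have h4 : q ⬝ᵥ (W *ᵥ θ) = 0 := residual_dotProduct hinj v θ
    have h5 : ∀ w : Fin n → ℝ, w ⬝ᵥ q = w ⬝ᵥ v - (P *ᵥ w) ⬝ᵥ v := fun w => by
      rw [hq, dotProduct_sub, dotProduct_colProj_comm]
    have h6 : v ⬝ᵥ q = q ⬝ᵥ q := by
      rw [hQv, hq, dotProduct_sub]
    rw [hr, huv]
    simp only [sub_dotProduct, add_dotProduct, smul_dotProduct, smul_eq_mul]
    rw [h6, dotProduct_comm (W *ᵥ θ) q, h4, h5 y, h5 z, hyv]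
    ring
  have h4 : 0 ≤ r ⬝ᵥ q + q ⬝ᵥ q := by
    simp only [add_dotProduct, dotProduct_add, smul_dotProduct, dotProduct_smul, smul_eq_mul] at h1
    have := dotProduct_comm q r
    linarith
  rw [h3, hQv, hvv] at h4
  have hk0 : 0 ≤ k := Nat.cast_nonneg _
  have h5 : ∀ w : Fin n → ℝ, |w ⬝ᵥ v| ≤ ∑ i ∈ S, |w i| := fun w => by
    rw [hdot]
    refine (Finset.abs_sum_le_sum_abs _ _).trans (le_of_eq (Finset.sum_congr rfl fun i _ => ?_))
    rw [abs_mul, hy.abs_eq, mul_one]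
  have h6 := h5 (P *ᵥ y)
  have h7 := h5 (z - P *ᵥ z)
  rw [Finset.sum_add_distrib, ← Finset.mul_sum, ← Finset.mul_sum]
  set p₁ := ∑ i ∈ S, |(P *ᵥ y) i|
  set q₁ := ∑ i ∈ S, |(z - P *ᵥ z) i|
  have hCs : 0 ≤ C * s := (abs_nonneg _).trans hb
  have h8 : (1 - b) * (k - (P *ᵥ y) ⬝ᵥ v) ≤ C * s * (k + p₁) := by
    refine (le_abs_self _).trans ?_
    rw [abs_mul]
    refine mul_le_mul hb ?_ (abs_nonneg _) hCs
    refine (abs_sub _ _).trans ?_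
    rw [abs_of_nonneg hk0]
    linarith
  have h9 : -(b * s * ((z - P *ᵥ z) ⬝ᵥ v)) ≤ (1 + ε) * s * q₁ := by
    refine (neg_le_abs _).trans ?_
    rw [abs_mul, abs_mul, abs_of_nonneg hs]
    have hb' : |b| ≤ 1 + ε := by
      have := abs_le.1 hb
      exact abs_le.2 ⟨by linarith, by linarith⟩
    exact mul_le_mul (mul_le_mul_of_nonneg_right hb' hs) h7 (abs_nonneg _)
      (mul_nonneg ((abs_nonneg _).trans hb') hs)
  have h10 : C * s * k ≤ ε * k := mul_le_mul_of_nonneg_right hC hk0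
  have h11 : 8192 * δ * k ≤ ε * k := mul_le_mul_of_nonneg_right hδε hk0
  linarith

end GoodNoise

/-- Exponential surrogate `exp (-τ²) (exp (τ x) + exp (-τ x))` for the event `τ ≤ |x|`. -/
def tailBound (τ x : ℝ) : ℝ := Real.exp (-τ ^ 2) * (Real.exp (τ * x) + Real.exp (-(τ * x)))

theorem tailBound_nonneg (τ x : ℝ) : 0 ≤ tailBound τ x := by
  unfold tailBound; positivity

theorem le_tailBound (τ x : ℝ) : τ * |x| - τ ^ 2 ≤ tailBound τ x := by
  rw [tailBound, mul_add, ← Real.exp_add, ← Real.exp_add]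
  have h1 := Real.add_one_le_exp (-τ ^ 2 + τ * x)
  have h2 := Real.add_one_le_exp (-τ ^ 2 + -(τ * x))
  have h3 := Real.exp_pos (-τ ^ 2 + τ * x)
  have h4 := Real.exp_pos (-τ ^ 2 + -(τ * x))
  rcases abs_cases x with ⟨h, _⟩ | ⟨h, _⟩ <;> rw [h] <;> linarith

theorem GoodNoise.card_errSet_le {n : ℕ} {ι : Type*} [Fintype ι] [DecidableEq ι]
    {W : Matrix (Fin n) ι ℝ} {y : Fin n → ℝ} {η δ T : ℝ} (h : GoodNoise W y η δ T)
    (hy : isSign y) (hn : 0 < n) (hT : 0 ≤ T) (hδ : 0 ≤ δ) {z : Fin n → ℝ}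
    (hz : z ⬝ᵥ z ≤ 4 * n) {u : Fin n → ℝ} (hu : isSign u)
    (hk : ((errSet u y).card : ℝ) ≤ n / 2) {A ε ρ : ℝ} (hA : A = 16 * (1 + 8192 * T))
    (hε : 0 < ε) (hε' : ε ≤ 1 / 10) (hδε : 8192 * δ ≤ ε) (hρ : 1 ≤ ρ)
    (hρε : 10 * A ≤ ε ^ 2 * ρ ^ 2) (hρη : 5 * A ≤ η * ρ ^ 2)
    (hρτ : 1 + ε ≤ ε * ρ * ((1 - 5 * ε) * ρ)) {θ : ι → ℝ} {b : ℝ}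
    (hopt : ∀ y', isSign y' → ∀ (θ' : ι → ℝ) (b' : ℝ),
      (u - W *ᵥ θ - b • (y + ρ⁻¹ • z)) ⬝ᵥ (u - W *ᵥ θ - b • (y + ρ⁻¹ • z)) ≤
      (y' - W *ᵥ θ' - b' • (y + ρ⁻¹ • z)) ⬝ᵥ (y' - W *ᵥ θ' - b' • (y + ρ⁻¹ • z))) :
    ((errSet u y).card : ℝ) ≤ ∑ i, (tailBound ρ (√(10 * A) / ε * (colProj W *ᵥ y) i) +
      tailBound ((1 - 5 * ε) * ρ) ((z - colProj W *ᵥ z) i)) := by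
  have hρ0 : 0 < ρ := by linarith
  have hA0 : 0 ≤ A := by rw [hA]; positivity
  have hsq : (ρ⁻¹) ^ 2 * ρ ^ 2 = 1 := by field_simp
  have hAs : 10 * (A * (ρ⁻¹) ^ 2) ≤ ε ^ 2 := by
    have := mul_le_mul_of_nonneg_right hρε (sq_nonneg ρ⁻¹)
    nlinarith
  obtain ⟨hb4, hb, hkn⟩ := h.rough_estimate hy hn hT hz hu hk hA (by nlinarith)
    (θ := θ) (b := b) (s := ρ⁻¹) (by simpa using hopt y hy 0 1)
  have hkη : ((errSet u y).card : ℝ) ≤ η * n := by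
    refine hkn.trans (mul_le_mul_of_nonneg_right ?_ (Nat.cast_nonneg _))
    have := mul_le_mul_of_nonneg_right hρη (sq_nonneg ρ⁻¹)
    nlinarith
  have hC : √(10 * A) * ρ⁻¹ = √(10 * (A * (ρ⁻¹) ^ 2)) := by
    rw [← mul_assoc, Real.sqrt_mul (x := 10 * A) (by positivity) (ρ⁻¹ ^ 2),
      Real.sqrt_sq (by positivity)]
  have hmain := h.main_inequality hy hn hδ (s := ρ⁻¹) (by positivity) hu hkη
    (fun θ' => hopt y hy θ' b) (C := √(10 * A)) (ε := ε)
    (by rw [hC]; exact Real.abs_le_sqrt hb)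
    (by rw [hC]; exact Real.sqrt_le_iff.2 ⟨hε.le, hAs⟩) hδε
  set S := errSet u y
  set τ := (1 - 5 * ε) * ρ with hτ
  set p := colProj W *ᵥ y
  set q := z - colProj W *ᵥ z
  have hτ0 : 0 < τ := mul_pos (by linarith) hρ0
  have hpt : ∀ i, √(10 * A) * ρ⁻¹ * |p i| + (1 + ε) * ρ⁻¹ * |q i| ≤
      (1 - 3 * ε) + ε * (tailBound ρ (√(10 * A) / ε * p i) + tailBound τ (q i)) := by
    intro i
    have h1 := le_tailBound ρ (√(10 * A) / ε * p i)
    have h2 := le_tailBound τ (q i)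
    have h3 := tailBound_nonneg ρ (√(10 * A) / ε * p i)
    have h4 := tailBound_nonneg τ (q i)
    rw [abs_mul, abs_of_nonneg (by positivity : 0 ≤ √(10 * A) / ε)] at h1
    set U := tailBound ρ (√(10 * A) / ε * p i)
    set V := tailBound τ (q i)
    have h5 : √(10 * A) * ρ⁻¹ * |p i| ≤ ε + ε * U := by
      have h6 : √(10 * A) * ρ⁻¹ * |p i| = ε * (ρ⁻¹) ^ 2 * (ρ * (√(10 * A) / ε * |p i|)) := by
        field_simp
      rw [h6]
      calc ε * (ρ⁻¹) ^ 2 * (ρ * (√(10 * A) / ε * |p i|)) ≤ ε * (ρ⁻¹) ^ 2 * (U + ρ ^ 2) := by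
            gcongr; linarith
        _ = ε * ((ρ⁻¹) ^ 2 * U) + ε * ((ρ⁻¹) ^ 2 * ρ ^ 2) := by ring
        _ ≤ ε * (1 * U) + ε * 1 := by
            rw [hsq]
            gcongr
            exact pow_le_one₀ (by positivity) (inv_le_one_of_one_le₀ hρ)
        _ = ε + ε * U := by ring
    have h7 : (1 + ε) * ρ⁻¹ * |q i| ≤ (1 + ε) * (1 - 5 * ε) + ε * V := by
      calc (1 + ε) * ρ⁻¹ * |q i| = (1 + ε) * (ρ⁻¹ * τ⁻¹) * (τ * |q i|) := by field_simp
        _ ≤ (1 + ε) * (ρ⁻¹ * τ⁻¹) * (V + τ ^ 2) := by gcongr; linarith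
        _ = (1 + ε) * (ρ⁻¹ * τ⁻¹) * V + (1 + ε) * (1 - 5 * ε) := by
            have : ρ⁻¹ * τ⁻¹ * τ ^ 2 = 1 - 5 * ε := by
              rw [sq, ← mul_assoc, mul_assoc ρ⁻¹, inv_mul_cancel₀ hτ0.ne', hτ]; field_simp
            linear_combination (1 + ε) * this
        _ ≤ ε * V + (1 + ε) * (1 - 5 * ε) := by
            have : (1 + ε) * (ρ⁻¹ * τ⁻¹) ≤ ε := by
              rw [← mul_inv, ← div_eq_mul_inv, div_le_iff₀ (by positivity)]
              linarith
            gcongr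
        _ = _ := by ring
    nlinarith [sq_nonneg ε]
  have hsum := hmain.trans (Finset.sum_le_sum fun i _ => hpt i)
  rw [Finset.sum_add_distrib, Finset.sum_const, nsmul_eq_mul, ← Finset.mul_sum] at hsum
  have h8 : ε * (S.card : ℝ) ≤
      ε * ∑ i ∈ S, (tailBound ρ (√(10 * A) / ε * p i) + tailBound τ (q i)) := by linarith
  exact (le_of_mul_le_mul_left h8 hε).trans (Finset.sum_le_univ_sum_of_nonneg fun i =>
    add_nonneg (tailBound_nonneg _ _) (tailBound_nonneg _ _))

theorem dataMatrix_mulVec {n d : ℕ} (hd : 0 < d) (y : Fin n → ℝ) {a σ s : ℝ} (hσ : σ = a * s)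
    (p : (Fin n → NoiseIdx d → ℝ) × (Fin n → ℝ)) (β : Fin d → ℝ) :
    Matrix.of (dataMatrix y a σ p) *ᵥ β =
      Matrix.of p.1 *ᵥ (fun j : NoiseIdx d => β j.1) + (β ⟨0, hd⟩ * a) • (y + s • p.2) := by
  ext i
  simp only [Matrix.mulVec, dotProduct, Pi.add_apply, Pi.smul_apply, smul_eq_mul, Matrix.of_apply]
  rw [← Fintype.sum_subtype_add_sum_subtype (fun j : Fin d => (j : ℕ) = 0), add_comm]
  congr 1
  · refine Finset.sum_congr rfl fun j _ => ?_
    simp [dataMatrix, j.2]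
  · have e (j : {j : Fin d // (j : ℕ) = 0}) : j = ⟨⟨0, hd⟩, rfl⟩ := Subtype.ext (Fin.ext j.2)
    rw [Fintype.sum_eq_single ⟨⟨0, hd⟩, rfl⟩ fun j hj => absurd (e j) hj]
    simp only [dataMatrix, ↓reduceDIte, hσ]
    ring

theorem misclass_le_left {n : ℕ} (u y : Fin n → ℝ) :
    misclass n u y ≤ (n : ℝ)⁻¹ * (errSet u y).card := by
  refine mul_le_mul_of_nonneg_left ((min_le_left _ _).trans (le_of_eq ?_)) (by positivity)
  rw [Nat.card_eq_fintype_card, Fintype.card_subtype, errSet]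

theorem misclass_neg {n : ℕ} (u y : Fin n → ℝ) : misclass n (-u) y = misclass n u y := by
  simp only [misclass, Pi.neg_apply, neg_neg]
  rw [min_comm]

theorem card_errSet_add_neg {n : ℕ} {u y : Fin n → ℝ} (hu : isSign u) (hy : isSign y) :
    (errSet u y).card + (errSet (-u) y).card = n := by
  have h : errSet (-u) y = (errSet u y)ᶜ := by
    ext i
    simp only [errSet, Finset.mem_filter, Finset.mem_univ, true_and, Pi.neg_apply,
      Finset.mem_compl, not_not]
    rcases hu i with h | h <;> rcases hy i with h' | h' <;> rw [h, h'] <;> norm_num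
  rw [h, Finset.card_add_card_compl, Fintype.card_fin]

theorem GoodNoise.misclass_le {n d : ℕ} (hd : 0 < d) {y : Fin n → ℝ}
    {p : (Fin n → NoiseIdx d → ℝ) × (Fin n → ℝ)} {η δ T : ℝ}
    (h : GoodNoise (Matrix.of p.1) y η δ T)
    (hy : isSign y) (hn : 0 < n) (hT : 0 ≤ T) (hδ : 0 ≤ δ)
    (hz : p.2 ⬝ᵥ p.2 ≤ 4 * n) {A ε ρ : ℝ} (hA : A = 16 * (1 + 8192 * T))
    (hε : 0 < ε) (hε' : ε ≤ 1 / 10) (hδε : 8192 * δ ≤ ε) (hρ : 1 ≤ ρ)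
    (hρε : 10 * A ≤ ε ^ 2 * ρ ^ 2) (hρη : 5 * A ≤ η * ρ ^ 2)
    (hρτ : 1 + ε ≤ ε * ρ * ((1 - 5 * ε) * ρ)) {a σ : ℝ} (ha : 0 < a) (hσ : σ = a * ρ⁻¹)
    {u : Fin n → ℝ} (hu : isMaxCutOpt (dataMatrix y a σ p) u) :
    misclass n u y ≤ (n : ℝ)⁻¹ *
      ∑ i, (tailBound ρ (√(10 * A) / ε * (colProj (Matrix.of p.1) *ᵥ y) i) +
        tailBound ((1 - 5 * ε) * ρ) ((p.2 - colProj (Matrix.of p.1) *ᵥ p.2) i)) := by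
  have hmul := dataMatrix_mulVec hd y hσ p
  have hsq : (ρ⁻¹) ^ 2 * ρ ^ 2 = 1 := by field_simp
  have hinj : ∀ β, Matrix.of (dataMatrix y a σ p) *ᵥ β = 0 → β = 0 := by
    intro β hβ
    rw [hmul] at hβ
    have hs : (65536 * T + 8) * (ρ⁻¹) ^ 2 < 1 := by
      have := mul_le_mul_of_nonneg_right hρε (sq_nonneg ρ⁻¹)
      nlinarith [mul_nonneg hT (sq_nonneg ρ⁻¹)]
    have h0 : β ⟨0, hd⟩ = 0 := by
      by_contra h0
      have hne : β ⟨0, hd⟩ * a ≠ 0 := mul_ne_zero h0 ha.ne'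
      refine h.mulVec_ne hn hT hy hz hs ((-(β ⟨0, hd⟩ * a)⁻¹) • fun j : NoiseIdx d => β j.1) ?_
      rw [Matrix.mulVec_smul, eq_neg_of_add_eq_zero_left hβ, smul_neg, neg_smul, neg_neg, smul_smul,
        inv_mul_cancel₀ hne, one_smul]
    rw [h0, zero_mul, zero_smul, add_zero] at hβ
    have h1 := h.eq_zero_of_mulVec hy hn _ hβ
    ext j
    by_cases hj : (j : ℕ) = 0
    · rw [show j = ⟨0, hd⟩ from Fin.ext hj, h0]; rfl
    · exact congrFun h1 ⟨j, hj⟩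
  obtain ⟨β, hβ⟩ := hu.exists_leastSquares hinj
  have hopt : ∀ y', isSign y' → ∀ (θ' : NoiseIdx d → ℝ) (b' : ℝ),
      (u - Matrix.of p.1 *ᵥ (fun j : NoiseIdx d => β j.1) - (β ⟨0, hd⟩ * a) • (y + ρ⁻¹ • p.2)) ⬝ᵥ
      (u - Matrix.of p.1 *ᵥ (fun j : NoiseIdx d => β j.1) - (β ⟨0, hd⟩ * a) • (y + ρ⁻¹ • p.2)) ≤
      (y' - Matrix.of p.1 *ᵥ θ' - b' • (y + ρ⁻¹ • p.2)) ⬝ᵥ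
      (y' - Matrix.of p.1 *ᵥ θ' - b' • (y + ρ⁻¹ • p.2)) := by
    intro y' hy' θ' b'
    have h1 := hβ y' hy' fun j => if hj : (j : ℕ) = 0 then b' / a else θ' ⟨j, hj⟩
    simp only [hmul, ↓reduceDIte, div_mul_cancel₀ _ ha.ne', ← sub_sub] at h1
    convert h1 using 5 <;>
    · ext j
      simp [j.2]
  have hcard := card_errSet_add_neg hu.1 hy
  have hcard' : ((errSet u y).card : ℝ) + (errSet (-u) y).card = n := by exact_mod_cast hcard
  rcases le_total ((errSet u y).card : ℝ) (n / 2) with hk | hk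
  · exact (misclass_le_left u y).trans (mul_le_mul_of_nonneg_left
      (h.card_errSet_le hy hn hT hδ hz hu.1 hk hA hε hε' hδε hρ hρε hρη hρτ hopt) (by positivity))
  · rw [← misclass_neg]
    refine (misclass_le_left (-u) y).trans (mul_le_mul_of_nonneg_left
      (h.card_errSet_le hy hn hT hδ hz hu.1.neg (by linarith) hA hε hε' hδε hρ hρε hρη hρτ
        (θ := -fun j : NoiseIdx d => β j.1) (b := -(β ⟨0, hd⟩ * a)) ?_) (by positivity))
    intro y' hy' θ' b'
    refine le_trans (le_of_eq ?_) (hopt y' hy' θ' b')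
    rw [← neg_dotProduct_neg]
    congr 1 <;>
    · rw [Matrix.mulVec_neg]
      module

section

theorem colProj_mul_self {n : ℕ} {κ : Type*} [Fintype κ] [DecidableEq κ]
    {M : Matrix (Fin n) κ ℝ} (hM : (Mᵀ * M).det ≠ 0) : colProj M * colProj M = colProj M := by
  have h : IsUnit (Mᵀ * M).det := hM.isUnit
  unfold colProj
  rw [Matrix.mul_assoc (M * (Mᵀ * M)⁻¹), ← Matrix.mul_assoc Mᵀ, ← Matrix.mul_assoc Mᵀ M,
    Matrix.mul_nonsing_inv _ h, Matrix.one_mul]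

theorem sum_colProj_sq {n : ℕ} {κ : Type*} [Fintype κ] [DecidableEq κ]
    {M : Matrix (Fin n) κ ℝ} (hM : (Mᵀ * M).det ≠ 0) (i : Fin n) :
    ∑ j, colProj M i j ^ 2 = colProj M i i := by
  conv_rhs => rw [← colProj_mul_self hM, Matrix.mul_apply]
  refine Finset.sum_congr rfl fun j _ => ?_
  rw [sq]
  congr 1
  conv_lhs => rw [← colProj_transpose, Matrix.transpose_apply]

theorem measurePreserving_signFlip {n : ℕ} {ι : Type*} [Fintype ι] {ε : Fin n → ℝ} (hε : isSign ε) :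
    MeasurePreserving (fun W : Fin n → ι → ℝ => fun i j => ε i * W i j)
      (Measure.pi fun _ => stdPi ι) (Measure.pi fun _ => stdPi ι) := by
  refine measurePreserving_pi _ _ (f := fun i (w : ι → ℝ) j => ε i * w j) fun i => ?_
  refine measurePreserving_pi _ _ (f := fun j (x : ℝ) => ε i * x) fun j => ⟨by fun_prop, ?_⟩
  rw [gaussianReal_map_const_mul, mul_zero]
  congr 1
  ext
  simp [sq, hε.sq_eq i]

variable {n : ℕ} {ι : Type*} [Fintype ι] [DecidableEq ι]

theorem measurable_det_gram :
    Measurable fun W : Fin n → ι → ℝ => ((Matrix.of W)ᵀ * Matrix.of W).det := by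
  have h : Continuous fun W : Fin n → ι → ℝ => Matrix.of W := continuous_id
  exact ((h.matrix_transpose.matrix_mul h).matrix_det).measurable

theorem measurable_colProj (i j : Fin n) :
    Measurable fun W : Fin n → ι → ℝ => colProj (Matrix.of W) i j := by
  have h : Continuous fun W : Fin n → ι → ℝ => Matrix.of W := continuous_id
  have h1 : ∀ k l, Measurable fun W : Fin n → ι → ℝ =>
      ((Matrix.of W)ᵀ * Matrix.of W)⁻¹ k l := fun k l => by
    simp_rw [Matrix.inv_def, Matrix.smul_apply, smul_eq_mul, Ring.inverse_eq_inv']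
    exact measurable_det_gram.inv.mul
      (((h.matrix_transpose.matrix_mul h).matrix_adjugate).matrix_elem k l).measurable
  simp_rw [colProj, Matrix.mul_apply, Matrix.transpose_apply, Matrix.of_apply]
  refine Finset.measurable_sum _ fun k _ => Measurable.mul ?_ (by fun_prop)
  exact Finset.measurable_sum _ fun l _ => Measurable.mul (by fun_prop) (h1 _ _)

theorem measurable_tailBound (τ : ℝ) : Measurable (tailBound τ) := by
  unfold tailBound; fun_prop

theorem lintegral_tailBound_linear_le {κ : Type*} [Fintype κ] {c : κ → ℝ} (hc : ∑ j, c j ^ 2 ≤ 1)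
    (τ : ℝ) : ∫⁻ x, ENNReal.ofReal (tailBound τ (∑ j, c j * x j)) ∂stdPi κ ≤
      ENNReal.ofReal (2 * Real.exp (-τ ^ 2 / 2)) := by
  have h1 := lintegral_exp_linear_stdPi_le c hc τ
  have h2 := lintegral_exp_linear_stdPi_le c hc (-τ)
  have e : ∀ x : κ → ℝ, ENNReal.ofReal (tailBound τ (∑ j, c j * x j)) =
      ENNReal.ofReal (Real.exp (-τ ^ 2)) * (ENNReal.ofReal (Real.exp (τ * ∑ j, c j * x j)) +
        ENNReal.ofReal (Real.exp (-τ * ∑ j, c j * x j))) := fun x => by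
    rw [tailBound, ENNReal.ofReal_mul (Real.exp_pos _).le,
      ENNReal.ofReal_add (Real.exp_pos _).le (Real.exp_pos _).le, neg_mul]
  simp_rw [e]
  rw [lintegral_const_mul _ (by fun_prop), lintegral_add_left (by fun_prop)]
  refine (mul_le_mul_right (add_le_add h1 h2) _).trans (le_of_eq ?_)
  rw [← ENNReal.ofReal_add (Real.exp_pos _).le (Real.exp_pos _).le,
    ← ENNReal.ofReal_mul (Real.exp_pos _).le, neg_sq, ← two_mul, mul_left_comm, ← Real.exp_add]
  congr 3
  ring

theorem lintegral_tailBound_residual_le {M : Matrix (Fin n) ι ℝ} (hM : (Mᵀ * M).det ≠ 0)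
    (τ : ℝ) (i : Fin n) :
    ∫⁻ z, ENNReal.ofReal (tailBound τ ((z - colProj M *ᵥ z) i)) ∂stdPi (Fin n) ≤
      ENNReal.ofReal (2 * Real.exp (-τ ^ 2 / 2)) := by
  have e : ∀ z : Fin n → ℝ, (z - colProj M *ᵥ z) i =
      ∑ j, ((1 : Matrix (Fin n) (Fin n) ℝ) i j - colProj M i j) * z j := fun z => by
    simp only [sub_mul, Finset.sum_sub_distrib, Pi.sub_apply, Matrix.mulVec, dotProduct]
    congr 1
    simp [Matrix.one_apply]
  simp_rw [e]
  refine lintegral_tailBound_linear_le ?_ τ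
  have h1 := sum_colProj_sq hM i
  have h2 : 0 ≤ colProj M i i := h1 ▸ Finset.sum_nonneg fun j _ => sq_nonneg _
  have e2 : ∀ j, ((1 : Matrix (Fin n) (Fin n) ℝ) i j - colProj M i j) ^ 2 =
      (if i = j then 1 - 2 * colProj M i j else 0) + colProj M i j ^ 2 := fun j => by
    rw [Matrix.one_apply]; split_ifs <;> ring
  simp_rw [e2]
  rw [Finset.sum_add_distrib, h1]
  simp
  linarith

/-- The finite set of all sign vectors. -/
def signs (n : ℕ) : Finset (Fin n → ℝ) := Fintype.piFinset fun _ => {1, -1}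

theorem mem_signs {ε : Fin n → ℝ} : ε ∈ signs n ↔ isSign ε := by
  simp [signs, isSign]

theorem card_signs (n : ℕ) : (signs n).card = 2 ^ n := by
  have h : ((1 : ℝ)) ∉ ({-1} : Finset ℝ) := by norm_num
  simp [signs, Finset.card_insert_of_notMem h]

theorem sum_signs_exp_le (a : Fin n → ℝ) :
    ∑ ε ∈ signs n, Real.exp (∑ j, a j * ε j) ≤ 2 ^ n * Real.exp ((∑ j, a j ^ 2) / 2) := by
  have h : ((1 : ℝ)) ∉ ({-1} : Finset ℝ) := by norm_num
  simp_rw [Real.exp_sum]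
  rw [signs, ← Finset.prod_univ_sum (fun _ => ({1, -1} : Finset ℝ)) fun j x => Real.exp (a j * x)]
  have e : ∀ j, ∑ x ∈ ({1, -1} : Finset ℝ), Real.exp (a j * x) = 2 * Real.cosh (a j) := fun j => by
    rw [Finset.sum_insert h, Finset.sum_singleton, Real.cosh_eq]
    ring_nf
  simp_rw [e]
  rw [Finset.sum_div, Real.exp_sum, Finset.prod_mul_distrib, Finset.prod_const, Finset.card_univ,
    Fintype.card_fin]
  gcongr with j
  exact Real.cosh_le_exp_half_sq _

theorem colProj_signFlip {ε : Fin n → ℝ} (hε : isSign ε) (M : Matrix (Fin n) ι ℝ) :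
    colProj (diagonal ε * M) = diagonal ε * colProj M * diagonal ε ∧
      (diagonal ε * M)ᵀ * (diagonal ε * M) = Mᵀ * M := by
  have h1 : diagonal ε * diagonal ε = 1 := by
    rw [diagonal_mul_diagonal]
    simp [hε.sq_eq]
  have h2 : (diagonal ε * M)ᵀ * (diagonal ε * M) = Mᵀ * M := by
    rw [Matrix.transpose_mul, diagonal_transpose, Matrix.mul_assoc, ← Matrix.mul_assoc (diagonal ε),
      h1, Matrix.one_mul]
  refine ⟨?_, h2⟩
  rw [colProj, h2, colProj, Matrix.transpose_mul, diagonal_transpose]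
  simp only [Matrix.mul_assoc]

/-- Noise matrices of full column rank whose `i`-th leverage is at most `c⁻²`. -/
def lowLeverage (n : ℕ) (ι : Type*) [Fintype ι] [DecidableEq ι] (c : ℝ) (i : Fin n) :
    Set (Fin n → ι → ℝ) :=
  {W | ((Matrix.of W)ᵀ * Matrix.of W).det ≠ 0 ∧ c ^ 2 * colProj (Matrix.of W) i i ≤ 1}

theorem measurableSet_lowLeverage (c : ℝ) (i : Fin n) : MeasurableSet (lowLeverage n ι c i) :=
  (measurable_det_gram (measurableSet_singleton 0).compl).inter
    (measurableSet_le ((measurable_colProj i i).const_mul _) measurable_const)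

theorem sum_tailBound_signFlip_le {M : Matrix (Fin n) ι ℝ} (hM : (Mᵀ * M).det ≠ 0) {c : ℝ}
    {i : Fin n} (hc : c ^ 2 * colProj M i i ≤ 1) {y : Fin n → ℝ} (hy : isSign y) (ρ : ℝ) :
    ∑ ε ∈ signs n, tailBound ρ (c * ((diagonal ε * colProj M * diagonal ε) *ᵥ y) i) ≤
      2 ^ n * (2 * Real.exp (-ρ ^ 2 / 2)) := by
  have h1 := sum_signs_exp_le fun j => ρ * c * (colProj M i j * y j)
  have h2 := sum_signs_exp_le fun j => -(ρ * c * (colProj M i j * y j))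
  have h3 : ∑ j, (ρ * c * (colProj M i j * y j)) ^ 2 ≤ ρ ^ 2 := by
    have : ∀ j, (ρ * c * (colProj M i j * y j)) ^ 2 = ρ ^ 2 * c ^ 2 * colProj M i j ^ 2 :=
      fun j => by linear_combination (ρ * c * colProj M i j) ^ 2 * hy.sq_eq j
    simp_rw [this]
    rw [← Finset.mul_sum, sum_colProj_sq hM]
    nlinarith [sq_nonneg ρ]
  have h4 : Real.exp (ρ ^ 2 / 2) * Real.exp (-ρ ^ 2) = Real.exp (-ρ ^ 2 / 2) := by
    rw [← Real.exp_add]; congr 1; ring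
  have h5 : ∀ ε ∈ signs n, tailBound ρ (c * ((diagonal ε * colProj M * diagonal ε) *ᵥ y) i) =
      Real.exp (-ρ ^ 2) * (Real.exp (∑ j, ρ * c * (colProj M i j * y j) * ε j) +
        Real.exp (∑ j, -(ρ * c * (colProj M i j * y j)) * ε j)) := by
    intro ε hε
    have e : ρ * (c * ((diagonal ε * colProj M * diagonal ε) *ᵥ y) i) =
        ε i * ∑ j, ρ * c * (colProj M i j * y j) * ε j := by
      simp only [Matrix.mulVec, dotProduct, mul_diagonal, diagonal_mul, Finset.mul_sum]
      exact Finset.sum_congr rfl fun j _ => by ring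
    rw [tailBound, e]
    simp only [neg_mul, Finset.sum_neg_distrib]
    rcases mem_signs.1 hε i with h | h <;> rw [h]
    · rw [one_mul]
    · rw [neg_one_mul, neg_neg, add_comm]
  rw [Finset.sum_congr rfl h5, ← Finset.mul_sum, Finset.sum_add_distrib]
  simp only [neg_sq] at h2
  calc _ ≤ Real.exp (-ρ ^ 2) * (2 ^ n * Real.exp (ρ ^ 2 / 2) + 2 ^ n * Real.exp (ρ ^ 2 / 2)) := by
        gcongr
        · exact h1.trans (by gcongr)
        · exact h2.trans (by gcongr)
    _ = _ := by rw [← h4]; ring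

theorem setLIntegral_tailBound_colProj_le (c ρ : ℝ) (i : Fin n) {y : Fin n → ℝ} (hy : isSign y) :
    ∫⁻ W in lowLeverage n ι c i, ENNReal.ofReal (tailBound ρ (c * (colProj (Matrix.of W) *ᵥ y) i))
      ∂(Measure.pi fun _ : Fin n => stdPi ι) ≤ ENNReal.ofReal (2 * Real.exp (-ρ ^ 2 / 2)) := by
  set μ : Measure (Fin n → ι → ℝ) := Measure.pi fun _ : Fin n => stdPi ι
  rw [← lintegral_indicator (measurableSet_lowLeverage c i)]
  set f : (Fin n → ι → ℝ) → ℝ≥0∞ := (lowLeverage n ι c i).indicator fun W =>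
    ENNReal.ofReal (tailBound ρ (c * (colProj (Matrix.of W) *ᵥ y) i)) with hf
  have hfm : Measurable f := by
    refine Measurable.indicator ?_ (measurableSet_lowLeverage c i)
    refine ((measurable_tailBound ρ).comp (Measurable.const_mul ?_ c)).ennreal_ofReal
    simp only [Matrix.mulVec, dotProduct]
    exact Finset.measurable_sum _ fun j _ => (measurable_colProj i j).mul_const _
  have hflip : ∀ ε ∈ signs n, ∫⁻ W, f W ∂μ = ∫⁻ W, f (fun i j => ε i * W i j) ∂μ :=
    fun ε hε => ((measurePreserving_signFlip (mem_signs.1 hε)).lintegral_comp hfm).symm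
  have hpt : ∀ W : Fin n → ι → ℝ, ∑ ε ∈ signs n, f (fun i j => ε i * W i j) ≤
      ENNReal.ofReal (2 ^ n * (2 * Real.exp (-ρ ^ 2 / 2))) := by
    intro W
    have hof : ∀ ε : Fin n → ℝ, Matrix.of (fun i j => ε i * W i j) = diagonal ε * Matrix.of W :=
      fun ε => by ext i j; simp [diagonal_mul]
    have hmem : ∀ ε ∈ signs n, (fun i j => ε i * W i j) ∈ lowLeverage n ι c i ↔
        W ∈ lowLeverage n ι c i := fun ε hε => by
      have hs := mem_signs.1 hε
      have h1 := colProj_signFlip hs (Matrix.of W)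
      simp only [lowLeverage, Set.mem_ofPred_eq, hof, h1.2, h1.1, mul_diagonal, diagonal_mul]
      have h2 : ε i * colProj (Matrix.of W) i i * ε i = colProj (Matrix.of W) i i := by
        linear_combination colProj (Matrix.of W) i i * hs.sq_eq i
      rw [h2]
    by_cases hW : W ∈ lowLeverage n ι c i
    · have h1 : ∀ ε ∈ signs n, f (fun i j => ε i * W i j) = ENNReal.ofReal (tailBound ρ
          (c * ((diagonal ε * colProj (Matrix.of W) * diagonal ε) *ᵥ y) i)) := fun ε hε => by
        rw [hf, Set.indicator_of_mem ((hmem ε hε).2 hW), hof,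
          (colProj_signFlip (mem_signs.1 hε) (Matrix.of W)).1]
      rw [Finset.sum_congr rfl h1, ← ENNReal.ofReal_sum_of_nonneg fun ε _ => tailBound_nonneg _ _]
      exact ENNReal.ofReal_le_ofReal (sum_tailBound_signFlip_le hW.1 hW.2 hy ρ)
    · rw [Finset.sum_eq_zero fun ε hε => ?_]
      · exact bot_le
      · rw [hf, Set.indicator_of_notMem (mt (hmem ε hε).1 hW)]
  have h2 : (2 : ℝ≥0∞) ^ n * ∫⁻ W, f W ∂μ ≤
      2 ^ n * ENNReal.ofReal (2 * Real.exp (-ρ ^ 2 / 2)) := by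
    calc (2 : ℝ≥0∞) ^ n * ∫⁻ W, f W ∂μ = ∑ ε ∈ signs n, ∫⁻ W, f W ∂μ := by
          rw [Finset.sum_const, card_signs, nsmul_eq_mul]; norm_cast
      _ = ∑ ε ∈ signs n, ∫⁻ W, f (fun i j => ε i * W i j) ∂μ := Finset.sum_congr rfl hflip
      _ = ∫⁻ W, ∑ ε ∈ signs n, f (fun i j => ε i * W i j) ∂μ :=
          (lintegral_finsetSum _ fun ε hε =>
            hfm.comp (measurePreserving_signFlip (mem_signs.1 hε)).measurable).symm
      _ ≤ ∫⁻ W, ENNReal.ofReal (2 ^ n * (2 * Real.exp (-ρ ^ 2 / 2))) ∂μ := lintegral_mono hpt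
      _ = _ := by
          rw [lintegral_const, measure_univ, mul_one, ENNReal.ofReal_mul (by positivity),
            ENNReal.ofReal_pow (by norm_num), ENNReal.ofReal_ofNat]
  exact (ENNReal.mul_le_mul_iff_right (by simp) (by simp)).1 h2

end

theorem misclass_nonneg {n : ℕ} (u y : Fin n → ℝ) : 0 ≤ misclass n u y := by
  unfold misclass; positivity

theorem misclass_le_one {n : ℕ} (u y : Fin n → ℝ) : misclass n u y ≤ 1 := by
  refine (misclass_le_left u y).trans ?_
  refine inv_mul_le_one_of_le₀ ?_ (Nat.cast_nonneg _)
  exact_mod_cast (Finset.card_le_univ _).trans (Fintype.card_fin n).le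

theorem lintegral_noiseLaw_tailBound_le {n : ℕ} {ι : Type*} [Fintype ι] [DecidableEq ι]
    {y : Fin n → ℝ} (hy : isSign y) (c ρ τ : ℝ) (i : Fin n) :
    ∫⁻ p in (lowLeverage n ι c i) ×ˢ Set.univ,
      ENNReal.ofReal (tailBound ρ (c * (colProj (Matrix.of p.1) *ᵥ y) i)) +
      ENNReal.ofReal (tailBound τ ((p.2 - colProj (Matrix.of p.1) *ᵥ p.2) i)) ∂noiseLaw n ι ≤
      ENNReal.ofReal (2 * Real.exp (-ρ ^ 2 / 2)) + ENNReal.ofReal (2 * Real.exp (-τ ^ 2 / 2)) := by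
  have hm1 : Measurable fun p : (Fin n → ι → ℝ) × (Fin n → ℝ) =>
      ENNReal.ofReal (tailBound ρ (c * (colProj (Matrix.of p.1) *ᵥ y) i)) := by
    refine ((measurable_tailBound ρ).comp (Measurable.const_mul ?_ c)).ennreal_ofReal
    simp only [Matrix.mulVec, dotProduct]
    exact Finset.measurable_sum _ fun j _ =>
      ((measurable_colProj i j).comp measurable_fst).mul_const _
  rw [lintegral_add_left hm1, ← Measure.prod_restrict, Measure.restrict_univ]
  refine add_le_add ?_ ?_
  · refine (lintegral_prod_le _).trans ?_
    simp only [lintegral_const, measure_univ, mul_one]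
    exact setLIntegral_tailBound_colProj_le c ρ i hy
  · refine (lintegral_prod_le _).trans ?_
    calc _ ≤ ∫⁻ W in lowLeverage n ι c i, ENNReal.ofReal (2 * Real.exp (-τ ^ 2 / 2))
          ∂(Measure.pi fun _ : Fin n => stdPi ι) :=
          setLIntegral_mono measurable_const fun W hW => lintegral_tailBound_residual_le hW.1 τ i
      _ ≤ _ := by
          rw [setLIntegral_const]
          exact mul_le_of_le_one_right' prob_le_one

theorem lintegral_misclass_le {n d : ℕ} (hd : 1 ≤ d) (hn : 0 < n) {y : Fin n → ℝ} (hy : isSign y)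
    {snr : ℝ} (hsnr : 0 < snr) {η δ T A ε : ℝ} (hT : 0 ≤ T) (hδ : 0 ≤ δ)
    (hA : A = 16 * (1 + 8192 * T)) (hε : 0 < ε) (hε' : ε ≤ 1 / 10) (hδε : 8192 * δ ≤ ε)
    (hδA : 10 * A * (8192 * δ) ≤ ε ^ 2) (hηn : 1 ≤ η * n)
    (hρ : 1 ≤ snr) (hρε : 10 * A ≤ ε ^ 2 * snr) (hρη : 5 * A ≤ η * snr)
    (hρτ : 1 + ε ≤ ε * (1 - 5 * ε) * snr) {B : ℝ≥0∞}
    (hB : noiseLaw n (NoiseIdx d)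
      {p | ¬ (GoodNoise (Matrix.of p.1) y η δ T ∧ p.2 ⬝ᵥ p.2 ≤ 4 * n)} ≤ B)
    {yhat : (Fin n → Fin d → ℝ) → (Fin n → ℝ)} (hopt : ∀ X, isMaxCutOpt X (yhat X)) :
    ∫⁻ X, ENNReal.ofReal (misclass n (yhat X) y) ∂canonLaw n d y snr ≤
      B + ENNReal.ofReal (4 * Real.exp (-((1 - 5 * ε) ^ 2 * snr) / 2)) := by
  set a := √(1 - (1 / √(1 + snr)) ^ 2) with ha
  set σ := 1 / √(1 + snr) with hσ
  set ρ := √snr with hρdef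
  have hρsq : ρ ^ 2 = snr := Real.sq_sqrt hsnr.le
  have hρ0 : 0 < ρ := Real.sqrt_pos.2 hsnr
  have hρ1 : 1 ≤ ρ := Real.one_le_sqrt.2 hρ
  have ha2 : 1 - σ ^ 2 = (ρ * σ) ^ 2 := by
    have : √(1 + snr) ^ 2 = 1 + snr := Real.sq_sqrt (by linarith)
    rw [mul_pow, hρsq, hσ, div_pow, this]
    field_simp
    ring
  have hσ0 : 0 < σ := by positivity
  have haσ : a = ρ * σ := by rw [ha, ha2, Real.sqrt_sq (by positivity)]
  have ha0 : 0 < a := by rw [haσ]; positivity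
  have hσa : σ = a * ρ⁻¹ := by rw [haσ]; field_simp
  set c := √(10 * A) / ε with hc
  have hA0 : 0 ≤ A := by rw [hA]; positivity
  have hc2 : c ^ 2 = 10 * A / ε ^ 2 := by rw [hc, div_pow, Real.sq_sqrt (by positivity)]
  set τ := (1 - 5 * ε) * ρ with hτ
  set μ := noiseLaw n (NoiseIdx d)
  set bad := {p : (Fin n → NoiseIdx d → ℝ) × (Fin n → ℝ) |
    ¬ (GoodNoise (Matrix.of p.1) y η δ T ∧ p.2 ⬝ᵥ p.2 ≤ 4 * n)} with hbad
  set f : Fin n → (Fin n → NoiseIdx d → ℝ) × (Fin n → ℝ) → ℝ≥0∞ := fun i p =>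
    ENNReal.ofReal (tailBound ρ (c * (colProj (Matrix.of p.1) *ᵥ y) i)) +
      ENNReal.ofReal (tailBound τ ((p.2 - colProj (Matrix.of p.1) *ᵥ p.2) i)) with hf
  have hfm : ∀ i, Measurable (f i) := fun i => by
    have h1 : ∀ i j, Measurable fun p : (Fin n → NoiseIdx d → ℝ) × (Fin n → ℝ) =>
        colProj (Matrix.of p.1) i j := fun i j => (measurable_colProj i j).comp measurable_fst
    refine Measurable.add (M := ℝ≥0∞) ?_ ?_
    · refine ((measurable_tailBound ρ).comp (Measurable.const_mul ?_ c)).ennreal_ofReal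
      simp only [Matrix.mulVec, dotProduct]
      exact Finset.measurable_sum _ fun j _ => (h1 i j).mul_const _
    · refine ((measurable_tailBound τ).comp ?_).ennreal_ofReal
      simp only [Pi.sub_apply, Matrix.mulVec, dotProduct]
      exact Measurable.sub (by fun_prop) (Finset.measurable_sum _ fun j _ =>
        (h1 i j).mul (by fun_prop))
  have hL : ∀ i, MeasurableSet ((lowLeverage n (NoiseIdx d) c i) ×ˢ (Set.univ : Set (Fin n → ℝ))) :=
    fun i => (measurableSet_lowLeverage c i).prod MeasurableSet.univ
  have hpt : ∀ p, ENNReal.ofReal (misclass n (yhat (dataMatrix y a σ p)) y) ≤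
      (toMeasurable μ bad).indicator 1 p + (n : ℝ≥0∞)⁻¹ *
        ∑ i, ((lowLeverage n (NoiseIdx d) c i) ×ˢ Set.univ).indicator (f i) p := by
    intro p
    by_cases hp : p ∈ bad
    · rw [Set.indicator_of_mem (subset_toMeasurable _ _ hp)]
      refine le_add_right ?_
      rw [Pi.one_apply, ← ENNReal.ofReal_one]
      exact ENNReal.ofReal_le_ofReal (misclass_le_one _ _)
    · simp only [hbad, Set.mem_ofPred_eq, not_not] at hp
      refine le_add_left ?_
      have h1 := hp.1.misclass_le hd hy hn hT hδ hp.2 hA hε hε' hδε hρ1 (by rwa [hρsq])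
        (by rwa [hρsq]) (by rw [← hρsq] at hρτ; linarith) ha0 hσa (hopt (dataMatrix y a σ p))
      refine (ENNReal.ofReal_le_ofReal h1).trans ?_
      have hn' : (0 : ℝ) < n := by exact_mod_cast hn
      rw [ENNReal.ofReal_mul (by positivity), ENNReal.ofReal_inv_of_pos hn', ENNReal.ofReal_natCast,
        ENNReal.ofReal_sum_of_nonneg fun i _ =>
          add_nonneg (tailBound_nonneg _ _) (tailBound_nonneg _ _)]
      gcongr with i
      rw [Set.indicator_of_mem]
      · exact ENNReal.ofReal_add_le
      · refine ⟨⟨(isUnit_det_transpose_mul (hp.1.eq_zero_of_mulVec hy hn)).ne_zero, ?_⟩, trivial⟩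
        have h2 := hp.1.colProj_diag_le hy hn hδ hηn i
        rw [hc2, div_mul_eq_mul_div, div_le_one (by positivity)]
        exact (mul_le_mul_of_nonneg_left h2 (by positivity)).trans hδA
  have hexp : Real.exp (-ρ ^ 2 / 2) ≤ Real.exp (-τ ^ 2 / 2) := by
    refine Real.exp_le_exp.2 ?_
    have : τ ^ 2 ≤ ρ ^ 2 := by
      rw [hτ, mul_pow]
      exact mul_le_of_le_one_left (sq_nonneg _) (pow_le_one₀ (by linarith) (by linarith))
    linarith
  rw [canonLaw_eq_map n d hd y hsnr]
  calc _ ≤ ∫⁻ p, ENNReal.ofReal (misclass n (yhat (dataMatrix y a σ p)) y) ∂μ :=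
        lintegral_map_le (fun X => ENNReal.ofReal (misclass n (yhat X) y)) _
    _ ≤ ∫⁻ p, ((toMeasurable μ bad).indicator 1 p + (n : ℝ≥0∞)⁻¹ *
        ∑ i, ((lowLeverage n (NoiseIdx d) c i) ×ˢ Set.univ).indicator (f i) p) ∂μ :=
        lintegral_mono hpt
    _ = μ bad + (n : ℝ≥0∞)⁻¹ *
        ∑ i, ∫⁻ p in (lowLeverage n (NoiseIdx d) c i) ×ˢ Set.univ, f i p ∂μ := by
        rw [lintegral_add_left (measurable_one.indicator (measurableSet_toMeasurable _ _)),
          lintegral_indicator_one (measurableSet_toMeasurable _ _), measure_toMeasurable,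
          lintegral_const_mul _ (Finset.measurable_sum _ fun i _ => (hfm i).indicator (hL i)),
          lintegral_finsetSum _ fun i _ => (hfm i).indicator (hL i)]
        simp_rw [lintegral_indicator (hL _)]
    _ ≤ B + (n : ℝ≥0∞)⁻¹ * ∑ i : Fin n, ENNReal.ofReal (4 * Real.exp (-τ ^ 2 / 2)) := by
        gcongr with i
        refine (lintegral_noiseLaw_tailBound_le hy c ρ τ i).trans ?_
        rw [← ENNReal.ofReal_add (by positivity) (by positivity)]
        exact ENNReal.ofReal_le_ofReal (by linarith)
    _ = B + ENNReal.ofReal (4 * Real.exp (-((1 - 5 * ε) ^ 2 * snr) / 2)) := by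
        rw [Finset.sum_const, Finset.card_univ, Fintype.card_fin, nsmul_eq_mul, ← mul_assoc,
          ENNReal.inv_mul_cancel (by exact_mod_cast hn.ne') (ENNReal.natCast_ne_top n), one_mul,
          hτ, mul_pow, hρsq]

/-- The law of the noise matrix `W`. -/
abbrev noiseMatLaw (n : ℕ) (ι : Type*) [Fintype ι] : Measure (Fin n → ι → ℝ) :=
  Measure.pi fun _ : Fin n => stdPi ι

theorem gaussianReal_abs_ge_le (a : ℝ) (ha : 0 ≤ a) :
    gaussianReal 0 1 {x | a ≤ |x|} ≤ ENNReal.ofReal (2 * Real.exp (-a ^ 2 / 4)) := by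
  have h1 : gaussianReal 0 1 {x | ENNReal.ofReal (Real.exp (a ^ 2 / 4)) ≤
      ENNReal.ofReal (Real.exp (x ^ 2 / 4))} ≤ _ :=
    meas_ge_le_lintegral_div (by fun_prop) (by simp [Real.exp_pos]) ENNReal.ofReal_ne_top
  rw [lintegral_exp_sq_gaussianReal, ← ENNReal.ofReal_div_of_pos (Real.exp_pos _)] at h1
  refine (measure_mono fun x hx => ?_).trans (h1.trans (ENNReal.ofReal_le_ofReal ?_))
  · simp only [Set.mem_ofPred_eq] at hx ⊢
    refine ENNReal.ofReal_le_ofReal (Real.exp_le_exp.2 ?_)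
    have := pow_le_pow_left₀ ha hx 2
    rw [sq_abs] at this
    linarith
  · rw [div_eq_mul_inv, ← Real.exp_neg, ← neg_div]
    refine mul_le_mul_of_nonneg_right ?_ (Real.exp_pos _).le
    exact (Real.sqrt_le_iff.2 ⟨by norm_num, by norm_num⟩)

theorem noiseMatLaw_entry_le {n : ℕ} {ι : Type*} [Fintype ι] (a : ℝ) (ha : 0 ≤ a) :
    noiseMatLaw n ι {W | ∃ i j, a ≤ |W i j|} ≤
      ENNReal.ofReal (n * Fintype.card ι * (2 * Real.exp (-a ^ 2 / 4))) := by
  have h : ∀ i j, noiseMatLaw n ι {W | a ≤ |W i j|} ≤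
      ENNReal.ofReal (2 * Real.exp (-a ^ 2 / 4)) := by
    intro i j
    have h1 : MeasurePreserving (fun W : Fin n → ι → ℝ => W i j) (noiseMatLaw n ι)
        (gaussianReal 0 1) :=
      (measurePreserving_eval (fun _ : ι => gaussianReal 0 1) j).comp
        (measurePreserving_eval (fun _ : Fin n => stdPi ι) i)
    have hm : MeasurableSet {x : ℝ | a ≤ |x|} := measurableSet_le measurable_const (by fun_prop)
    refine le_trans (le_of_eq ?_) (gaussianReal_abs_ge_le a ha)
    exact h1.measure_preimage hm.nullMeasurableSet
  have e : {W : Fin n → ι → ℝ | ∃ i j, a ≤ |W i j|} = ⋃ i, ⋃ j, {W | a ≤ |W i j|} := by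
    ext W; simp
  rw [e]
  calc _ ≤ ∑ i : Fin n, ∑ j : ι, noiseMatLaw n ι {W | a ≤ |W i j|} :=
        (measure_iUnion_fintype_le _ _).trans
          (Finset.sum_le_sum fun i _ => measure_iUnion_fintype_le _ _)
    _ ≤ ∑ i : Fin n, ∑ j : ι, ENNReal.ofReal (2 * Real.exp (-a ^ 2 / 4)) :=
        Finset.sum_le_sum fun i _ => Finset.sum_le_sum fun j _ => h i j
    _ = _ := by
        simp only [Finset.sum_const, Finset.card_univ, Fintype.card_fin, nsmul_eq_mul]
        rw [mul_assoc, ENNReal.ofReal_mul (p := (n : ℝ)) (by positivity),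
          ENNReal.ofReal_mul (p := (Fintype.card ι : ℝ)) (by positivity),
          ENNReal.ofReal_natCast, ENNReal.ofReal_natCast]

theorem stdPi_sq_ge_le (n : ℕ) :
    stdPi (Fin n) {z | 4 * (n : ℝ) < z ⬝ᵥ z} ≤ ENNReal.ofReal (Real.exp (-n / 2)) := by
  have h := pi_measure_sum_ge_le (n := n) (μ := gaussianReal 0 1) (f := fun _ x => x ^ 2 / 4)
    (fun _ => by fun_prop) (c := 1 / 2) (fun _ => by
      rw [lintegral_exp_sq_gaussianReal]
      refine ENNReal.ofReal_le_ofReal (Real.sqrt_le_iff.2 ⟨(Real.exp_pos _).le, ?_⟩)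
      rw [← Real.exp_nat_mul]
      have := Real.add_one_le_exp (1 : ℝ)
      norm_num
      linarith) n
  refine (measure_mono fun z hz => ?_).trans (h.trans (ENNReal.ofReal_le_ofReal ?_))
  · simp only [Set.mem_ofPred_eq, dotProduct_self_eq_sum_sq] at hz ⊢
    rw [← Finset.sum_div]
    linarith
  · refine Real.exp_le_exp.2 ?_
    linarith

theorem noiseMatLaw_smallBall_le {n : ℕ} {ι : Type*} [Fintype ι] {y : Fin n → ℝ} (hy : isSign y)
    {θ : ι → ℝ} (hθ : 1 / 2 ≤ θ ⬝ᵥ θ) (t : ℝ) :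
    noiseMatLaw n ι {W | (n : ℝ) / 4 ≤
      (Finset.card {i | |y i * (Matrix.of W *ᵥ θ) i - t| ≤ 3 / 64} : ℝ)} ≤
      ENNReal.ofReal (Real.exp (-n / 16)) := by
  set g : ℝ → ℝ → ℝ := fun e x => if |e * x - t| ≤ 3 / 64 then 1 else 0 with hg
  have hS : ∀ e : ℝ, MeasurableSet {x : ℝ | |e * x - t| ≤ 3 / 64} := fun e =>
    measurableSet_le (by fun_prop) measurable_const
  have hgm : ∀ e, Measurable (g e) := fun e =>
    Measurable.ite (hS e) measurable_const measurable_const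
  have he : Real.exp 1 - 1 ≤ 1.7183 := by
    have := Real.exp_one_lt_d9
    linarith
  have he0 : 0 ≤ Real.exp 1 - 1 := by
    have := Real.add_one_le_exp (1 : ℝ)
    linarith
  have h := pi_measure_sum_ge_le (n := n) (μ := stdPi ι) (f := fun i w => g (y i) (∑ j, θ j * w j))
    (fun i => (hgm _).comp (by fun_prop)) (c := 3 / 16) (fun i => by
      rw [lintegral_linear_stdPi θ (g := fun x => ENNReal.ofReal (Real.exp (g (y i) x)))
        ((Real.measurable_exp.comp (hgm _)).ennreal_ofReal)]
      have e : ∀ x, ENNReal.ofReal (Real.exp (g (y i) x)) = 1 + ENNReal.ofReal (Real.exp 1 - 1) *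
          {x : ℝ | |y i * x - t| ≤ 3 / 64}.indicator 1 x := fun x => by
        by_cases hx : |y i * x - t| ≤ 3 / 64
        · rw [Set.indicator_of_mem (show x ∈ {x : ℝ | |y i * x - t| ≤ 3 / 64} from hx)]
          simp only [hg, if_pos hx, Pi.one_apply, mul_one]
          rw [← ENNReal.ofReal_one, ← ENNReal.ofReal_add zero_le_one he0]
          congr 1
          ring
        · rw [Set.indicator_of_notMem (show x ∉ {x : ℝ | |y i * x - t| ≤ 3 / 64} from hx)]
          simp [hg, if_neg hx]
      simp_rw [e]
      rw [lintegral_add_left measurable_const, lintegral_const_mul _ (measurable_one.indicator (hS _)),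
        lintegral_indicator_one (hS _), lintegral_one, measure_univ]
      have hset : {x : ℝ | |y i * x - t| ≤ 3 / 64} = {x : ℝ | |x - y i * t| ≤ 3 / 64} := by
        ext x
        have : |y i * x - t| = |x - y i * t| := by
          rw [← one_mul |x - y i * t|, ← hy.abs_eq i, ← abs_mul, mul_sub, ← mul_assoc, hy.sq_eq,
            one_mul]
        simp only [Set.mem_ofPred_eq, this]
      rw [hset]
      have h1 := gaussianReal_interval_le (v := ∑ j, θ j ^ 2)
        (by rwa [← dotProduct_self_eq_sum_sq]) (y i * t) (k := 3 / 64)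
      refine (add_le_add_right (mul_le_mul_right h1 _) 1).trans ?_
      rw [← ENNReal.ofReal_mul he0, ← ENNReal.ofReal_one, ← ENNReal.ofReal_add zero_le_one
        (by positivity)]
      refine ENNReal.ofReal_le_ofReal (le_trans ?_ (Real.add_one_le_exp (3 / 16 : ℝ)))
      norm_num at he ⊢
      linarith) (n / 4)
  refine (measure_mono fun W hW => ?_).trans (h.trans (ENNReal.ofReal_le_ofReal ?_))
  · simp only [Set.mem_ofPred_eq] at hW ⊢
    refine hW.trans (le_of_eq ?_)
    rw [← Finset.sum_boole]
    refine Finset.sum_congr rfl fun i _ => ?_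
    have : (Matrix.of W *ᵥ θ) i = ∑ j, θ j * W i j := by
      simp only [Matrix.mulVec, dotProduct, Matrix.of_apply, mul_comm]
    rw [this]
  · refine Real.exp_le_exp.2 (le_of_eq ?_)
    ring

theorem noiseMatLaw_excess_le {n : ℕ} {ι : Type*} [Fintype ι] {θ : ι → ℝ} (hθ : θ ⬝ᵥ θ ≤ 2)
    {δ : ℝ} (hδ : 0 < δ) :
    noiseMatLaw n ι {W | δ * n ≤ ∑ i, max ((Matrix.of W *ᵥ θ) i ^ 2 - 8 * Real.log (32 / δ)) 0} ≤
      ENNReal.ofReal (Real.exp (-(δ / 16 * n))) := by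
  set M := 8 * Real.log (32 / δ) with hM
  have h := pi_measure_sum_ge_le (n := n) (μ := stdPi ι)
    (f := fun i w => max ((∑ j, θ j * w j) ^ 2 - M) 0 / 8)
    (fun i => by fun_prop) (c := δ / 16) (fun i => by
      rw [lintegral_linear_stdPi θ (g := fun x => ENNReal.ofReal (Real.exp (max (x ^ 2 - M) 0 / 8)))
        (by fun_prop)]
      have e : ∀ x : ℝ, ENNReal.ofReal (Real.exp (max (x ^ 2 - M) 0 / 8)) ≤
          1 + ENNReal.ofReal (δ / 32) * ENNReal.ofReal (Real.exp (x ^ 2 / 8)) := fun x => by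
        rw [← ENNReal.ofReal_mul (by positivity), ← ENNReal.ofReal_one,
          ← ENNReal.ofReal_add zero_le_one (by positivity)]
        refine ENNReal.ofReal_le_ofReal ?_
        have h2 : δ / 32 * Real.exp (x ^ 2 / 8) = Real.exp ((x ^ 2 - M) / 8) := by
          have : δ / 32 = Real.exp (-(M / 8)) := by
            rw [hM, mul_div_cancel_left₀ _ (by norm_num), Real.exp_neg, Real.exp_log (by positivity),
              inv_div]
          rw [this, ← Real.exp_add]
          congr 1
          ring
        rw [h2]
        have h3 := Real.exp_pos ((x ^ 2 - M) / 8)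
        rcases max_cases (x ^ 2 - M) 0 with ⟨h, _⟩ | ⟨h, _⟩ <;> rw [h]
        · linarith
        · rw [zero_div, Real.exp_zero]; linarith
      refine (lintegral_mono e).trans ?_
      rw [lintegral_add_left measurable_const, lintegral_const_mul _ (by fun_prop), lintegral_one,
        measure_univ]
      have h1 := lintegral_exp_sq_gaussianReal_le (v := ∑ j, θ j ^ 2)
        (by rwa [← dotProduct_self_eq_sum_sq])
      refine (add_le_add_right (mul_le_mul_right h1 _) 1).trans ?_
      rw [← ENNReal.ofReal_ofNat, ← ENNReal.ofReal_mul (by positivity), ← ENNReal.ofReal_one,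
        ← ENNReal.ofReal_add zero_le_one (by positivity)]
      refine ENNReal.ofReal_le_ofReal (le_trans ?_ (Real.add_one_le_exp (δ / 16)))
      linarith) (δ * n / 8)
  refine (measure_mono fun W hW => ?_).trans (h.trans (ENNReal.ofReal_le_ofReal ?_))
  · simp only [Set.mem_ofPred_eq] at hW ⊢
    rw [← Finset.sum_div]
    refine div_le_div_of_nonneg_right (hW.trans (le_of_eq ?_)) (by norm_num)
    refine Finset.sum_congr rfl fun i _ => ?_
    have : (Matrix.of W *ᵥ θ) i = ∑ j, θ j * W i j := by
      simp only [Matrix.mulVec, dotProduct, Matrix.of_apply, mul_comm]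
    rw [this]
  · refine Real.exp_le_exp.2 (le_of_eq ?_)
    ring

/-- The multiples of `n⁻³` in `[-n³, n³]`. -/
def grid (n : ℕ) : Finset ℝ :=
  (Finset.Icc (-(n : ℤ) ^ 6) ((n : ℤ) ^ 6)).image fun k : ℤ => (k : ℝ) / n ^ 3

theorem card_grid_le {n : ℕ} (hn : 3 ≤ n) : (grid n).card ≤ n ^ 7 := by
  refine Finset.card_image_le.trans ?_
  rw [Int.card_Icc]
  have h : (1 : ℤ) ≤ (n : ℤ) ^ 6 := one_le_pow₀ (by omega)
  have h2 : (3 : ℤ) * (n : ℤ) ^ 6 ≤ (n : ℤ) ^ 7 := by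
    rw [pow_succ (n : ℤ) 6, mul_comm]
    exact mul_le_mul_of_nonneg_left (by omega) (by omega)
  rw [Int.toNat_le]
  push_cast
  rw [neg_eq_neg_one_mul] at *
  linarith

theorem exists_mem_grid {n : ℕ} (hn : 1 ≤ n) {x : ℝ} (hx : |x| ≤ (n : ℝ) ^ 3 - 1) :
    ∃ g ∈ grid n, |x - g| ≤ 1 / (n : ℝ) ^ 3 := by
  have hn1 : (1 : ℝ) ≤ (n : ℝ) ^ 3 := one_le_pow₀ (by exact_mod_cast hn)
  have hn0 : (0 : ℝ) < (n : ℝ) ^ 3 := by linarith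
  obtain ⟨h1, h2⟩ := abs_le.1 hx
  have hfl := Int.floor_le (x * (n : ℝ) ^ 3)
  have hlt := Int.lt_floor_add_one (x * (n : ℝ) ^ 3)
  refine ⟨(⌊x * (n : ℝ) ^ 3⌋ : ℝ) / n ^ 3, Finset.mem_image.2 ⟨_, Finset.mem_Icc.2 ⟨?_, ?_⟩, rfl⟩, ?_⟩
  · rw [Int.le_floor]
    push_cast
    nlinarith
  · have : x * (n : ℝ) ^ 3 ≤ (n : ℝ) ^ 6 := by nlinarith
    exact_mod_cast hfl.trans this
  · have e : x - (⌊x * (n : ℝ) ^ 3⌋ : ℝ) / n ^ 3 = (x * n ^ 3 - ⌊x * (n : ℝ) ^ 3⌋) / n ^ 3 := by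
      field_simp
    rw [e, abs_of_nonneg (div_nonneg (by linarith) hn0.le)]
    exact div_le_div_of_nonneg_right (by linarith) hn0.le

theorem abs_le_one_of_dotProduct_self {ι : Type*} [Fintype ι] {θ : ι → ℝ} (hθ : θ ⬝ᵥ θ = 1) (j : ι) :
    |θ j| ≤ 1 := by
  rw [← sq_le_one_iff_abs_le_one, ← hθ, dotProduct_self_eq_sum_sq]
  exact Finset.single_le_sum (f := fun j => θ j ^ 2) (fun _ _ => sq_nonneg _) (Finset.mem_univ j)

open Classical in
/-- The net of directions of norm close to one with coordinates in `grid n`. -/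
def dirNet (n : ℕ) (ι : Type*) [Fintype ι] : Finset (ι → ℝ) :=
  (Fintype.piFinset fun _ : ι => grid n).filter fun θ => 1 / 2 ≤ θ ⬝ᵥ θ ∧ θ ⬝ᵥ θ ≤ 2

theorem card_dirNet_le {n : ℕ} (hn : 3 ≤ n) (ι : Type*) [Fintype ι] :
    (dirNet n ι).card ≤ n ^ (7 * Fintype.card ι) := by
  classical
  refine (Finset.card_filter_le _ _).trans ?_
  rw [Fintype.card_piFinset, pow_mul, Finset.prod_const, Finset.card_univ]
  exact Nat.pow_le_pow_left (card_grid_le hn) _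

theorem exists_mem_dirNet {n : ℕ} (hn : 96 ≤ n) {ι : Type*} [Fintype ι] (hι : Fintype.card ι ≤ n)
    {θ : ι → ℝ} (hθ : θ ⬝ᵥ θ = 1) : ∃ θ' ∈ dirNet n ι, ∀ j, |θ j - θ' j| ≤ 1 / (n : ℝ) ^ 3 := by
  have hnR : (96 : ℝ) ≤ n := by exact_mod_cast hn
  have hιR : (Fintype.card ι : ℝ) ≤ n := by exact_mod_cast hι
  have hn3 : (96 : ℝ) ≤ (n : ℝ) ^ 3 := by nlinarith [sq_nonneg (n : ℝ)]
  have hθ1 := abs_le_one_of_dotProduct_self hθ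
  choose θ' hmem hclose using fun j => exists_mem_grid (n := n) (x := θ j) (by omega)
    (by linarith [hθ1 j])
  have hsq : |θ' ⬝ᵥ θ' - θ ⬝ᵥ θ| ≤ 1 / 2 := by
    rw [dotProduct_self_eq_sum_sq, dotProduct_self_eq_sum_sq, ← Finset.sum_sub_distrib]
    have hterm : ∀ j, |θ' j ^ 2 - θ j ^ 2| ≤ 3 / (n : ℝ) ^ 3 := fun j => by
      have e : θ' j ^ 2 - θ j ^ 2 = (θ j - θ' j) * ((θ j - θ' j) - 2 * θ j) := by ring
      rw [e, abs_mul]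
      have h1 : |θ j - θ' j - 2 * θ j| ≤ 3 := by
        refine (abs_sub _ _).trans ?_
        rw [abs_mul, abs_two]
        have : 1 / (n : ℝ) ^ 3 ≤ 1 := by rw [div_le_one (by linarith)]; linarith
        linarith [hθ1 j, hclose j]
      calc _ ≤ 1 / (n : ℝ) ^ 3 * 3 := mul_le_mul (hclose j) h1 (abs_nonneg _) (by positivity)
        _ = _ := by ring
    calc _ ≤ ∑ j, |θ' j ^ 2 - θ j ^ 2| := Finset.abs_sum_le_sum_abs _ _
      _ ≤ ∑ _j : ι, 3 / (n : ℝ) ^ 3 := Finset.sum_le_sum fun j _ => hterm j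
      _ = Fintype.card ι * (3 / (n : ℝ) ^ 3) := by
        rw [Finset.sum_const, Finset.card_univ, nsmul_eq_mul]
      _ ≤ n * (3 / (n : ℝ) ^ 3) := mul_le_mul_of_nonneg_right hιR (by positivity)
      _ = 3 / (n : ℝ) ^ 2 := by field_simp
      _ ≤ 1 / 2 := by
        rw [div_le_div_iff₀ (by positivity) (by norm_num)]
        nlinarith
  rw [hθ] at hsq
  obtain ⟨h1, h2⟩ := abs_le.1 hsq
  classical
  exact ⟨θ', Finset.mem_filter.2 ⟨Fintype.mem_piFinset.2 hmem, by linarith, by linarith⟩, hclose⟩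

theorem abs_mulVec_sub_le {n : ℕ} (hn : 96 ≤ n) {ι : Type*} [Fintype ι] (hι : Fintype.card ι ≤ n)
    {W : Matrix (Fin n) ι ℝ} (hW : ∀ i j, |W i j| ≤ 2 * n) {θ θ' : ι → ℝ}
    (h : ∀ j, |θ j - θ' j| ≤ 1 / (n : ℝ) ^ 3) (i : Fin n) :
    |(W *ᵥ θ) i - (W *ᵥ θ') i| ≤ 2 / n := by
  have hnR : (96 : ℝ) ≤ n := by exact_mod_cast hn
  have hιR : (Fintype.card ι : ℝ) ≤ n := by exact_mod_cast hι
  simp only [Matrix.mulVec, dotProduct]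
  rw [← Finset.sum_sub_distrib]
  calc _ ≤ ∑ j, |W i j * θ j - W i j * θ' j| := Finset.abs_sum_le_sum_abs _ _
    _ ≤ ∑ _j : ι, 2 * (n : ℝ) * (1 / (n : ℝ) ^ 3) := Finset.sum_le_sum fun j _ => by
        rw [← mul_sub, abs_mul]
        exact mul_le_mul (hW i j) (h j) (abs_nonneg _) (by positivity)
    _ = Fintype.card ι * (2 * (n : ℝ) * (1 / (n : ℝ) ^ 3)) := by
        rw [Finset.sum_const, Finset.card_univ, nsmul_eq_mul]
    _ ≤ n * (2 * (n : ℝ) * (1 / (n : ℝ) ^ 3)) := mul_le_mul_of_nonneg_right hιR (by positivity)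
    _ = _ := by field_simp

theorem abs_mulVec_le {n : ℕ} {ι : Type*} [Fintype ι] (hι : Fintype.card ι ≤ n)
    {W : Matrix (Fin n) ι ℝ} (hW : ∀ i j, |W i j| ≤ 2 * n) {θ : ι → ℝ} (hθ : θ ⬝ᵥ θ = 1)
    (i : Fin n) : |(W *ᵥ θ) i| ≤ 2 * (n : ℝ) ^ 2 := by
  have hιR : (Fintype.card ι : ℝ) ≤ n := by exact_mod_cast hι
  simp only [Matrix.mulVec, dotProduct]
  calc _ ≤ ∑ j, |W i j * θ j| := Finset.abs_sum_le_sum_abs _ _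
    _ ≤ ∑ _j : ι, 2 * (n : ℝ) * 1 := Finset.sum_le_sum fun j _ => by
        rw [abs_mul]
        exact mul_le_mul (hW i j) (abs_le_one_of_dotProduct_self hθ j) (abs_nonneg _) (by positivity)
    _ = Fintype.card ι * (2 * (n : ℝ) * 1) := by
        rw [Finset.sum_const, Finset.card_univ, nsmul_eq_mul]
    _ ≤ n * (2 * (n : ℝ) * 1) := mul_le_mul_of_nonneg_right hιR (by positivity)
    _ = _ := by ring

/-- The truncation level above which the squares `(W θ)ᵢ²` sum to at most `δ n`. -/
def truncLevel (δ : ℝ) : ℝ := 8 * Real.log (32 / δ)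

theorem sum_mulVec_sq_le {n : ℕ} (hn : 96 ≤ n) {ι : Type*} [Fintype ι] (hι : Fintype.card ι ≤ n)
    {W : Matrix (Fin n) ι ℝ} (hW : ∀ i j, |W i j| ≤ 2 * n) {δ : ℝ}
    (hnet : ∀ θ ∈ dirNet n ι, ∑ i, max ((W *ᵥ θ) i ^ 2 - truncLevel δ) 0 ≤ δ * n)
    {θ : ι → ℝ} (hθ : θ ⬝ᵥ θ = 1) (S : Finset (Fin n)) :
    ∑ i ∈ S, (W *ᵥ θ) i ^ 2 ≤ 2 * δ * n + (2 * |truncLevel δ| + 1) * S.card := by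
  have hnR : (96 : ℝ) ≤ n := by exact_mod_cast hn
  obtain ⟨θ', hmem, hclose⟩ := exists_mem_dirNet hn hι hθ
  have h2n : 2 / (n : ℝ) ≤ 1 / 2 := by
    rw [div_le_div_iff₀ (by linarith) (by norm_num)]
    linarith
  have hterm : ∀ i, (W *ᵥ θ) i ^ 2 ≤
      2 * max ((W *ᵥ θ') i ^ 2 - truncLevel δ) 0 + (2 * |truncLevel δ| + 1) := fun i => by
    have h1 := (abs_mulVec_sub_le hn hι hW hclose i).trans h2n
    have h2 := abs_le.1 h1
    have h3 : ((W *ᵥ θ) i - (W *ᵥ θ') i) ^ 2 ≤ 1 / 4 := by nlinarith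
    have h4 := le_max_left ((W *ᵥ θ') i ^ 2 - truncLevel δ) 0
    have h5 := le_abs_self (truncLevel δ)
    nlinarith [sq_nonneg ((W *ᵥ θ) i - 2 * (W *ᵥ θ') i)]
  calc _ ≤ ∑ i ∈ S, (2 * max ((W *ᵥ θ') i ^ 2 - truncLevel δ) 0 + (2 * |truncLevel δ| + 1)) :=
        Finset.sum_le_sum fun i _ => hterm i
    _ = 2 * ∑ i ∈ S, max ((W *ᵥ θ') i ^ 2 - truncLevel δ) 0 +
        (2 * |truncLevel δ| + 1) * S.card := by
        rw [Finset.sum_add_distrib, ← Finset.mul_sum, Finset.sum_const, nsmul_eq_mul, mul_comm _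
          (S.card : ℝ)]
    _ ≤ _ := by
        have h6 : ∑ i ∈ S, max ((W *ᵥ θ') i ^ 2 - truncLevel δ) 0 ≤
            ∑ i, max ((W *ᵥ θ') i ^ 2 - truncLevel δ) 0 :=
          Finset.sum_le_univ_sum_of_nonneg fun i => le_max_right _ _
        linarith [hnet θ' hmem]

theorem goodNoise_of_net {n : ℕ} (hn : 96 ≤ n) {ι : Type*} [Fintype ι] (hι : Fintype.card ι ≤ n)
    {W : Matrix (Fin n) ι ℝ} {y : Fin n → ℝ} (hy : isSign y) (hW : ∀ i j, |W i j| ≤ 2 * n) {δ : ℝ}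
    (hball : ∀ θ ∈ dirNet n ι, ∀ t ∈ grid n,
      (Finset.card {i | |y i * (W *ᵥ θ) i - t| ≤ 3 / 64} : ℝ) ≤ n / 4)
    (hδ : ∀ θ ∈ dirNet n ι, ∑ i, max ((W *ᵥ θ) i ^ 2 - truncLevel δ) 0 ≤ δ * n)
    (hone : ∀ θ ∈ dirNet n ι, ∑ i, max ((W *ᵥ θ) i ^ 2 - truncLevel 1) 0 ≤ 1 * n) :
    GoodNoise W y (2 * δ / (2 * |truncLevel δ| + 1)) (4 * δ) (3 + 2 * |truncLevel 1|) where
  smallBall θ hθ t := by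
    have hnR : (96 : ℝ) ≤ n := by exact_mod_cast hn
    by_cases ht : |t| ≤ 2 * (n : ℝ) ^ 2 + 1
    · obtain ⟨θ', hmem, hclose⟩ := exists_mem_dirNet hn hι hθ
      obtain ⟨s, hs, hts⟩ := exists_mem_grid (n := n) (x := t) (by omega) (ht.trans (by nlinarith))
      refine le_trans ?_ (hball θ' hmem s hs)
      refine Nat.cast_le.2 (Finset.card_le_card fun i hi => ?_)
      simp only [Finset.mem_filter, Finset.mem_univ, true_and] at hi ⊢
      have h1 : |y i * (W *ᵥ θ) i - y i * (W *ᵥ θ') i| ≤ 2 / n := by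
        rw [← mul_sub, abs_mul, hy.abs_eq, one_mul]
        exact abs_mulVec_sub_le hn hι hW hclose i
      have h2 : 2 / (n : ℝ) ≤ 1 / 48 := by
        rw [div_le_div_iff₀ (by linarith) (by norm_num)]
        linarith
      have h3 : 1 / (n : ℝ) ^ 3 ≤ 1 / 192 := by
        rw [div_le_div_iff₀ (by positivity) (by norm_num)]
        nlinarith
      rw [abs_le] at *
      constructor <;> linarith [h1.1, h1.2, hi.1, hi.2, hts.1, hts.2]
    · have : (Finset.univ.filter fun i => |y i * (W *ᵥ θ) i - t| ≤ 1 / 64) = ∅ := by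
        refine Finset.filter_eq_empty_iff.2 fun i _ hi => ht ?_
        have h1 := abs_mulVec_le hι hW hθ i
        have h2 : |y i * (W *ᵥ θ) i| ≤ 2 * (n : ℝ) ^ 2 := by
          rwa [abs_mul, hy.abs_eq, one_mul]
        rw [abs_le] at *
        constructor <;> linarith [h2.1, h2.2, hi.1, hi.2]
      rw [this]
      simp only [Finset.card_empty, Nat.cast_zero]
      positivity
  spread θ hθ S hS := by
    refine (sum_mulVec_sq_le hn hι hW hδ hθ S).trans ?_
    have h0 : 0 < 2 * |truncLevel δ| + 1 := by positivity
    have := mul_le_mul_of_nonneg_left hS h0.le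
    have e : (2 * |truncLevel δ| + 1) * (2 * δ / (2 * |truncLevel δ| + 1) * n) = 2 * δ * n := by
      field_simp
    linarith
  bounded θ hθ := by
    refine (sum_mulVec_sq_le hn hι hW hone hθ Finset.univ).trans (le_of_eq ?_)
    rw [Finset.card_univ, Fintype.card_fin]
    ring

theorem noiseMatLaw_bad_le {n : ℕ} (hn : 96 ≤ n) {ι : Type*} [Fintype ι] (hι : Fintype.card ι ≤ n)
    {y : Fin n → ℝ} (hy : isSign y) {δ : ℝ} (hδ : 0 < δ) (hδ1 : δ ≤ 1) :
    noiseMatLaw n ι {W | ¬ GoodNoise (Matrix.of W) y (2 * δ / (2 * |truncLevel δ| + 1)) (4 * δ)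
      (3 + 2 * |truncLevel 1|)} ≤
      ENNReal.ofReal (4 * (n : ℝ) ^ (7 * (Fintype.card ι + 1)) * Real.exp (-(δ / 16 * n))) := by
  have hnR : (96 : ℝ) ≤ n := by exact_mod_cast hn
  have hn1 : (1 : ℝ) ≤ n := by linarith
  set m := Fintype.card ι with hm
  set E := Real.exp (-(δ / 16 * n)) with hE
  have hE0 : 0 < E := Real.exp_pos _
  have hmR : (m : ℝ) ≤ n := by exact_mod_cast hι
  set ball : (ι → ℝ) → ℝ → Set (Fin n → ι → ℝ) := fun θ t => {W | (n : ℝ) / 4 ≤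
      (Finset.card {i | |y i * (Matrix.of W *ᵥ θ) i - t| ≤ 3 / 64} : ℝ)} with hball
  set excess : ℝ → (ι → ℝ) → Set (Fin n → ι → ℝ) := fun δ θ =>
    {W | δ * n ≤ ∑ i, max ((Matrix.of W *ᵥ θ) i ^ 2 - truncLevel δ) 0} with hexcess
  set large : Set (Fin n → ι → ℝ) := {W | ∃ i j, 2 * (n : ℝ) ≤ |W i j|} with hlarge
  have hsub : {W | ¬ GoodNoise (Matrix.of W) y (2 * δ / (2 * |truncLevel δ| + 1)) (4 * δ)
      (3 + 2 * |truncLevel 1|)} ⊆ large ∪ (⋃ θ ∈ dirNet n ι, ⋃ t ∈ grid n, ball θ t) ∪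
        (⋃ θ ∈ dirNet n ι, excess δ θ) ∪ (⋃ θ ∈ dirNet n ι, excess 1 θ) := by
    intro W hW
    by_contra hcon
    simp only [Set.mem_union, Set.mem_iUnion, not_or, not_exists, hball, hexcess, hlarge,
      Set.mem_ofPred_eq, not_le] at hcon
    obtain ⟨⟨⟨h1, h2⟩, h3⟩, h4⟩ := hcon
    exact hW (goodNoise_of_net hn hι hy (fun i j => (h1 i j).le) (fun θ hθ t ht => (h2 θ hθ t ht).le)
      (fun θ hθ => (h3 θ hθ).le) (fun θ hθ => (h4 θ hθ).le))
  have hcardR : ((dirNet n ι).card : ℝ) ≤ (n : ℝ) ^ (7 * m) := by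
    exact_mod_cast card_dirNet_le (by omega) ι
  have hgridR : ((grid n).card : ℝ) ≤ (n : ℝ) ^ 7 := by exact_mod_cast card_grid_le (n := n) (by omega)
  have hpow : (n : ℝ) ^ (7 * (m + 1)) = (n : ℝ) ^ (7 * m) * (n : ℝ) ^ 7 := by
    rw [← pow_add]; ring_nf
  have hpow1 : (1 : ℝ) ≤ (n : ℝ) ^ (7 * m) := one_le_pow₀ hn1
  have hpow7 : (1 : ℝ) ≤ (n : ℝ) ^ 7 := one_le_pow₀ hn1
  have hpowle : (n : ℝ) ^ (7 * m) ≤ (n : ℝ) ^ (7 * (m + 1)) := by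
    rw [hpow]; nlinarith
  have hδn : δ / 16 * n ≤ n / 16 := by nlinarith
  have blarge : noiseMatLaw n ι large ≤ ENNReal.ofReal ((n : ℝ) ^ (7 * (m + 1)) * E) := by
    refine (noiseMatLaw_entry_le (2 * (n : ℝ)) (by positivity)).trans (ENNReal.ofReal_le_ofReal ?_)
    have h1 : Real.exp (-(2 * (n : ℝ)) ^ 2 / 4) ≤ E := Real.exp_le_exp.2 (by nlinarith)
    have h2 : (n : ℝ) * m * 2 ≤ (n : ℝ) ^ (7 * (m + 1)) := by
      have : (n : ℝ) ^ 3 ≤ (n : ℝ) ^ (7 * (m + 1)) := pow_le_pow_right₀ hn1 (by omega)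
      have h3 : (n : ℝ) * m * 2 ≤ (n : ℝ) * n * n := by gcongr; linarith
      calc _ ≤ _ := h3
        _ = (n : ℝ) ^ 3 := by ring
        _ ≤ _ := this
    rw [← mul_assoc]
    exact mul_le_mul h2 h1 (Real.exp_pos _).le (by positivity)
  have bball : noiseMatLaw n ι (⋃ θ ∈ dirNet n ι, ⋃ t ∈ grid n, ball θ t) ≤
      ENNReal.ofReal ((n : ℝ) ^ (7 * (m + 1)) * E) := by
    calc _ ≤ ∑ θ ∈ dirNet n ι, ∑ t ∈ grid n, noiseMatLaw n ι (ball θ t) :=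
          (measure_biUnion_finset_le _ _).trans
            (Finset.sum_le_sum fun θ _ => measure_biUnion_finset_le _ _)
      _ ≤ ∑ θ ∈ dirNet n ι, ∑ t ∈ grid n, ENNReal.ofReal E := by
          refine Finset.sum_le_sum fun θ hθ => Finset.sum_le_sum fun t _ => ?_
          refine (noiseMatLaw_smallBall_le hy (Finset.mem_filter.1 hθ).2.1 t).trans
            (ENNReal.ofReal_le_ofReal (Real.exp_le_exp.2 ?_))
          linarith
      _ = ENNReal.ofReal ((dirNet n ι).card * ((grid n).card * E)) := by
          rw [Finset.sum_const, Finset.sum_const, nsmul_eq_mul, nsmul_eq_mul,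
            ENNReal.ofReal_mul (p := ((dirNet n ι).card : ℝ)) (by positivity),
            ENNReal.ofReal_mul (p := ((grid n).card : ℝ)) (by positivity),
            ENNReal.ofReal_natCast, ENNReal.ofReal_natCast]
      _ ≤ _ := by
          refine ENNReal.ofReal_le_ofReal ?_
          rw [← mul_assoc, hpow]
          gcongr
  have bexcess : ∀ δ' : ℝ, δ ≤ δ' → noiseMatLaw n ι (⋃ θ ∈ dirNet n ι, excess δ' θ) ≤
      ENNReal.ofReal ((n : ℝ) ^ (7 * (m + 1)) * E) := fun δ' hδ' => by
    calc _ ≤ ∑ θ ∈ dirNet n ι, noiseMatLaw n ι (excess δ' θ) := measure_biUnion_finset_le _ _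
      _ ≤ ∑ θ ∈ dirNet n ι, ENNReal.ofReal E := by
          refine Finset.sum_le_sum fun θ hθ => ?_
          refine (noiseMatLaw_excess_le (Finset.mem_filter.1 hθ).2.2 (hδ.trans_le hδ')).trans
            (ENNReal.ofReal_le_ofReal (Real.exp_le_exp.2 ?_))
          have : δ / 16 * n ≤ δ' / 16 * n := by gcongr
          linarith
      _ = ENNReal.ofReal ((dirNet n ι).card * E) := by
          rw [Finset.sum_const, nsmul_eq_mul,
            ENNReal.ofReal_mul (p := ((dirNet n ι).card : ℝ)) (by positivity),
            ENNReal.ofReal_natCast]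
      _ ≤ _ := ENNReal.ofReal_le_ofReal (mul_le_mul_of_nonneg_right (hcardR.trans hpowle) hE0.le)
  have e4 : 4 * (n : ℝ) ^ (7 * (m + 1)) * E = (n : ℝ) ^ (7 * (m + 1)) * E +
      (n : ℝ) ^ (7 * (m + 1)) * E + (n : ℝ) ^ (7 * (m + 1)) * E + (n : ℝ) ^ (7 * (m + 1)) * E := by
    ring
  have hP : 0 ≤ (n : ℝ) ^ (7 * (m + 1)) * E := by positivity
  rw [e4, ENNReal.ofReal_add (by positivity) hP, ENNReal.ofReal_add (by positivity) hP,
    ENNReal.ofReal_add hP hP]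
  refine (measure_mono hsub).trans ((measure_union_le _ _).trans (add_le_add
    ((measure_union_le _ _).trans (add_le_add ((measure_union_le _ _).trans
      (add_le_add blarge bball)) (bexcess δ le_rfl))) (bexcess 1 hδ1)))

theorem noiseLaw_bad_le {n : ℕ} (hn : 96 ≤ n) {d : ℕ} (hd : 1 ≤ d) (hdn : d ≤ n)
    {y : Fin n → ℝ} (hy : isSign y) {δ : ℝ} (hδ : 0 < δ) (hδ1 : δ ≤ 1) :
    noiseLaw n (NoiseIdx d) {p | ¬ (GoodNoise (Matrix.of p.1) y (2 * δ / (2 * |truncLevel δ| + 1))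
      (4 * δ) (3 + 2 * |truncLevel 1|) ∧ p.2 ⬝ᵥ p.2 ≤ 4 * n)} ≤
      ENNReal.ofReal (5 * (n : ℝ) ^ (7 * d) * Real.exp (-(δ / 16 * n))) := by
  have hnR : (96 : ℝ) ≤ n := by exact_mod_cast hn
  have hcard : Fintype.card (NoiseIdx d) + 1 = d := by
    have h1 : Fintype.card {j : Fin d // (j : ℕ) = 0} = 1 := by
      rw [Fintype.card_eq_one_iff]
      exact ⟨⟨⟨0, hd⟩, rfl⟩, fun j => Subtype.ext (Fin.ext j.2)⟩
    have h2 := Fintype.card_subtype_compl (fun j : Fin d => (j : ℕ) = 0)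
    rw [h1, Fintype.card_fin] at h2
    rw [h2]
    omega
  have hW := noiseMatLaw_bad_le hn (ι := NoiseIdx d) (by omega) hy hδ hδ1
  rw [hcard] at hW
  set A := {W : Fin n → NoiseIdx d → ℝ | ¬ GoodNoise (Matrix.of W) y
    (2 * δ / (2 * |truncLevel δ| + 1)) (4 * δ) (3 + 2 * |truncLevel 1|)} with hA
  set Z := {z : Fin n → ℝ | 4 * (n : ℝ) < z ⬝ᵥ z} with hZ
  have hsub : {p : (Fin n → NoiseIdx d → ℝ) × (Fin n → ℝ) | ¬ (GoodNoise (Matrix.of p.1) y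
      (2 * δ / (2 * |truncLevel δ| + 1)) (4 * δ) (3 + 2 * |truncLevel 1|) ∧ p.2 ⬝ᵥ p.2 ≤ 4 * n)} ⊆
      A ×ˢ Set.univ ∪ Set.univ ×ˢ Z := by
    intro p hp
    by_cases h : GoodNoise (Matrix.of p.1) y
      (2 * δ / (2 * |truncLevel δ| + 1)) (4 * δ) (3 + 2 * |truncLevel 1|)
    · exact Or.inr ⟨trivial, not_le.1 fun h2 => hp ⟨h, h2⟩⟩
    · exact Or.inl ⟨h, trivial⟩
  have h1 : noiseLaw n (NoiseIdx d) (A ×ˢ Set.univ) = noiseMatLaw n (NoiseIdx d) A := by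
    rw [noiseLaw, Measure.prod_prod, measure_univ, mul_one]
  have h2 : noiseLaw n (NoiseIdx d) (Set.univ ×ˢ Z) = stdPi (Fin n) Z := by
    rw [noiseLaw, Measure.prod_prod, measure_univ, one_mul]
  have hZle : stdPi (Fin n) Z ≤
      ENNReal.ofReal ((n : ℝ) ^ (7 * d) * Real.exp (-(δ / 16 * n))) := by
    refine (stdPi_sq_ge_le n).trans (ENNReal.ofReal_le_ofReal ?_)
    have h3 : Real.exp (-n / 2) ≤ Real.exp (-(δ / 16 * n)) := Real.exp_le_exp.2 (by nlinarith)
    have h4 : (1 : ℝ) ≤ (n : ℝ) ^ (7 * d) := one_le_pow₀ (by linarith)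
    exact h3.trans (le_mul_of_one_le_left (Real.exp_pos _).le h4)
  have e5 : 5 * (n : ℝ) ^ (7 * d) * Real.exp (-(δ / 16 * n)) =
      4 * (n : ℝ) ^ (7 * d) * Real.exp (-(δ / 16 * n)) +
        (n : ℝ) ^ (7 * d) * Real.exp (-(δ / 16 * n)) := by ring
  rw [e5, ENNReal.ofReal_add (by positivity) (by positivity)]
  refine (measure_mono hsub).trans ((measure_union_le _ _).trans ?_)
  rw [h1, h2]
  exact add_le_add hW hZle

/-- In the regime `d log n = o(n)` the net cardinality is absorbed by exponential decay. -/
theorem eventually_net_bound {d : ℕ → ℕ}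
    (hdim : Tendsto (fun n : ℕ => (d n : ℝ) * Real.log n / n) atTop (nhds 0)) {r : ℝ} (hr : 0 < r) :
    ∀ᶠ n : ℕ in atTop, d n ≤ n ∧
      5 * (n : ℝ) ^ (7 * d n) * Real.exp (-(r * n)) ≤ Real.exp (-(r / 2 * n)) := by
  have h1 : ∀ᶠ n : ℕ in atTop, (d n : ℝ) * Real.log n / n < min 1 (r / 28) :=
    hdim.eventually_lt_const (by positivity)
  have h2 : ∀ᶠ n : ℕ in atTop, Real.log 5 ≤ r / 4 * n :=
    (tendsto_natCast_atTop_atTop.const_mul_atTop (by positivity)).eventually_ge_atTop _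
  filter_upwards [h1, h2, eventually_ge_atTop 3] with n h1 h2 hn
  have hnR : (3 : ℝ) ≤ n := by exact_mod_cast hn
  have hn0 : (0 : ℝ) < n := by linarith
  have hlog : 1 ≤ Real.log n := by
    rw [Real.le_log_iff_exp_le hn0]
    have := Real.exp_one_lt_d9
    linarith
  rw [div_lt_iff₀ hn0] at h1
  constructor
  · have h3 : min 1 (r / 28) * (n : ℝ) ≤ n := by
      have := min_le_left 1 (r / 28)
      nlinarith
    have h4 : (d n : ℝ) ≤ d n * Real.log n := le_mul_of_one_le_right (by positivity) hlog
    exact_mod_cast h4.trans (h1.le.trans h3)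
  · have h3 : min 1 (r / 28) * (n : ℝ) ≤ r / 28 * n :=
      mul_le_mul_of_nonneg_right (min_le_right _ _) hn0.le
    rw [← Real.exp_log (show (0 : ℝ) < 5 by norm_num), ← Real.exp_log (pow_pos hn0 (7 * d n)),
      ← Real.exp_add, ← Real.exp_add, Real.exp_le_exp, Real.log_pow]
    push_cast
    linarith

theorem eventually_lintegral_misclass_le {d : ℕ → ℕ} (hd : ∀ n, 1 ≤ d n)
    (hdim : Tendsto (fun n : ℕ => (d n : ℝ) * Real.log n / n) atTop (nhds 0)) {ε : ℝ} (hε : 0 < ε)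
    (hε' : ε ≤ 1 / 10) :
    ∃ s c : ℝ, 0 < s ∧ 0 < c ∧ ∀ᶠ n : ℕ in atTop, ∀ y : Fin n → ℝ, isSign y → ∀ snr : ℝ, s ≤ snr →
      ∀ yhat : (Fin n → Fin (d n) → ℝ) → (Fin n → ℝ), (∀ X, isMaxCutOpt X (yhat X)) →
        ∫⁻ X, ENNReal.ofReal (misclass n (yhat X) y) ∂canonLaw n (d n) y snr ≤
          ENNReal.ofReal (4 * Real.exp (-((1 - 5 * ε) ^ 2 * snr) / 2) + Real.exp (-(c * n))) := by
  set T := 3 + 2 * |truncLevel 1| with hT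
  have hT0 : 0 ≤ T := by positivity
  set A := 16 * (1 + 8192 * T) with hA
  have hA0 : 0 < A := by positivity
  set δ := min (ε / 8192) (ε ^ 2 / (10 * A * 8192)) / 4 with hδ
  have hδ0 : 0 < δ := by positivity
  have hδ1 : 8192 * (4 * δ) ≤ ε := by
    have : 4 * δ ≤ ε / 8192 := by rw [hδ]; linarith [min_le_left (ε / 8192) (ε ^ 2 / (10 * A * 8192))]
    linarith
  have hδ2 : 10 * A * (8192 * (4 * δ)) ≤ ε ^ 2 := by
    have : 4 * δ ≤ ε ^ 2 / (10 * A * 8192) := by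
      rw [hδ]; linarith [min_le_right (ε / 8192) (ε ^ 2 / (10 * A * 8192))]
    rw [le_div_iff₀ (by positivity)] at this
    linarith
  set η := 2 * δ / (2 * |truncLevel δ| + 1) with hη
  have hη0 : 0 < η := by positivity
  refine ⟨1 + 10 * A / ε ^ 2 + 5 * A / η + 2 * (1 + ε) / ε, δ / 16 / 2, by positivity, by positivity, ?_⟩
  filter_upwards [eventually_net_bound hdim (r := δ / 16) (by positivity), eventually_ge_atTop 96,
    (tendsto_natCast_atTop_atTop (R := ℝ)).const_mul_atTop hη0 |>.eventually_ge_atTop 1]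
    with n hnet hn hηn y hy snr hs yhat hopt
  have p1 : 0 < 10 * A / ε ^ 2 := by positivity
  have p2 : 0 < 5 * A / η := by positivity
  have p3 : 0 < 2 * (1 + ε) / ε := by positivity
  have hbad := (noiseLaw_bad_le hn (hd n) hnet.1 hy hδ0 (by linarith)).trans
    (ENNReal.ofReal_le_ofReal hnet.2)
  have key := lintegral_misclass_le (hd n) (by omega) hy (snr := snr) (by linarith) hT0
    (δ := 4 * δ) (by positivity) hA hε hε' hδ1 hδ2 hηn (by linarith)
    (by
      have : 10 * A / ε ^ 2 ≤ snr := by linarith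
      rw [div_le_iff₀ (by positivity)] at this
      linarith)
    (by
      have : 5 * A / η ≤ snr := by linarith
      rw [div_le_iff₀ (by positivity)] at this
      linarith)
    (by
      have : 2 * (1 + ε) / ε ≤ snr := by linarith
      rw [div_le_iff₀ (by positivity)] at this
      have h2 : 0 < snr * ε := by nlinarith
      nlinarith) hbad hopt
  refine key.trans (le_of_eq ?_)
  rw [add_comm, ← ENNReal.ofReal_add (by positivity) (by positivity)]

theorem integral_misclass_le {n d : ℕ} {μ : Measure (Fin n → Fin d → ℝ)} {y : Fin n → ℝ}
    {yhat : (Fin n → Fin d → ℝ) → (Fin n → ℝ)} {b : ℝ} (hb : 0 ≤ b)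
    (h : ∫⁻ X, ENNReal.ofReal (misclass n (yhat X) y) ∂μ ≤ ENNReal.ofReal b) :
    ∫ X, misclass n (yhat X) y ∂μ ≤ b := by
  refine (Real.le_norm_self _).trans ((norm_integral_le_lintegral_norm _).trans ?_)
  refine ENNReal.toReal_le_of_le_ofReal hb (le_trans (le_of_eq ?_) h)
  simp_rw [Real.norm_of_nonneg (misclass_nonneg _ _)]

theorem isProbabilityMeasure_canonLaw (n : ℕ) {d : ℕ} (hd : 1 ≤ d) (y : Fin n → ℝ) {snr : ℝ}
    (hs : 0 < snr) : IsProbabilityMeasure (canonLaw n d y snr) := by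
  rw [canonLaw_eq_map n d hd y hs]
  exact Measure.isProbabilityMeasure_map (measurable_dataMatrix _ _ _).aemeasurable

theorem measurable_misclass {n : ℕ} (y : Fin n → ℝ) : Measurable fun u => misclass n u y := by
  have h : ∀ s : ℝ, Measurable fun u : Fin n → ℝ => (Nat.card {i : Fin n // s * u i ≠ y i} : ℝ) := by
    intro s
    have e : (fun u : Fin n → ℝ => (Nat.card {i : Fin n // s * u i ≠ y i} : ℝ)) =
        fun u => ∑ i, if s * u i = y i then (0 : ℝ) else 1 := by
      funext u
      rw [Nat.card_eq_fintype_card, Fintype.card_subtype, ← Finset.sum_boole]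
      exact Finset.sum_congr rfl fun i _ => by simp only [ite_not, ne_eq]
    rw [e]
    exact Finset.measurable_sum _ fun i _ => Measurable.ite
      (measurableSet_eq_fun (by fun_prop) measurable_const) measurable_const measurable_const
  have h1 := h 1
  have h2 := h (-1)
  simp only [one_mul, neg_one_mul] at h1 h2
  exact measurable_const.mul (h1.min h2)

theorem inv_le_misclass {n : ℕ} {u y : Fin n → ℝ} (h : misclass n u y ≠ 0) :
    (n : ℝ)⁻¹ ≤ misclass n u y := by
  unfold misclass at *
  rw [← Nat.cast_min] at *
  have h1 := right_ne_zero_of_mul h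
  have h2 : (1 : ℝ) ≤ ((min (Nat.card {i : Fin n // u i ≠ y i})
      (Nat.card {i : Fin n // -(u i) ≠ y i}) : ℕ) : ℝ) := by
    exact_mod_cast Nat.one_le_iff_ne_zero.2 (by exact_mod_cast h1)
  exact le_mul_of_one_le_right (by positivity) h2

theorem one_sub_le_measure_misclass_eq_zero {n d : ℕ} (hn : 0 < n) {μ : Measure (Fin n → Fin d → ℝ)}
    [IsProbabilityMeasure μ] {y : Fin n → ℝ} {yhat : (Fin n → Fin d → ℝ) → (Fin n → ℝ)}
    (hyhat : Measurable yhat) {b : ℝ} (hb : 0 ≤ b)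
    (h : ∫⁻ X, ENNReal.ofReal (misclass n (yhat X) y) ∂μ ≤ ENNReal.ofReal b) :
    1 - n * b ≤ (μ {X | misclass n (yhat X) y = 0}).toReal := by
  have hnR : (0 : ℝ) < n := by exact_mod_cast hn
  have hm : Measurable fun X => misclass n (yhat X) y := (measurable_misclass y).comp hyhat
  have hset : MeasurableSet {X | misclass n (yhat X) y = 0} :=
    measurableSet_eq_fun hm measurable_const
  have h1 : μ {X | misclass n (yhat X) y = 0}ᶜ ≤ ENNReal.ofReal (n * b) := by
    have h2 := meas_ge_le_lintegral_div (μ := μ) hm.ennreal_ofReal.aemeasurable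
      (ε := ENNReal.ofReal (n : ℝ)⁻¹) (by simpa using hn.ne') ENNReal.ofReal_ne_top
    refine (measure_mono fun X hX => ?_).trans (h2.trans ((ENNReal.div_le_div_right h _).trans
      (le_of_eq ?_)))
    · exact ENNReal.ofReal_le_ofReal (inv_le_misclass hX)
    · rw [← ENNReal.ofReal_div_of_pos (by positivity), div_inv_eq_mul, mul_comm]
  have h3 := ENNReal.toReal_le_of_le_ofReal (by positivity) h1
  have h4 := probReal_compl_eq_one_sub (μ := μ) hset
  simp only [measureReal_def] at h4
  linarith

/-- A diagonal argument: a property holding eventually at each level `1 / (k + 1)` holds along a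
sequence of levels tending to zero, up to finitely many exceptional indices. -/
theorem exists_tendsto_zero_of_eventually {P : ℕ → ℝ → Prop}
    (h : ∀ κ : ℝ, 0 < κ → κ ≤ 1 → ∀ᶠ n in atTop, P n κ) (a : ℝ) :
    ∃ γ : ℕ → ℝ, Tendsto γ atTop (nhds 0) ∧ ∀ n, P n (γ n) ∨ γ n = a := by
  classical
  set k : ℕ → ℕ := fun n => Nat.findGreatest (fun k => P n (1 / ((k : ℝ) + 1))) n with hk
  have hlev : ∀ K : ℕ, ∀ᶠ n in atTop, P n (1 / ((K : ℝ) + 1)) := fun K => by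
    refine h _ (by positivity) ?_
    rw [div_le_one (by positivity)]
    have : (0 : ℝ) ≤ K := Nat.cast_nonneg K
    linarith
  have hk_top : Tendsto k atTop atTop := tendsto_atTop.2 fun K => by
    filter_upwards [hlev K, eventually_ge_atTop K] with n h1 h2
    exact Nat.le_findGreatest h2 h1
  refine ⟨fun n => if P n (1 / (((0 : ℕ) : ℝ) + 1)) then 1 / ((k n : ℝ) + 1) else a, ?_, fun n => ?_⟩
  · refine ((tendsto_one_div_add_atTop_nhds_zero_nat (𝕜 := ℝ)).comp hk_top).congr' ?_
    filter_upwards [hlev 0] with n hn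
    simp only [if_pos hn, Function.comp_apply]
  · by_cases hP : P n (1 / (((0 : ℕ) : ℝ) + 1))
    · left
      simp only [if_pos hP]
      exact Nat.findGreatest_spec (P := fun k => P n (1 / ((k : ℝ) + 1))) (Nat.zero_le n) hP
    · exact Or.inr (if_neg hP)

theorem eventually_log_le (C : ℝ) {c : ℝ} (hc : 0 < c) :
    ∀ᶠ n : ℕ in atTop, C * Real.log n ≤ c * n := by
  have h := ((Real.isLittleO_log_id_atTop.const_mul_left C).bound hc).filter_mono
    (le_refl atTop)
  filter_upwards [tendsto_natCast_atTop_atTop.eventually h] with n hn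
  simpa using (Real.le_norm_self _).trans hn

theorem eventually_integral_misclass_le {d : ℕ → ℕ} (hd : ∀ n, 1 ≤ d n)
    (hdim : Tendsto (fun n : ℕ => (d n : ℝ) * Real.log n / n) atTop (nhds 0))
    {snr : ℕ → ℝ} (hsnr : Tendsto snr atTop atTop) {C : ℝ}
    (hC : ∀ᶠ n : ℕ in atTop, snr n ≤ C * Real.log n) {κ : ℝ} (hκ : 0 < κ) (hκ1 : κ ≤ 1) :
    ∀ᶠ n : ℕ in atTop, ∀ y : Fin n → ℝ, isSign y →
      ∀ yhat : (Fin n → Fin (d n) → ℝ) → (Fin n → ℝ), (∀ X, isMaxCutOpt X (yhat X)) →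
        ∫ X, misclass n (yhat X) y ∂canonLaw n (d n) y (snr n) ≤
          Real.exp (-(snr n) / (2 + κ)) := by
  obtain ⟨s, c, hs, hc, hev⟩ := eventually_lintegral_misclass_le hd hdim (ε := κ / 40)
    (by positivity) (by linarith)
  filter_upwards [hev, hC, eventually_log_le C hc, hsnr.eventually_ge_atTop s,
    hsnr.eventually_ge_atTop (24 * Real.log 5 / κ)] with n hn h1 h2 h3 h4 y hy yhat hopt
  refine (integral_misclass_le (by positivity) (hn y hy (snr n) h3 yhat hopt)).trans ?_
  have hs0 : 0 < snr n := hs.trans_le h3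
  rw [div_le_iff₀ hκ] at h4
  have e1 : Real.exp (-((1 - 5 * (κ / 40)) ^ 2 * snr n) / 2) ≤
      Real.exp (-((1 - κ / 4) * snr n) / 2) := by
    refine Real.exp_le_exp.2 ?_
    have : (1 - κ / 4) * snr n ≤ (1 - 5 * (κ / 40)) ^ 2 * snr n :=
      mul_le_mul_of_nonneg_right (by nlinarith) hs0.le
    linarith
  have e2 : Real.exp (-(c * n)) ≤ Real.exp (-((1 - κ / 4) * snr n) / 2) := by
    refine Real.exp_le_exp.2 ?_
    nlinarith
  have e3 : Real.exp (Real.log 5 + -((1 - κ / 4) * snr n) / 2) ≤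
      Real.exp (-(snr n) / (2 + κ)) := by
    refine Real.exp_le_exp.2 ?_
    rw [le_div_iff₀ (by linarith)]
    have h5 : Real.log 5 * (2 + κ) ≤ snr n * κ / 24 * (2 + κ) :=
      mul_le_mul_of_nonneg_right (by linarith) (by linarith)
    have h6 : 0 ≤ snr n * κ * (1 - κ) := by have := sub_nonneg.2 hκ1; positivity
    nlinarith
  rw [Real.exp_add, Real.exp_log (by norm_num)] at e3
  linarith

theorem eventually_measure_misclass_eq_zero_ge {d : ℕ → ℕ} (hd : ∀ n, 1 ≤ d n)
    (hdim : Tendsto (fun n : ℕ => (d n : ℝ) * Real.log n / n) atTop (nhds 0))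
    {snr : ℕ → ℝ} {κ : ℝ} (hκ : 0 < κ) (hκ1 : κ ≤ 1)
    (hsnr : ∀ᶠ n : ℕ in atTop, (2 + κ) * Real.log n ≤ snr n) :
    ∃ b : ℕ → ℝ, Tendsto b atTop (nhds 0) ∧ ∀ᶠ n : ℕ in atTop, ∀ y : Fin n → ℝ, isSign y →
      ∀ yhat : (Fin n → Fin (d n) → ℝ) → (Fin n → ℝ), Measurable yhat →
        (∀ X, isMaxCutOpt X (yhat X)) →
          1 - b n ≤ (canonLaw n (d n) y (snr n) {X | misclass n (yhat X) y = 0}).toReal := by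
  obtain ⟨s, c, hs, hc, hev⟩ := eventually_lintegral_misclass_le hd hdim (ε := κ / 40)
    (by positivity) (by linarith)
  have hlog : Tendsto (fun n : ℕ => Real.log n) atTop atTop :=
    Real.tendsto_log_atTop.comp tendsto_natCast_atTop_atTop
  refine ⟨fun n => 4 * Real.exp (-(κ / 8 * Real.log n)) + n * Real.exp (-(c * n)), ?_, ?_⟩
  · have t1 : Tendsto (fun n : ℕ => Real.exp (-(κ / 8 * Real.log n))) atTop (nhds 0) :=
      Real.tendsto_exp_neg_atTop_nhds_zero.comp (hlog.const_mul_atTop (by positivity))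
    have t2 : Tendsto (fun n : ℕ => (n : ℝ) * Real.exp (-(c * n))) atTop (nhds 0) := by
      have h := (Real.tendsto_pow_mul_exp_neg_atTop_nhds_zero 1).comp
        ((tendsto_natCast_atTop_atTop (R := ℝ)).const_mul_atTop hc)
      have h' := h.const_mul c⁻¹
      rw [mul_zero] at h'
      refine h'.congr fun n => ?_
      simp only [Function.comp_apply, pow_one]
      field_simp
    simpa using (t1.const_mul 4).add t2
  · filter_upwards [hev, hsnr, hlog.eventually_ge_atTop s, eventually_ge_atTop 1]
      with n hn h1 h2 h3 y hy yhat hmeas hopt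
    have hnR : (0 : ℝ) < n := by exact_mod_cast h3
    have hL : 0 < Real.log n := hs.trans_le h2
    have hsn : s ≤ snr n := by nlinarith
    have := isProbabilityMeasure_canonLaw n (hd n) y (hs.trans_le hsn)
    refine le_trans ?_ (one_sub_le_measure_misclass_eq_zero h3 hmeas (by positivity)
      (hn y hy (snr n) hsn yhat hopt))
    have e1 : (n : ℝ) * Real.exp (-((1 - 5 * (κ / 40)) ^ 2 * snr n) / 2) ≤
        Real.exp (-(κ / 8 * Real.log n)) := by
      nth_rewrite 1 [← Real.exp_log hnR]
      rw [← Real.exp_add]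
      refine Real.exp_le_exp.2 ?_
      have h4 : (2 + κ / 4) * Real.log n ≤ (1 - 5 * (κ / 40)) ^ 2 * snr n := by
        calc _ ≤ (1 - 5 * (κ / 40)) ^ 2 * ((2 + κ) * Real.log n) := by
              rw [← mul_assoc]
              refine mul_le_mul_of_nonneg_right ?_ hL.le
              nlinarith [mul_nonneg hκ.le (sub_nonneg.2 hκ1), pow_pos hκ 3]
          _ ≤ _ := mul_le_mul_of_nonneg_left h1 (sq_nonneg _)
      linarith
    linarith

/-- statistical guarantees for maximizers of the Max-Cut integer program in the
canonical model, for `d_n log n / n → 0`.  Part 1: if `SNR_n → ∞` and `SNR_n ≤ C log n`,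
the expected misclassification proportion is at most `exp(-SNR_n/(2+γ_n))` uniformly in
`y⋆` and in the chosen maximizer; part 2: if `SNR_n > (2+ε) log n`, exact recovery holds
with probability `1 - γ'_n`, with `γ'_n → 0` not depending on `y⋆`. -/
theorem maxcut_statistical_guarantee (d : ℕ → ℕ) (hd : ∀ n, 1 ≤ d n)
    (hdim : Tendsto (fun n : ℕ => (d n : ℝ) * Real.log n / n) atTop (nhds 0))
    (snr : ℕ → ℝ) (hpos : ∀ n, 0 < snr n) :
    ((Tendsto snr atTop atTop → ∀ C : ℝ, 0 < C →
      (∀ᶠ n : ℕ in atTop, snr n ≤ C * Real.log n) →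
      ∃ γ : ℕ → ℝ, Tendsto γ atTop (nhds 0) ∧
        ∀ n : ℕ, ∀ ystar : Fin n → ℝ, isSign ystar →
          ∀ yhat : (Fin n → Fin (d n) → ℝ) → (Fin n → ℝ), Measurable yhat →
            (∀ X, isMaxCutOpt X (yhat X)) →
            (∫ X, misclass n (yhat X) ystar ∂(canonLaw n (d n) ystar (snr n))) ≤
              Real.exp (-(snr n) / (2 + γ n))) ∧
    (∀ ε : ℝ, 0 < ε → (∀ᶠ n : ℕ in atTop, (2 + ε) * Real.log n < snr n) →
      ∃ γ' : ℕ → ℝ, Tendsto γ' atTop (nhds 0) ∧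
        ∀ n : ℕ, ∀ ystar : Fin n → ℝ, isSign ystar →
          ∀ yhat : (Fin n → Fin (d n) → ℝ) → (Fin n → ℝ), Measurable yhat →
            (∀ X, isMaxCutOpt X (yhat X)) →
            1 - γ' n ≤
              (canonLaw n (d n) ystar (snr n) {X | misclass n (yhat X) ystar = 0}).toReal)) := by
  constructor
  · intro hsnr C _ hC
    obtain ⟨γ, hγ, hP⟩ := exists_tendsto_zero_of_eventually
      (fun κ hκ hκ1 => eventually_integral_misclass_le hd hdim hsnr hC hκ hκ1) (-2)
    refine ⟨γ, hγ, fun n ystar hy yhat _ hopt => ?_⟩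
    rcases hP n with h | h
    · exact h ystar hy yhat hopt
    · have := isProbabilityMeasure_canonLaw n (hd n) ystar (hpos n)
      rw [h, add_neg_cancel, div_zero, Real.exp_zero]
      refine integral_misclass_le zero_le_one ?_
      calc _ ≤ ∫⁻ _, ENNReal.ofReal 1 ∂canonLaw n (d n) ystar (snr n) :=
            lintegral_mono fun X => ENNReal.ofReal_le_ofReal (misclass_le_one _ _)
        _ = ENNReal.ofReal 1 := by rw [lintegral_const, measure_univ, mul_one]
  · intro ε hε hsnr
    classical
    obtain ⟨b, hb, hev⟩ := eventually_measure_misclass_eq_zero_ge hd hdim (snr := snr)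
      (κ := min ε 1) (by positivity) (min_le_right _ _) (by
        filter_upwards [hsnr, eventually_ge_atTop 1] with n hn h1
        have hL : 0 ≤ Real.log n := Real.log_nonneg (by exact_mod_cast h1)
        exact (mul_le_mul_of_nonneg_right (by linarith [min_le_left ε 1]) hL).trans hn.le)
    set G : ℕ → Prop := fun n => ∀ y : Fin n → ℝ, isSign y →
      ∀ yhat : (Fin n → Fin (d n) → ℝ) → (Fin n → ℝ), Measurable yhat →
        (∀ X, isMaxCutOpt X (yhat X)) →
          1 - b n ≤ (canonLaw n (d n) y (snr n) {X | misclass n (yhat X) y = 0}).toReal with hG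
    refine ⟨fun n => if G n then b n else 1, hb.congr' ?_, fun n ystar hy yhat hmeas hopt => ?_⟩
    · filter_upwards [hev] with n hn
      exact (if_pos hn).symm
    · by_cases h : G n
      · simp only [if_pos h]
        exact h ystar hy yhat hmeas hopt
      · simp only [if_neg h, sub_self]
        exact ENNReal.toReal_nonneg
end
end

section
/- Fix n ≥ d ≥ 1, y* ∈ {±1}^n, SNR > 0, σ = 1/√(1+SNR), z ∈ ℝ^n and W ∈ ℝ^{n×(d−1)}. Let X = (√(1−σ²) y* + σ z, W) ∈ ℝ^{n×d}, assume X has rank d, and let H = X(X^T X)^{−1} X^T. Then for every y ∈ {±1}^n: (i) y*^T H y* − y^T H y = ‖(I − H)(y − y*)‖_2² − (2/√SNR) ⟨y − y*, (I − H) z⟩; (ii) if S = {i ∈ [n] : y_i ≠ y_i*} is nonempty, then for every real p ∈ [1, ∞), y*^T H y* − y^T H y ≥ 4|S| (1 − ‖H(y − y*)‖_2²/‖y − y*‖_2² − ‖(I − H) z‖_p/(|S|^{1/p} √SNR)), and the same bound holds with the supremum norm ‖(I − H) z‖_∞ in place of ‖(I − H) z‖_p and with |S|^{1/p} replaced by 1.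 -/
open Real Matrix

noncomputable section

/-- Squared Euclidean norm. -/
def sqnorm {m : ℕ} (v : Fin m → ℝ) : ℝ := ∑ i, v i ^ 2

/-- `ℓ_p` norm, `1 ≤ p < ∞`. -/
def pnorm {m : ℕ} (p : ℝ) (v : Fin m → ℝ) : ℝ := (∑ i, |v i| ^ p) ^ (1 / p)

/-- supremum norm. -/
def supnorm {m : ℕ} (v : Fin m → ℝ) : ℝ := ⨆ i, |v i|

theorem Matrix.isUnit_transpose_mul_self_of_rank_eq {n d : ℕ} (A : Matrix (Fin n) (Fin d) ℝ)
    (hA : A.rank = d) : IsUnit (Aᵀ * A) := by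
  rw [← Matrix.linearIndependent_cols_iff_isUnit, linearIndependent_iff_card_eq_finrank_span,
    Set.finrank, ← Matrix.rank_eq_finrank_span_cols, Matrix.rank_transpose_mul_self, hA,
    Fintype.card_fin]

theorem Hmat_transpose {n d : ℕ} (X : Fin n → Fin d → ℝ) : (Hmat X)ᵀ = Hmat X := by
  simp [Hmat, Matrix.transpose_mul, Matrix.transpose_nonsing_inv, Matrix.mul_assoc]

theorem Hmat_mul_of {n d : ℕ} (X : Fin n → Fin d → ℝ) (hX : (Matrix.of X).rank = d) :
    Hmat X * Matrix.of X = Matrix.of X := by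
  have hu := (Matrix.isUnit_iff_isUnit_det _).1
    (Matrix.isUnit_transpose_mul_self_of_rank_eq (Matrix.of X) hX)
  rw [Hmat, Matrix.mul_assoc, Matrix.mul_assoc, Matrix.nonsing_inv_mul _ hu, Matrix.mul_one]

theorem Hmat_mul_self {n d : ℕ} (X : Fin n → Fin d → ℝ) (hX : (Matrix.of X).rank = d) :
    Hmat X * Hmat X = Hmat X := by
  nth_rewrite 2 [Hmat]
  rw [← Matrix.mul_assoc, ← Matrix.mul_assoc, Hmat_mul_of X hX, Hmat]

theorem sqnorm_eq_dotProduct {m : ℕ} (v : Fin m → ℝ) : sqnorm v = v ⬝ᵥ v := by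
  simp [sqnorm, dotProduct, sq]

/-- For a symmetric idempotent matrix `P`, `‖P v‖² = vᵀ P v`. -/
theorem sqnorm_mulVec_of_idempotent {m : ℕ} (P : Matrix (Fin m) (Fin m) ℝ) (hT : Pᵀ = P)
    (hP : P * P = P) (v : Fin m → ℝ) : sqnorm (P *ᵥ v) = v ⬝ᵥ (P *ᵥ v) := by
  rw [sqnorm_eq_dotProduct, Matrix.dotProduct_mulVec, Matrix.vecMul_mulVec, hT, hP,
    ← Matrix.dotProduct_mulVec]

theorem dotProduct_mulVec_comm_of_symm {m : ℕ} (P : Matrix (Fin m) (Fin m) ℝ) (hT : Pᵀ = P)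
    (u v : Fin m → ℝ) : u ⬝ᵥ (P *ᵥ v) = v ⬝ᵥ (P *ᵥ u) := by
  rw [Matrix.dotProduct_mulVec, ← Matrix.mulVec_transpose, hT, dotProduct_comm]

theorem isSign.sq_eq_one {m : ℕ} {v : Fin m → ℝ} (hv : isSign v) (i : Fin m) : v i ^ 2 = 1 := by
  rcases hv i with h | h <;> simp [h]

theorem isSign.dotProduct_self_s4 {m : ℕ} {v : Fin m → ℝ} (hv : isSign v) : v ⬝ᵥ v = m := by
  simp [← sqnorm_eq_dotProduct, sqnorm, hv.sq_eq_one]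

theorem isSign.abs_sub_of_ne {m : ℕ} {u v : Fin m → ℝ} (hu : isSign u) (hv : isSign v)
    {i : Fin m} (h : u i ≠ v i) : |u i - v i| = 2 := by
  rcases hu i with h1 | h1 <;> rcases hv i with h2 | h2 <;>
    first | exact absurd (h1.trans h2.symm) h | (rw [h1, h2]; norm_num)

theorem isSign.sqnorm_sub {m : ℕ} {u v : Fin m → ℝ} (hu : isSign u) (hv : isSign v) :
    sqnorm (u - v) = 4 * (Finset.univ.filter fun i => u i ≠ v i).card := by
  have h : ∀ i, (u - v) i ^ 2 = if u i ≠ v i then 4 else 0 := fun i => by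
    split_ifs with h
    · rw [Pi.sub_apply, ← sq_abs, hu.abs_sub_of_ne hv h]; norm_num
    · simp [not_not.1 h]
  simp only [sqnorm, h, Finset.sum_ite, Finset.sum_const, nsmul_eq_mul, mul_zero, add_zero]
  ring

theorem isSign.dotProduct_sub_le {m : ℕ} {u v : Fin m → ℝ} (hu : isSign u) (hv : isSign v)
    (w : Fin m → ℝ) :
    (u - v) ⬝ᵥ w ≤ 2 * ∑ i ∈ Finset.univ.filter (fun i => u i ≠ v i), |w i| := by
  rw [Finset.mul_sum, Finset.sum_filter]
  refine Finset.sum_le_sum fun i _ => ?_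
  split_ifs with h
  · rw [← hu.abs_sub_of_ne hv h, ← abs_mul]
    exact le_abs_self _
  · simp [not_not.1 h]

theorem sum_abs_le_card_mul_pnorm {m : ℕ} (s : Finset (Fin m)) (hs : 0 < s.card) {p : ℝ}
    (hp : 1 ≤ p) (w : Fin m → ℝ) :
    ∑ i ∈ s, |w i| ≤ s.card * (pnorm p w / (s.card : ℝ) ^ (1 / p)) := by
  have hc : (0 : ℝ) < s.card := by exact_mod_cast hs
  have hp0 : 0 < p := by linarith
  have hW : 0 ≤ ∑ i, |w i| ^ p := Finset.sum_nonneg fun i _ => by positivity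
  have hle : (∑ i ∈ s, |w i|) ^ p ≤ (s.card : ℝ) ^ (p - 1) * ∑ i, |w i| ^ p :=
    (Real.rpow_sum_le_const_mul_sum_rpow s w hp).trans <| by
      gcongr
      exact Finset.subset_univ s
  have hS : 0 ≤ ∑ i ∈ s, |w i| := Finset.sum_nonneg fun i _ => abs_nonneg _
  have hR : 0 ≤ s.card * (pnorm p w / (s.card : ℝ) ^ (1 / p)) := by
    unfold pnorm; positivity
  rw [← Real.rpow_le_rpow_iff hS hR hp0]
  refine hle.trans_eq ?_
  rw [Real.mul_rpow hc.le (by unfold pnorm; positivity), Real.div_rpow (by unfold pnorm; positivity)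
    (by positivity), pnorm, ← Real.rpow_mul hW, ← Real.rpow_mul hc.le, one_div_mul_cancel hp0.ne',
    Real.rpow_one, Real.rpow_one, Real.rpow_sub_one hc.ne']
  ring

theorem sum_abs_le_card_mul_supnorm {m : ℕ} (s : Finset (Fin m)) (w : Fin m → ℝ) :
    ∑ i ∈ s, |w i| ≤ s.card * supnorm w := by
  rw [← nsmul_eq_mul]
  exact Finset.sum_le_card_nsmul _ _ _ fun i _ =>
    le_ciSup (f := fun i => |w i|) (Set.finite_range _).bddAbove i

/-- deterministic optimality gap of the Max-Cut objective. Here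
`σ = 1/√(1+SNR)`, the first column of `X` is `√(1-σ²) y⋆ + σ z` (the other columns forming
an arbitrary matrix `W`), `X` has rank `d`, and `S = {i : yᵢ ≠ y⋆ᵢ}`. -/
theorem deterministic_optimality_gap {n d : ℕ} (hd : 0 < d) (hnd : d ≤ n) (hn : 1 ≤ n)
    (ystar : Fin n → ℝ) (hystar : isSign ystar) (snr : ℝ) (hsnr : 0 < snr)
    (z : Fin n → ℝ) (X : Fin n → Fin d → ℝ)
    (hcol : ∀ i, X i ⟨0, hd⟩ =
      Real.sqrt (1 - (1 / Real.sqrt (1 + snr)) ^ 2) * ystar i +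
        1 / Real.sqrt (1 + snr) * z i)
    (hrank : (Matrix.of X).rank = d) :
    ∀ y : Fin n → ℝ, isSign y →
      (ystar ⬝ᵥ (Hmat X *ᵥ ystar) - y ⬝ᵥ (Hmat X *ᵥ y) =
        sqnorm (((1 : Matrix (Fin n) (Fin n) ℝ) - Hmat X) *ᵥ (y - ystar)) -
          2 / Real.sqrt snr *
            ((y - ystar) ⬝ᵥ (((1 : Matrix (Fin n) (Fin n) ℝ) - Hmat X) *ᵥ z))) ∧
      (0 < Nat.card {i : Fin n // y i ≠ ystar i} →
        (∀ p : ℝ, 1 ≤ p →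
          4 * (Nat.card {i : Fin n // y i ≠ ystar i} : ℝ) *
            (1 - sqnorm (Hmat X *ᵥ (y - ystar)) / sqnorm (y - ystar) -
              pnorm p (((1 : Matrix (Fin n) (Fin n) ℝ) - Hmat X) *ᵥ z) /
                ((Nat.card {i : Fin n // y i ≠ ystar i} : ℝ) ^ (1 / p) * Real.sqrt snr)) ≤
            ystar ⬝ᵥ (Hmat X *ᵥ ystar) - y ⬝ᵥ (Hmat X *ᵥ y)) ∧
        4 * (Nat.card {i : Fin n // y i ≠ ystar i} : ℝ) *
            (1 - sqnorm (Hmat X *ᵥ (y - ystar)) / sqnorm (y - ystar) -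
              supnorm (((1 : Matrix (Fin n) (Fin n) ℝ) - Hmat X) *ᵥ z) /
                (1 * Real.sqrt snr)) ≤
          ystar ⬝ᵥ (Hmat X *ᵥ ystar) - y ⬝ᵥ (Hmat X *ᵥ y)) := by
  intro y hy
  set H := Hmat X with hH
  set Q := (1 : Matrix (Fin n) (Fin n) ℝ) - H with hQ
  have hHT : Hᵀ = H := Hmat_transpose X
  have hHH : H * H = H := Hmat_mul_self X hrank
  have hQT : Qᵀ = Q := by rw [hQ, Matrix.transpose_sub, Matrix.transpose_one, hHT]
  have hQQ : Q * Q = Q := by rw [hQ, sub_mul, mul_sub H, hHH]; simp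
  have hQv : ∀ v, Q *ᵥ v = v - H *ᵥ v := fun v => by rw [hQ, Matrix.sub_mulVec, Matrix.one_mulVec]
  have hr : 0 < Real.sqrt snr := Real.sqrt_pos.2 hsnr
  have ht : 0 < Real.sqrt (1 + snr) := Real.sqrt_pos.2 (by linarith)
  have hσ : Real.sqrt (1 - (1 / Real.sqrt (1 + snr)) ^ 2) =
      Real.sqrt snr / Real.sqrt (1 + snr) := by
    rw [← Real.sqrt_div hsnr.le, div_pow, Real.sq_sqrt (by linarith)]
    congr 1
    field_simp
    ring
  have hcol' : (fun i => X i ⟨0, hd⟩) =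
      (1 / Real.sqrt (1 + snr)) • (Real.sqrt snr • ystar + z) := by
    ext i
    simp only [hcol, hσ, Pi.smul_apply, Pi.add_apply, smul_eq_mul]
    ring
  have hQx : Q *ᵥ (fun i => X i ⟨0, hd⟩) = 0 := by
    rw [hQv, sub_eq_zero]
    ext i
    exact (congrFun (congrFun (Hmat_mul_of X hrank) i) ⟨0, hd⟩).symm
  have hQy : Q *ᵥ ystar = -(1 / Real.sqrt snr) • (Q *ᵥ z) := by
    rw [hcol', Matrix.mulVec_smul, smul_eq_zero_iff_right (by positivity), Matrix.mulVec_add,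
      Matrix.mulVec_smul, add_eq_zero_iff_eq_neg] at hQx
    rw [neg_smul, ← smul_neg, ← hQx, smul_smul, one_div_mul_cancel hr.ne', one_smul]
  have hgap : ystar ⬝ᵥ (H *ᵥ ystar) - y ⬝ᵥ (H *ᵥ y) =
      sqnorm (Q *ᵥ (y - ystar)) - 2 / Real.sqrt snr * ((y - ystar) ⬝ᵥ (Q *ᵥ z)) := by
    have hform : ∀ v, isSign v → v ⬝ᵥ (H *ᵥ v) = n - v ⬝ᵥ (Q *ᵥ v) := fun v hv => by
      rw [hQv, dotProduct_sub, hv.dotProduct_self_s4]; ring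
    have hexp : sqnorm (Q *ᵥ (y - ystar)) =
        y ⬝ᵥ (Q *ᵥ y) - ystar ⬝ᵥ (Q *ᵥ ystar) - 2 * ((y - ystar) ⬝ᵥ (Q *ᵥ ystar)) := by
      rw [sqnorm_mulVec_of_idempotent Q hQT hQQ, Matrix.mulVec_sub, dotProduct_sub,
        sub_dotProduct, sub_dotProduct, dotProduct_mulVec_comm_of_symm Q hQT ystar y]
      ring
    rw [hform _ hystar, hform _ hy, hexp, hQy, dotProduct_smul, dotProduct_smul, smul_eq_mul,
      smul_eq_mul]
    ring
  refine ⟨hgap, ?_⟩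
  rw [Nat.card_eq_fintype_card, Fintype.card_subtype]
  set s := Finset.univ.filter fun i => y i ≠ ystar i with hs
  intro hpos
  have hc : (0 : ℝ) < s.card := by exact_mod_cast hpos
  have hu : sqnorm (y - ystar) = 4 * s.card := hy.sqnorm_sub hystar
  have hpyth : sqnorm (Q *ᵥ (y - ystar)) = 4 * s.card - sqnorm (H *ᵥ (y - ystar)) := by
    rw [sqnorm_mulVec_of_idempotent Q hQT hQQ, sqnorm_mulVec_of_idempotent H hHT hHH, hQv,
      dotProduct_sub, ← sqnorm_eq_dotProduct, hu]
  have hbound : ∀ B : ℝ, ∑ i ∈ s, |(Q *ᵥ z) i| ≤ s.card * B →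
      4 * (s.card : ℝ) * (1 - sqnorm (H *ᵥ (y - ystar)) / sqnorm (y - ystar) -
        B / Real.sqrt snr) ≤ ystar ⬝ᵥ (H *ᵥ ystar) - y ⬝ᵥ (H *ᵥ y) := fun B hB => by
    have hdot : 2 / Real.sqrt snr * ((y - ystar) ⬝ᵥ (Q *ᵥ z)) ≤
        2 / Real.sqrt snr * (2 * (s.card * B)) := by
      gcongr
      exact (hy.dotProduct_sub_le hystar _).trans (by gcongr)
    have hexpand : 4 * (s.card : ℝ) * (1 - sqnorm (H *ᵥ (y - ystar)) / (4 * s.card) -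
        B / Real.sqrt snr) = 4 * s.card - sqnorm (H *ᵥ (y - ystar)) -
          2 / Real.sqrt snr * (2 * (s.card * B)) := by
      field_simp
      ring
    rw [hgap, hpyth, hu, hexpand]
    linarith
  refine ⟨fun p hp => ?_, ?_⟩
  · rw [← div_div]
    exact hbound _ (sum_abs_le_card_mul_pnorm s hpos hp _)
  · rw [one_mul]
    exact hbound _ (sum_abs_le_card_mul_supnorm s _)
end
end
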